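/- arXiv:2603.05736 — 2 statements merged into one kernel-verified Lean document; each statement's English description precedes it below -/
import Mathlib

section
/- Let s ≥ 0 and 2 ≤ m_1 ≤ m_2 ≤ ⋯ ≤ m_t be integers, set m = m_1 + ⋯ + m_t and n = s + m. If m ≤ 10, n is odd, and n(n−1) ≡ 0 (mod 2m), then HOP(2^⟨s⟩, 2m_1, …, 2m_t) has a solution. -/
/-- The vertex set of the complete graph `K_{2n}`: the `n` couples are indexed by `Fin n`,
and the two members of a couple by `Fin 2`. -/
abbrev HOPVertex (n : ℕ) : Type := Fin n × Fin 2

/-- The spouse of a participant: the other member of the same couple. -/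
def HOPspouse {n : ℕ} (v : HOPVertex n) : HOPVertex n := (v.1, v.2 + 1)

/-- An edge of `K_{2n}` is an `I`-edge (an edge of the distinguished perfect matching `I`)
if it joins a participant to their spouse. -/
def IsIEdge {n : ℕ} (e : Sym2 (HOPVertex n)) : Prop :=
  ∃ v, e = s(v, HOPspouse v)

/-- An `I`-alternating `(K_2^⟨s⟩, C_{2m_1}, …, C_{2m_t})`-factor of `K_{2n}`:
a spanning subgraph of `K_{2n}` which is a vertex-disjoint union of `s` edges of `I`
(one for each `a : Fin s`, namely the edge joining `pair a` to its spouse) together with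
`t` cycles, the `i`-th of which has length `2 * m i` (given by the cyclic vertex sequence
`cyc i : ZMod (2 * m i) → HOPVertex n`), such that along each cycle the edges alternate
between `I`-edges (at even positions) and non-`I`-edges (at odd positions).
The field `spanning` says that the listed vertices are pairwise distinct and exhaust the
whole vertex set; in particular each `cyc i` is injective, so it really traces a cycle. -/
structure HOPFactor (n s t : ℕ) (m : Fin t → ℕ) : Type where
  pair : Fin s → HOPVertex n
  cyc : (i : Fin t) → ZMod (2 * m i) → HOPVertex n
  alt_even : ∀ (i : Fin t) (j : ZMod (2 * m i)),
      j.val % 2 = 0 → cyc i (j + 1) = HOPspouse (cyc i j)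
  alt_odd : ∀ (i : Fin t) (j : ZMod (2 * m i)),
      j.val % 2 = 1 → ¬ IsIEdge s(cyc i j, cyc i (j + 1))
  spanning : Function.Bijective
      (Sum.elim
        (fun a : Fin s × Fin 2 => if a.2 = 0 then pair a.1 else HOPspouse (pair a.1))
        (fun x : (i : Fin t) × ZMod (2 * m i) => cyc x.1 x.2))

/-- The edge set of an `I`-alternating `(K_2^⟨s⟩, C_{2m_1}, …, C_{2m_t})`-factor. -/
def HOPFactor.edges {n s t : ℕ} {m : Fin t → ℕ} (F : HOPFactor n s t m) :
    Set (Sym2 (HOPVertex n)) :=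
  {e | (∃ a : Fin s, e = s(F.pair a, HOPspouse (F.pair a))) ∨
    ∃ (i : Fin t) (j : ZMod (2 * m i)), e = s(F.cyc i j, F.cyc i (j + 1))}

/-- A solution to the generalized Honeymoon Oberwolfach Problem
`HOP(2^⟨s⟩, 2 m_1, …, 2 m_t)`: a family of `γ` `I`-alternating
`(K_2^⟨s⟩, C_{2m_1}, …, C_{2m_t})`-factors of `K_{2n}`, where `γ` is the natural number
with `γ * (m_1 + ⋯ + m_t) = 2n(n-1)`, such that every edge of `K_{2n}` that is not an
`I`-edge lies in exactly one factor of the family. -/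
def HOPSolution (n s t : ℕ) (m : Fin t → ℕ) : Prop :=
  ∃ γ : ℕ, γ * (∑ i, m i) = 2 * n * (n - 1) ∧
    ∃ F : Fin γ → HOPFactor n s t m,
      ∀ e : Sym2 (HOPVertex n), ¬ e.IsDiag → ¬ IsIEdge e →
        ∃! k : Fin γ, e ∈ (F k).edges

/-! ### Abstract decompositions into lifted blocks

A couple `v : V` has two members `(v, 0)` and `(v, 1)`.  A block is a map
`b : J → V × Fin 2`, injective on couples, where `J` carries a successor map `nx` describing a
disjoint union of cycles: the couple of `b j` is entered at the member `b j` and is left at its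
spouse, from which we go to `b (nx j)`. -/

namespace HOPAux

/-- The directed version of the non-spouse edge leaving position `j` of a block. -/
def dart {J V : Type} (nx : J → J) (b : J → V × Fin 2) (j : J) (d : Bool) :
    (V × Fin 2) × (V × Fin 2) :=
  if d then (b (nx j), ((b j).1, (b j).2 + 1)) else (((b j).1, (b j).2 + 1), b (nx j))

/-- `Dec nx R` : the lifted edges described by `R` can be partitioned into blocks. -/
def Dec {J : Type} (nx : J → J) {V : Type} (R : V × Fin 2 → V × Fin 2 → Prop) : Prop :=
  ∃ (ι : Type) (_ : Fintype ι) (B : ι → J → V × Fin 2),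
    (∀ i, Function.Injective fun j => (B i j).1) ∧
    (∀ i j d, R (dart nx (B i) j d).1 (dart nx (B i) j d).2) ∧
    ∀ p q, R p q → ∃! x : ι × J × Bool, dart nx (B x.1) x.2.1 x.2.2 = (p, q)

theorem dart_not {J V : Type} (nx : J → J) (b : J → V × Fin 2) (j : J) (d : Bool) :
    dart nx b j (!d) = (dart nx b j d).swap := by
  cases d <;> rfl

theorem Dec.symm {J : Type} {nx : J → J} {V : Type} {R : V × Fin 2 → V × Fin 2 → Prop}
    (h : Dec nx R) {p q} (hpq : R p q) : R q p := by
  obtain ⟨ι, _, B, -, h2, h3⟩ := h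
  obtain ⟨⟨i, j, d⟩, hx, -⟩ := h3 p q hpq
  have := h2 i j (!d)
  rw [dart_not] at this
  simp only at hx
  rw [hx] at this
  exact this

theorem Dec.congr {J : Type} {nx : J → J} {V : Type} {R R' : V × Fin 2 → V × Fin 2 → Prop}
    (h : Dec nx R) (hR : ∀ p q, R p q ↔ R' p q) : Dec nx R' := by
  have : R = R' := by
    funext p q
    exact propext (hR p q)
  exact this ▸ h

/-- The map on members induced by a map on couples. -/
def lift2 {V W : Type} (φ : V → W) (p : V × Fin 2) : W × Fin 2 := (φ p.1, p.2)

theorem lift2_injective {V W : Type} {φ : V → W} (hφ : Function.Injective φ) :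
    Function.Injective (lift2 φ) := by
  rintro ⟨a, b⟩ ⟨c, d⟩ h
  simp only [lift2, Prod.mk.injEq] at h
  rw [hφ h.1, h.2]

theorem dart_lift2 {J V W : Type} (nx : J → J) (b : J → V × Fin 2) (φ : V → W) (j : J)
    (d : Bool) :
    dart nx (fun j => lift2 φ (b j)) j d =
      (lift2 φ (dart nx b j d).1, lift2 φ (dart nx b j d).2) := by
  cases d <;> rfl

theorem Dec.map {J : Type} {nx : J → J} {V W : Type} {R : V × Fin 2 → V × Fin 2 → Prop}
    (h : Dec nx R) (φ : V → W) (hφ : Function.Injective φ) :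
    Dec nx (fun p q => ∃ p' q', R p' q' ∧ p = lift2 φ p' ∧ q = lift2 φ q') := by
  obtain ⟨ι, _, B, h1, h2, h3⟩ := h
  refine ⟨ι, inferInstance, fun i j => lift2 φ (B i j), ?_, ?_, ?_⟩
  · intro i j j' hj
    exact h1 i (hφ hj)
  · intro i j d
    rw [dart_lift2]
    exact ⟨_, _, h2 i j d, rfl, rfl⟩
  · rintro p q ⟨p', q', hR, rfl, rfl⟩
    obtain ⟨x, hx, hu⟩ := h3 p' q' hR
    refine ⟨x, ?_, ?_⟩
    · simp only at hx ⊢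
      rw [dart_lift2, hx]
    · intro y hy
      apply hu
      simp only at hy ⊢
      rw [dart_lift2] at hy
      simp only [Prod.mk.injEq] at hy
      exact Prod.ext (lift2_injective hφ hy.1) (lift2_injective hφ hy.2)

theorem Dec.mapEquiv {J : Type} {nx : J → J} {V W : Type}
    {R : V × Fin 2 → V × Fin 2 → Prop} (h : Dec nx R) (e : W ≃ V) :
    Dec nx (fun p q => R (lift2 e p) (lift2 e q)) := by
  refine (h.map e.symm e.symm.injective).congr ?_
  rintro ⟨p, a⟩ ⟨q, b⟩
  constructor
  · rintro ⟨⟨p', a'⟩, ⟨q', b'⟩, hR, h1, h2⟩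
    simp only [lift2, Prod.mk.injEq] at h1 h2 ⊢
    obtain ⟨rfl, rfl⟩ := h1
    obtain ⟨rfl, rfl⟩ := h2
    simpa using hR
  · intro hR
    exact ⟨_, _, hR, by simp [lift2], by simp [lift2]⟩

theorem Dec.union {J : Type} {nx : J → J} {V κ : Type} [Fintype κ]
    {R : κ → V × Fin 2 → V × Fin 2 → Prop} (h : ∀ k, Dec nx (R k))
    (hd : ∀ k k' p q, R k p q → R k' p q → k = k') :
    Dec nx (fun p q => ∃ k, R k p q) := by
  choose ι hι B h1 h2 h3 using h
  refine ⟨Σ k, ι k, inferInstance, fun x => B x.1 x.2, fun x => h1 x.1 x.2,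
    fun x j d => ⟨x.1, h2 x.1 x.2 j d⟩, ?_⟩
  rintro p q ⟨k, hk⟩
  obtain ⟨⟨i, j, d⟩, hx, hu⟩ := h3 k p q hk
  refine ⟨(⟨k, i⟩, j, d), hx, ?_⟩
  rintro ⟨⟨k', i'⟩, j', d'⟩ hy
  have h4 := h2 k' i' j' d'
  simp only at hy
  rw [hy] at h4
  obtain rfl := hd _ _ _ _ hk h4
  have := hu (i', j', d') hy
  simp only [Prod.mk.injEq] at this
  obtain ⟨rfl, rfl, rfl⟩ := this
  rfl

theorem Dec.reindex {J J' : Type} {nx : J → J} {nx' : J' → J'} {V : Type}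
    {R : V × Fin 2 → V × Fin 2 → Prop} (h : Dec nx' R) (e : J ≃ J')
    (he : ∀ j, e (nx j) = nx' (e j)) : Dec nx R := by
  obtain ⟨ι, _, B, h1, h2, h3⟩ := h
  have key : ∀ i j d, dart nx (fun j => B i (e j)) j d = dart nx' (B i) (e j) d := by
    intro i j d
    simp only [dart, he]
  refine ⟨ι, inferInstance, fun i j => B i (e j), fun i => (h1 i).comp e.injective, ?_, ?_⟩
  · intro i j d
    rw [key]
    exact h2 _ _ _
  · intro p q hR
    obtain ⟨⟨i, j, d⟩, hx, hu⟩ := h3 p q hR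
    refine ⟨(i, e.symm j, d), ?_, ?_⟩
    · simp only at hx ⊢
      rw [key, e.apply_symm_apply, hx]
    · rintro ⟨i', j', d'⟩ hy
      simp only at hy
      rw [key] at hy
      have := hu (i', e j', d') hy
      simp only [Prod.mk.injEq] at this ⊢
      obtain ⟨rfl, rfl, rfl⟩ := this
      simp

/-- All edges between different couples. -/
def Full (V : Type) : V × Fin 2 → V × Fin 2 → Prop := fun p q => p.1 ≠ q.1

theorem Dec.full_equiv {J : Type} {nx : J → J} {V W : Type} (h : Dec nx (Full V))
    (e : W ≃ V) : Dec nx (Full W) := by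
  refine (h.mapEquiv e).congr ?_
  intro p q
  simp [Full, lift2]

/-! ### Idempotent quasigroups -/

/-- The three fibres used by the ordered pair `(x, y)`. -/
def roles {H : Type} (op : H → H → H) (x y : H) : Fin 3 → H := ![x, y, op x y]

theorem zmod_two_cancel {k : ℕ} (hk : Odd k) {a b : ZMod k} (h : 2 * a = 2 * b) : a = b := by
  have h2 : IsUnit (2 : ZMod k) := by
    have := (ZMod.isUnit_iff_coprime 2 k).2 (Nat.coprime_two_left.2 hk)
    exact_mod_cast this
  exact h2.mul_left_cancel h

theorem exists_op (h : ℕ) (hh : 3 ≤ h) : ∃ op : Fin h → Fin h → Fin h,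
    (∀ x, op x x = x) ∧ (∀ x, Function.Injective (op x)) ∧
      (∀ y, Function.Injective fun x => op x y) := by
  have transport : ∀ (H : Type) (_ : Fintype H) (_ : Fintype.card H = h) (op : H → H → H),
      (∀ x, op x x = x) → (∀ x, Function.Injective (op x)) →
      (∀ y, Function.Injective fun x => op x y) → ∃ op : Fin h → Fin h → Fin h,
    (∀ x, op x x = x) ∧ (∀ x, Function.Injective (op x)) ∧
      (∀ y, Function.Injective fun x => op x y) := by
    intro H _ hc op h1 h2 h3
    let e := Fintype.equivFinOfCardEq hc
    refine ⟨fun x y => e (op (e.symm x) (e.symm y)), ?_, ?_, ?_⟩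
    · intro x
      simp [h1]
    · intro x y y' hy
      simpa using h2 _ (e.injective hy)
    · intro y x x' hx
      have := h3 _ (e.injective hx)
      simpa using this
  rcases Nat.even_or_odd h with he | ho
  · obtain ⟨k, rfl⟩ : ∃ k, h = k + 1 := ⟨h - 1, by omega⟩
    have hk : Odd k := by
      rcases Nat.even_or_odd k with h1 | h1
      · exact absurd he (by simpa [Nat.even_add_one] using h1)
      · exact h1
    have : Fact (1 < k) := ⟨by omega⟩
    have : NeZero k := ⟨by omega⟩
    have c2 := fun {a b : ZMod k} => zmod_two_cancel hk (a := a) (b := b)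
    refine transport (Option (ZMod k)) inferInstance (by simp [ZMod.card])
      (fun x y => match x, y with
        | none, none => none
        | none, some y => some (y - 2)
        | some x, none => some (x - 1)
        | some x, some y => if y = x + 1 then none else some (2 * x - y)) ?_ ?_ ?_
    · rintro (_ | x)
      · rfl
      · simp only [left_eq_add, one_ne_zero, if_false, Option.some.injEq]
        ring
    · rintro (_ | x) (_ | y) (_ | y') hy <;> simp only at hy ⊢
      · simp at hy
      · simp at hy
      · simpa using hy
      · split_ifs at hy with h1
        simp only [Option.some.injEq] at hy
        exact absurd (by linear_combination hy) h1
      · split_ifs at hy with h1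
        simp only [Option.some.injEq] at hy
        exact absurd (by linear_combination -hy) h1
      · split_ifs at hy with h1 h2
        · rw [h1, h2]
        · simp only [Option.some.injEq] at hy
          rw [show y = y' by linear_combination -hy]
    · rintro (_ | y) (_ | x) (_ | x') hx <;> simp only at hx ⊢
      · simp at hx
      · simp at hx
      · simpa using hx
      · split_ifs at hx with h1
        simp only [Option.some.injEq] at hx
        have : y = x' + 1 := c2 (by linear_combination hx)
        exact absurd this h1
      · split_ifs at hx with h1
        simp only [Option.some.injEq] at hx
        have : y = x + 1 := c2 (by linear_combination -hx)
        exact absurd this h1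
      · split_ifs at hx with h1 h2
        · rw [show x = x' by linear_combination h2 - h1]
        · simp only [Option.some.injEq] at hx
          rw [c2 (show 2 * x = 2 * x' by linear_combination hx)]
  · have : NeZero h := ⟨by omega⟩
    refine transport (ZMod h) inferInstance (ZMod.card h) (fun x y => 2 * x - y) ?_ ?_ ?_
    · intro x
      ring
    · intro x y y' hy
      simp only at hy
      linear_combination -hy
    · intro y x x' hx
      simp only at hx
      exact zmod_two_cancel ho (by linear_combination hx)

theorem roles_injective {H : Type} {op : H → H → H} (h1 : ∀ x, op x x = x)
    (h2 : ∀ x, Function.Injective (op x)) (h3 : ∀ y, Function.Injective fun x => op x y)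
    {x y : H} (hxy : x ≠ y) : Function.Injective (roles op x y) := by
  have ha : op x y ≠ x := fun h => hxy (h2 x ((h1 x).trans h.symm))
  have hb : op x y ≠ y := fun h => hxy (h3 y (h.trans (h1 y).symm))
  intro i j hij
  fin_cases i <;> fin_cases j <;> simp [roles] at hij ⊢
  all_goals first
    | exact hxy hij
    | exact hxy hij.symm
    | exact ha hij
    | exact ha hij.symm
    | exact hb hij
    | exact hb hij.symm

theorem roles_exists {H : Type} [Finite H] {op : H → H → H} (h1 : ∀ x, op x x = x)
    (h2 : ∀ x, Function.Injective (op x)) (h3 : ∀ y, Function.Injective fun x => op x y)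
    {i j : Fin 3} (hij : i ≠ j) {x y : H} (hxy : x ≠ y) :
    ∃ x' y', x' ≠ y' ∧ roles op x' y' i = x ∧ roles op x' y' j = y := by
  have s2 : ∀ x z, ∃ y, op x y = z := fun x => Finite.surjective_of_injective (h2 x)
  have s3 : ∀ y z, ∃ x, op x y = z := fun y => Finite.surjective_of_injective (h3 y)
  have t2 : ∀ x z, x ≠ z → ∃ y, x ≠ y ∧ op x y = z := by
    intro x z hxz
    obtain ⟨y, hy⟩ := s2 x z
    refine ⟨y, ?_, hy⟩
    rintro rfl
    exact hxz ((h1 x).symm.trans hy)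
  have t3 : ∀ y z, y ≠ z → ∃ x, x ≠ y ∧ op x y = z := by
    intro x z hxz
    obtain ⟨y, hy⟩ := s3 x z
    refine ⟨y, ?_, hy⟩
    rintro rfl
    exact hxz ((h1 y).symm.trans hy)
  fin_cases i <;> fin_cases j <;> simp [roles] at hij ⊢
  · exact hxy
  · exact t2 x y hxy
  · exact Ne.symm hxy
  · exact t3 x y hxy
  · exact t2 y x hxy.symm
  · exact t3 y x hxy.symm

theorem roles_unique {H : Type} {op : H → H → H}
    (h2 : ∀ x, Function.Injective (op x)) (h3 : ∀ y, Function.Injective fun x => op x y)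
    {i j : Fin 3} (hij : i ≠ j) {x y x' y' : H}
    (ha : roles op x y i = roles op x' y' i) (hb : roles op x y j = roles op x' y' j) :
    x = x' ∧ y = y' := by
  fin_cases i <;> fin_cases j <;> simp [roles] at hij ha hb ⊢
  · exact ⟨ha, hb⟩
  · subst ha
    exact ⟨rfl, h2 x hb⟩
  · exact ⟨hb, ha⟩
  · subst ha
    exact ⟨h3 y hb, rfl⟩
  · subst hb
    exact ⟨rfl, h2 x ha⟩
  · subst hb
    exact ⟨h3 y ha, rfl⟩

/-! ### The recursive construction -/

/-- All edges between different couples, except those inside the hole `Fin f`. -/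
def Hole (g f : ℕ) : (Fin g ⊕ Fin f) × Fin 2 → (Fin g ⊕ Fin f) × Fin 2 → Prop :=
  fun p q => p.1 ≠ q.1 ∧ ¬ (p.1.isRight = true ∧ q.1.isRight = true)

/-- Compatibility of the two tripartite ingredients. -/
structure Compat (g : ℕ)
    (RA RB : (Fin 3 × Fin g) × Fin 2 → (Fin 3 × Fin g) × Fin 2 → Prop) : Prop where
  offA : ∀ i P a Q b, ¬ RA ((i, P), a) ((i, Q), b)
  offB : ∀ i P a Q b, ¬ RB ((i, P), a) ((i, Q), b)
  same : ∀ i j : Fin 3, (i = 2 ∨ j = 2) → ∀ P a Q b,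
    RA ((i, P), a) ((j, Q), b) ↔ RB ((i, P), a) ((j, Q), b)
  one : ∀ P a Q b, ∃! ij : Fin 3 × Fin 3,
    if ij = (1, 0) then RB ((ij.1, P), a) ((ij.2, Q), b)
      else RA ((ij.1, P), a) ((ij.2, Q), b)

theorem fin3_cases : ∀ i j : Fin 3, i ≠ j → ¬ (i = 2 ∨ j = 2) →
    (i = 0 ∧ j = 1) ∨ (i = 1 ∧ j = 0) := by
  decide

theorem Dec.glue {J : Type} {nx : J → J} {g f h : ℕ} (hh : 3 ≤ h)
    {RA RB : (Fin 3 × Fin g) × Fin 2 → (Fin 3 × Fin g) × Fin 2 → Prop}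
    (hA : Dec nx RA) (hB : Dec nx RB) (hc : Compat g RA RB)
    (h0 : Dec nx (Full (Fin g ⊕ Fin f))) (h1 : Dec nx (Hole g f)) :
    Dec nx (Full ((Fin h × Fin g) ⊕ Fin f)) := by
  classical
  obtain ⟨op, o1, o2, o3⟩ := exists_op h hh
  have hpos : 0 < h := by omega
  let z : Fin h := ⟨0, hpos⟩
  -- the edges inside fibres
  let φ : Fin h → Fin g ⊕ Fin f → ((Fin h × Fin g) ⊕ Fin f) := fun x => Sum.map (fun P => (x, P)) id
  have hφ : ∀ x, Function.Injective (φ x) := by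
    intro x
    exact Sum.map_injective.2 ⟨fun a b hab => by simpa using hab, Function.injective_id⟩
  let ψ : Fin h → Fin h → Fin 3 × Fin g → ((Fin h × Fin g) ⊕ Fin f) :=
    fun x y u => Sum.inl (roles op x y u.1, u.2)
  have hψ : ∀ x y, x ≠ y → Function.Injective (ψ x y) := by
    rintro x y hxy ⟨i, P⟩ ⟨j, Q⟩ hu
    simp only [ψ, Sum.inl.injEq, Prod.mk.injEq] at hu
    rw [roles_injective o1 o2 o3 hxy hu.1, hu.2]
  let RF : Fin h → (Fin g ⊕ Fin f) × Fin 2 → (Fin g ⊕ Fin f) × Fin 2 → Prop :=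
    fun x => if x = z then Full _ else Hole g f
  let RT : Fin h → Fin h → (Fin 3 × Fin g) × Fin 2 → (Fin 3 × Fin g) × Fin 2 → Prop :=
    fun x y => if x < y then RA else RB
  have dF : ∀ x, Dec nx (RF x) := by
    intro x
    by_cases hx : x = z
    · simpa [RF, hx] using h0
    · simpa [RF, hx] using h1
  have dT : ∀ x y, Dec nx (RT x y) := by
    intro x y
    by_cases hx : x < y
    · simpa [RT, hx] using hA
    · simpa [RT, hx] using hB
  let κ := Fin h ⊕ {xy : Fin h × Fin h // xy.1 ≠ xy.2}
  let R : κ → ((Fin h × Fin g) ⊕ Fin f) × Fin 2 → ((Fin h × Fin g) ⊕ Fin f) × Fin 2 → Prop := fun k p q =>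
    match k with
    | Sum.inl x => ∃ p' q', RF x p' q' ∧ p = lift2 (φ x) p' ∧ q = lift2 (φ x) q'
    | Sum.inr xy => ∃ p' q', RT xy.1.1 xy.1.2 p' q' ∧
        p = lift2 (ψ xy.1.1 xy.1.2) p' ∧ q = lift2 (ψ xy.1.1 xy.1.2) q'
  have dR : ∀ k, Dec nx (R k) := by
    rintro (x | ⟨⟨x, y⟩, hxy⟩)
    · exact (dF x).map _ (hφ x)
    · exact (dT x y).map _ (hψ x y hxy)
  have sR : ∀ k p q, R k p q → R k q p := fun k p q hk => (dR k).symm hk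
  -- cross edges between two different fibres
  have crossT : ∀ x y P a Q b, x ≠ y → ∀ k, R k (Sum.inl (x, P), a) (Sum.inl (y, Q), b) →
      ∃ x' y', ∃ hxy : x' ≠ y', k = Sum.inr ⟨(x', y'), hxy⟩ ∧ ∃ i j, i ≠ j ∧
        roles op x' y' i = x ∧ roles op x' y' j = y ∧
        RT x' y' ((i, P), a) ((j, Q), b) := by
    rintro x y P a Q b hxy (w | ⟨⟨x', y'⟩, hxy'⟩) hk
    · exfalso
      obtain ⟨⟨p', a'⟩, ⟨q', b'⟩, -, e1, e2⟩ := hk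
      rcases p' with p' | p' <;> rcases q' with q' | q' <;> simp [lift2, φ] at e1 e2
      exact hxy (e1.1.1.trans e2.1.1.symm)
    · obtain ⟨⟨⟨i, P'⟩, a'⟩, ⟨⟨j, Q'⟩, b'⟩, hr, e1, e2⟩ := hk
      simp only [lift2, ψ, Prod.mk.injEq, Sum.inl.injEq] at e1 e2
      obtain ⟨⟨e1, rfl⟩, rfl⟩ := e1
      obtain ⟨⟨e2, rfl⟩, rfl⟩ := e2
      refine ⟨x', y', hxy', rfl, i, j, ?_, e1.symm, e2.symm, hr⟩
      rintro rfl
      exact hxy (e1.trans e2.symm)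
  have toT : ∀ x y, x < y → ∀ x' y', x' ≠ y' → ∀ i j, i ≠ j →
      roles op x' y' i = x → roles op x' y' j = y → ∀ P a Q b,
      (RT x' y' ((i, P), a) ((j, Q), b) ↔
        if (i, j) = ((1 : Fin 3), (0 : Fin 3)) then RB ((i, P), a) ((j, Q), b)
          else RA ((i, P), a) ((j, Q), b)) := by
    intro x y hxy x' y' hxy' i j hij e1 e2 P a Q b
    by_cases h2 : i = 2 ∨ j = 2
    · have hne : ¬ ((i, j) = ((1 : Fin 3), (0 : Fin 3))) := by
        rintro h3
        simp only [Prod.mk.injEq] at h3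
        obtain ⟨rfl, rfl⟩ := h3
        revert h2
        decide
      rw [if_neg hne]
      by_cases hx : x' < y'
      · simp [RT, hx]
      · simp [RT, hx, hc.same i j h2]
    · have : (i = 0 ∧ j = 1) ∨ (i = 1 ∧ j = 0) := fin3_cases i j hij h2
      rcases this with ⟨rfl, rfl⟩ | ⟨rfl, rfl⟩
      · simp only [roles] at e1 e2
        have hx : x' < y' := by simpa [← e1, ← e2] using hxy
        simp [RT, hx]
      · simp only [roles] at e1 e2
        have hx : y' < x' := by simpa [← e1, ← e2] using hxy
        have hx2 : ¬ x' < y' := not_lt.2 hx.le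
        simp [RT, hx2]
  have crossE : ∀ x y P a Q b, x < y →
      ∃! k, R k (Sum.inl (x, P), a) (Sum.inl (y, Q), b) := by
    intro x y P a Q b hxy
    obtain ⟨⟨i, j⟩, hij, hu⟩ := hc.one P a Q b
    have hne : i ≠ j := by
      rintro rfl
      simp only at hij
      split_ifs at hij with h3
      · exact hc.offB _ _ _ _ _ hij
      · exact hc.offA _ _ _ _ _ hij
    obtain ⟨x', y', hxy', e1, e2⟩ := roles_exists o1 o2 o3 hne hxy.ne
    refine ⟨Sum.inr ⟨(x', y'), hxy'⟩, ?_, ?_⟩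
    · refine ⟨((i, P), a), ((j, Q), b), (toT x y hxy x' y' hxy' i j hne e1 e2 P a Q b).2 hij,
        ?_, ?_⟩ <;> simp [lift2, ψ, e1, e2]
    · intro k hk
      obtain ⟨x2, y2, hxy2, rfl, i2, j2, hne2, f1, f2, hr⟩ := crossT x y P a Q b hxy.ne k hk
      have h5 := hu (i2, j2) ((toT x y hxy x2 y2 hxy2 i2 j2 hne2 f1 f2 P a Q b).1 hr)
      simp only [Prod.mk.injEq] at h5
      obtain ⟨rfl, rfl⟩ := h5
      obtain ⟨rfl, rfl⟩ := roles_unique o2 o3 hne (f1.trans e1.symm) (f2.trans e2.symm)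
      rfl
  -- edges inside a fibre (together with the hole)
  have noT : ∀ x P a p b, (∀ y Q, p = Sum.inl (y, Q) → y = x) → ∀ k,
      R k (Sum.inl (x, P), a) (p, b) → k = Sum.inl x := by
    rintro x P a p b hp (w | ⟨⟨x', y'⟩, hxy'⟩) hk
    · obtain ⟨⟨p', a'⟩, ⟨q', b'⟩, -, e1, e2⟩ := hk
      rcases p' with p' | p' <;> simp [lift2, φ] at e1
      rw [e1.1.1]
    · exfalso
      obtain ⟨⟨⟨i, P'⟩, a'⟩, ⟨⟨j, Q'⟩, b'⟩, hr, e1, e2⟩ := hk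
      simp only [lift2, ψ, Prod.mk.injEq, Sum.inl.injEq] at e1 e2
      have h6 := hp _ _ e2.1
      have h7 : j = i := roles_injective o1 o2 o3 hxy' (h6.trans e1.1.1)
      subst h7
      by_cases hx : x' < y'
      · simp only [RT, hx, if_true] at hr
        exact hc.offA _ _ _ _ _ hr
      · simp only [RT, hx, if_false] at hr
        exact hc.offB _ _ _ _ _ hr
  have rf1 : ∀ x (P : Fin g) a q b, Sum.inl P ≠ q → RF x (Sum.inl P, a) (q, b) := by
    intro x P a q b hq
    by_cases hx : x = z
    · simpa [RF, hx, Full] using hq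
    · simpa [RF, hx, Hole] using hq
  have main : ∀ p q : ((Fin h × Fin g) ⊕ Fin f) × Fin 2, p.1 ≠ q.1 → ∃! k, R k p q := by
    rintro ⟨⟨x, P⟩ | F, a⟩ ⟨⟨y, Q⟩ | F', b⟩ hpq
    · rcases lt_trichotomy x y with hxy | rfl | hxy
      · exact crossE x y P a Q b hxy
      · refine ⟨Sum.inl x, ?_, ?_⟩
        · refine ⟨(Sum.inl P, a), (Sum.inl Q, b), rf1 _ _ _ _ _ ?_, rfl, rfl⟩
          rintro h8
          simp only [Sum.inl.injEq] at h8
          exact hpq (by simp [h8])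
        · intro k hk
          refine noT x P a _ b ?_ k hk
          intro y' Q' h9
          simp only [Sum.inl.injEq, Prod.mk.injEq] at h9
          exact h9.1.symm
      · obtain ⟨k, hk, hu⟩ := crossE y x Q b P a hxy
        exact ⟨k, sR _ _ _ hk, fun k' hk' => hu k' (sR _ _ _ hk')⟩
    · refine ⟨Sum.inl x, ⟨(Sum.inl P, a), (Sum.inr F', b), rf1 _ _ _ _ _ (by simp), rfl, rfl⟩,
        ?_⟩
      intro k hk
      exact noT x P a _ b (by simp) k hk
    · have h10 : R (Sum.inl y) (Sum.inl (y, Q), b) (Sum.inr F, a) :=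
        ⟨(Sum.inl Q, b), (Sum.inr F, a), rf1 _ _ _ _ _ (by simp), rfl, rfl⟩
      have h11 := sR (Sum.inl y) _ _ h10
      refine ⟨Sum.inl y, h11, ?_⟩
      intro k hk
      exact noT y Q b _ a (by simp) k (sR _ _ _ hk)
    · refine ⟨Sum.inl z, ⟨(Sum.inr F, a), (Sum.inr F', b), ?_, rfl, rfl⟩, ?_⟩
      · simp only [RF, if_true, Full]
        intro h8
        simp only [Sum.inr.injEq] at h8
        exact hpq (by simp [h8])
      · rintro (w | ⟨⟨x', y'⟩, hxy'⟩) hk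
        · obtain ⟨⟨p', a'⟩, ⟨q', b'⟩, hr, e1, e2⟩ := hk
          by_cases hw : w = z
          · rw [hw]
          · exfalso
            simp only [RF, hw, if_false] at hr
            rcases p' with p' | p' <;> rcases q' with q' | q' <;>
              simp [lift2, φ, Hole] at e1 e2 hr
        · exfalso
          obtain ⟨⟨⟨i, P'⟩, a'⟩, ⟨⟨j, Q'⟩, b'⟩, hr, e1, e2⟩ := hk
          simp [lift2, ψ] at e1
  refine (Dec.union dR ?_).congr ?_
  · intro k k' p q hk hk'
    have hpq : p.1 ≠ q.1 := by
      rcases k with w | ⟨⟨x', y'⟩, hxy'⟩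
      · obtain ⟨p', q', hr, rfl, rfl⟩ := hk
        have : p'.1 ≠ q'.1 := by
          by_cases hw : w = z
          · simpa [RF, hw, Full] using hr
          · simp only [RF, hw, if_false] at hr
            exact hr.1
        exact fun h => this (hφ w h)
      · obtain ⟨⟨⟨i, P'⟩, a'⟩, ⟨⟨j, Q'⟩, b'⟩, hr, rfl, rfl⟩ := hk
        intro h
        have h7 := hψ x' y' hxy' h
        simp only [Prod.mk.injEq] at h7
        obtain ⟨rfl, rfl⟩ := h7
        by_cases hx : x' < y'
        · simp only [RT, hx, if_true] at hr
          exact hc.offA _ _ _ _ _ hr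
        · simp only [RT, hx, if_false] at hr
          exact hc.offB _ _ _ _ _ hr
    exact (main p q hpq).unique hk hk'
  · intro p q
    constructor
    · rintro ⟨k, hk⟩ hpq
      rcases k with w | ⟨⟨x', y'⟩, hxy'⟩
      · obtain ⟨p', q', hr, rfl, rfl⟩ := hk
        have : p'.1 ≠ q'.1 := by
          by_cases hw : w = z
          · simpa [RF, hw, Full] using hr
          · simp only [RF, hw, if_false] at hr
            exact hr.1
        exact this (hφ w hpq)
      · obtain ⟨⟨⟨i, P'⟩, a'⟩, ⟨⟨j, Q'⟩, b'⟩, hr, rfl, rfl⟩ := hk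
        have h7 := hψ x' y' hxy' hpq
        simp only [Prod.mk.injEq] at h7
        obtain ⟨rfl, rfl⟩ := h7
        by_cases hx : x' < y'
        · simp only [RT, hx, if_true] at hr
          exact hc.offA _ _ _ _ _ hr
        · simp only [RT, hx, if_false] at hr
          exact hc.offB _ _ _ _ _ hr
    · intro hpq
      exact (main p q hpq).exists


/-! ### A verified checker for explicit ingredients -/

/-- Successor of position `j` in the disjoint union of cycles of lengths `P`. -/
def nxt : List ℕ → ℕ → ℕ
  | [], j => j
  | c :: P, j =>
    bif Nat.blt j c then (bif Nat.blt (j + 1) c then j + 1 else 0) else c + nxt P (j - c)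

theorem bif_blt {α : Type} (a b : ℕ) (x y : α) :
    (bif Nat.blt a b then x else y) = if a < b then x else y := by
  by_cases h : a < b
  · have h2 : Nat.blt a b = true := by simpa [Nat.blt_eq] using h
    simp [h, h2]
  · have h2 : Nat.blt a b = false := by
      rw [← Bool.not_eq_true, Nat.blt_eq]
      exact h
    simp [h, h2]

theorem bif_beq {α : Type} (a b : ℕ) (x y : α) :
    (bif Nat.beq a b then x else y) = if a = b then x else y := by
  by_cases h : a = b
  · have h2 : Nat.beq a b = true := by simpa using h
    simp [h]
  · have h2 : Nat.beq a b = false := by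
      rw [← Bool.not_eq_true, Nat.beq_eq]
      exact h
    simp [h, h2]

/-- Bit test, in a form that evaluates quickly. -/
def tb (k c : ℕ) : Bool := Nat.beq (Nat.mod (Nat.shiftRight k c) 2) 1

theorem tb_eq (k c : ℕ) : tb k c = k.testBit c := by
  rw [Bool.eq_iff_iff, Nat.testBit_eq_decide_div_mod_eq, decide_eq_true_eq, tb, Nat.beq_eq]
  rw [← Nat.shiftRight_eq_div_pow]
  rfl

theorem nxt_lt : ∀ (P : List ℕ) (j : ℕ), j < P.sum → nxt P j < P.sum
  | [], j, h => by simp at h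
  | c :: P, j, h => by
    simp only [List.sum_cons, nxt, bif_blt] at h ⊢
    split_ifs with h1 h2
    · omega
    · omega
    · have := nxt_lt P (j - c) (by omega)
      omega

/-- The successor map as a map on positions. -/
def nxF (P : List ℕ) (j : Fin P.sum) : Fin P.sum := ⟨nxt P j, nxt_lt P j j.2⟩

/-- The spouse, on codes `2 * couple + side`. -/
def flipc (c : ℕ) : ℕ := bif Nat.beq (c % 2) 0 then c + 1 else c - 1

/-- The code of the dart leaving position `j` of a block. -/
def fdart (P : List ℕ) (b : List ℕ) (j : ℕ) : ℕ :=
  flipc (b.getD j 0) * 64 + b.getD (nxt P j) 0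

/-- The code of the reversed dart leaving position `j` of a block. -/
def rdart (P : List ℕ) (b : List ℕ) (j : ℕ) : ℕ :=
  b.getD (nxt P j) 0 * 64 + flipc (b.getD j 0)

/-- All darts of a block. -/
def bdarts (P : List ℕ) (b : List ℕ) : List ℕ :=
  (List.range P.sum).flatMap fun j => [fdart P b j, rdart P b j]

/-- Collect a list without repetitions into a bit mask. -/
def cover : List ℕ → ℕ → Option ℕ
  | [], acc => some acc
  | c :: l, acc =>
    bif tb acc c then none
    else match acc ||| (1 <<< c) with
      | 0 => none
      | k + 1 => cover l (k + 1)

theorem cover_cons {c : ℕ} {l : List ℕ} {acc k : ℕ} (h : cover (c :: l) acc = some k) :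
    acc.testBit c = false ∧ cover l (acc ||| (1 <<< c)) = some k := by
  rw [cover, tb_eq] at h
  cases h1 : acc.testBit c
  on_goal 2 => rw [h1] at h; simp at h
  rw [h1, cond_false] at h
  refine ⟨rfl, ?_⟩
  generalize acc ||| (1 <<< c) = z at h ⊢
  cases z with
  | zero => simp at h
  | succ z => exact h

theorem cover_spec : ∀ (l : List ℕ) (acc k : ℕ), cover l acc = some k →
    l.Nodup ∧ (∀ c ∈ l, acc.testBit c = false) ∧
      ∀ c, k.testBit c = true ↔ acc.testBit c = true ∨ c ∈ l
  | [], acc, k, h => by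
    simp only [cover, Option.some.injEq] at h
    subst h
    simp
  | c :: l, acc, k, h => by
    obtain ⟨h1, h2⟩ := cover_cons h
    obtain ⟨n1, n2, n3⟩ := cover_spec l _ k h2
    have key : ∀ x, (acc ||| (1 <<< c)).testBit x = true ↔ acc.testBit x = true ∨ x = c := by
      intro x
      rw [Nat.testBit_or, Nat.one_shiftLeft, Nat.testBit_two_pow]
      rw [Bool.or_eq_true, decide_eq_true_eq, eq_comm (a := c)]
    have key' : ∀ x ∈ l, acc.testBit x = false ∧ x ≠ c := by
      intro x hx
      have h3 := n2 x hx
      have h4 := key x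
      rw [h3] at h4
      simp only [Bool.false_eq_true, false_iff, not_or, Bool.not_eq_true] at h4
      exact h4
    refine ⟨List.nodup_cons.2 ⟨fun hc => (key' c hc).2 rfl, n1⟩, ?_, ?_⟩
    · intro x hx
      rcases List.mem_cons.1 hx with rfl | hx
      · exact h1
      · exact (key' x hx).1
    · intro x
      rw [n3, key, List.mem_cons, or_assoc]

/-- Check that a block is a list of codes below `2 * N` with different couples. -/
def okBlock (P : List ℕ) (N : ℕ) (b : List ℕ) : Bool :=
  ((List.range P.sum).all fun j => Nat.blt (b.getD j 0) (2 * N)) &&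
    (cover ((List.range P.sum).map fun j => b.getD j 0 / 2) 0).isSome

/-- The code of a member. -/
def code {N : ℕ} (p : Fin N × Fin 2) : ℕ := 2 * p.1.val + p.2.val

theorem code_lt {N : ℕ} (p : Fin N × Fin 2) : code p < 2 * N := by
  have h1 := p.1.2
  have h2 := p.2.2
  unfold code
  omega

theorem code_inj {N : ℕ} {p q : Fin N × Fin 2} (h : code p = code q) : p = q := by
  obtain ⟨⟨a, ha⟩, ⟨b, hb⟩⟩ := p
  obtain ⟨⟨c, hc⟩, ⟨d, hd⟩⟩ := q
  simp only [code] at h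
  simp only [Prod.mk.injEq, Fin.mk.injEq]
  omega

/-- The member with a given code. -/
def decode {N : ℕ} (hN : 0 < N) (c : ℕ) : Fin N × Fin 2 :=
  (⟨c / 2 % N, Nat.mod_lt _ hN⟩, ⟨c % 2, Nat.mod_lt _ (by norm_num)⟩)

theorem code_decode {N : ℕ} (hN : 0 < N) {c : ℕ} (hc : c < 2 * N) :
    code (decode hN c) = c := by
  simp only [code, decode]
  rw [Nat.mod_eq_of_lt (by omega)]
  omega

theorem code_spouse {N : ℕ} (p : Fin N × Fin 2) : code (p.1, p.2 + 1) = flipc (code p) := by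
  obtain ⟨a, b⟩ := p
  simp only [code, flipc, bif_beq]
  fin_cases b
  · simp
  · simp

/-- The relation described by a bit mask. -/
def Mask (N k : ℕ) : Fin N × Fin 2 → Fin N × Fin 2 → Prop :=
  fun p q => k.testBit (code p * 64 + code q) = true

theorem dec_of_cover {P : List ℕ} {N k : ℕ} {bs : List (List ℕ)} (hN : 0 < N) (hN2 : N ≤ 32)
    (hok : bs.all (okBlock P N) = true)
    (hc : cover (bs.flatMap (bdarts P)) 0 = some k) : Dec (nxF P) (Mask N k) := by
  obtain ⟨hnd, -, hk⟩ := cover_spec _ _ _ hc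
  simp only [Nat.zero_testBit, Bool.false_eq_true, false_or] at hk
  rw [List.nodup_flatMap] at hnd
  obtain ⟨nd1, nd2⟩ := hnd
  rw [List.pairwise_iff_getElem] at nd2
  have hlt : ∀ b ∈ bs, ∀ j < P.sum, b.getD j 0 < 2 * N := by
    intro b hb j hj
    have := List.all_eq_true.1 hok b hb
    rw [okBlock, Bool.and_eq_true] at this
    have := List.all_eq_true.1 this.1 j (List.mem_range.2 hj)
    rwa [Nat.blt_eq] at this
  have hne : ∀ b ∈ bs, ∀ j < P.sum, ∀ i < j, b.getD i 0 / 2 ≠ b.getD j 0 / 2 := by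
    intro b hb j hj i hi
    have := List.all_eq_true.1 hok b hb
    rw [okBlock, Bool.and_eq_true] at this
    obtain ⟨k', hk'⟩ := Option.isSome_iff_exists.1 this.2
    have h5 := (cover_spec _ _ _ hk').1
    intro h6
    have h7 := List.inj_on_of_nodup_map h5 (List.mem_range.2 (hi.trans hj)) (List.mem_range.2 hj) h6
    omega
  let B : Fin bs.length → Fin P.sum → Fin N × Fin 2 := fun i j => decode hN (bs[i].getD j 0)
  have hmem : ∀ i : Fin bs.length, bs[i] ∈ bs := fun i => List.getElem_mem _
  have cB : ∀ i j, code (B i j) = bs[i].getD j 0 := fun i j =>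
    code_decode hN (hlt _ (hmem i) j j.2)
  have cD : ∀ i j d, code (dart (nxF P) (B i) j d).1 * 64 + code (dart (nxF P) (B i) j d).2 =
      if d = true then rdart P bs[i] j else fdart P bs[i] j := by
    intro i j d
    cases d
    · simp only [dart, fdart, Bool.false_eq_true, if_false]
      rw [code_spouse, cB, cB]
      rfl
    · simp only [dart, rdart, if_true]
      rw [code_spouse, cB, cB]
      rfl
  have mD : ∀ i j d, code (dart (nxF P) (B i) j d).1 * 64 + code (dart (nxF P) (B i) j d).2 ∈
      bdarts P bs[i] := by
    intro i j d
    rw [cD]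
    refine List.mem_flatMap.2 ⟨j, List.mem_range.2 j.2, ?_⟩
    cases d <;> simp
  refine ⟨Fin bs.length, inferInstance, B, ?_, ?_, ?_⟩
  · intro i j j' hj
    have h2 : ∀ j, ((B i j).1 : ℕ) = bs[i].getD j 0 / 2 := by
      intro j
      have h3 := hlt _ (hmem i) j j.2
      simp only [B, decode]
      exact Nat.mod_eq_of_lt (by omega)
    have h4 : bs[i].getD j 0 / 2 = bs[i].getD j' 0 / 2 := by
      rw [← h2, ← h2]
      exact congrArg Fin.val hj
    rcases lt_trichotomy (j : ℕ) j' with h | h | h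
    · exact absurd h4 (hne _ (hmem i) _ j'.2 _ h)
    · exact Fin.ext h
    · exact absurd h4.symm (hne _ (hmem i) _ j.2 _ h)
  · intro i j d
    exact (hk _).2 (List.mem_flatMap.2 ⟨_, hmem i, mD i j d⟩)
  · intro p q hpq
    have hu : ∀ x : Fin bs.length × Fin P.sum × Bool,
        dart (nxF P) (B x.1) x.2.1 x.2.2 = (p, q) ↔
          (if x.2.2 = true then rdart P bs[x.1] x.2.1 else fdart P bs[x.1] x.2.1) =
            code p * 64 + code q := by
      rintro ⟨i, j, d⟩
      simp only
      rw [← cD]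
      generalize dart (nxF P) (B i) j d = y
      obtain ⟨p', q'⟩ := y
      constructor
      · rintro h
        simp only [Prod.mk.injEq] at h
        rw [h.1, h.2]
      · intro h
        simp only at h
        have l1 := code_lt p
        have l2 := code_lt q
        have l3 := code_lt p'
        have l4 := code_lt q'
        rw [code_inj (show code p' = code p by omega), code_inj (show code q' = code q by omega)]
    obtain ⟨b, hb, hd⟩ := List.mem_flatMap.1 ((hk _).1 hpq)
    obtain ⟨i, hi, rfl⟩ := List.getElem_of_mem hb
    obtain ⟨j, hj, hd⟩ := List.mem_flatMap.1 hd
    rw [List.mem_range] at hj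
    have hd2 : ∃ d : Bool, (if d = true then rdart P bs[i] j else fdart P bs[i] j) =
        code p * 64 + code q := by
      simp only [List.mem_cons, List.not_mem_nil, or_false] at hd
      rcases hd with hd | hd
      · exact ⟨false, by simpa using hd.symm⟩
      · exact ⟨true, by simpa using hd.symm⟩
    obtain ⟨d, hd2⟩ := hd2
    refine ⟨(⟨i, hi⟩, ⟨j, hj⟩, d), (hu _).2 hd2, ?_⟩
    rintro ⟨⟨i', hi'⟩, ⟨j', hj'⟩, d'⟩ hy
    rw [hu] at hy
    simp only [Fin.getElem_fin] at hy
    have memb : ∀ (b : List ℕ) (j : ℕ), j < P.sum → ∀ d : Bool,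
        (if d = true then rdart P b j else fdart P b j) ∈ bdarts P b := by
      intro b j hj d
      refine List.mem_flatMap.2 ⟨j, List.mem_range.2 hj, ?_⟩
      cases d <;> simp
    have m1 := memb bs[i] j hj d
    have m2 := memb bs[i'] j' hj' d'
    rw [hd2] at m1
    rw [hy] at m2
    have hii : i = i' := by
      rcases lt_trichotomy i i' with h | h | h
      · exact absurd m2 (nd2 i i' hi hi' h m1)
      · exact h
      · exact absurd m1 (nd2 i' i hi' hi h m2)
    subst hii
    have nd3 := nd1 _ hb
    rw [bdarts, List.nodup_flatMap] at nd3
    obtain ⟨nd4, nd5⟩ := nd3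
    rw [List.pairwise_iff_getElem] at nd5
    simp only [List.length_range, List.getElem_range] at nd5
    have q1 : code p * 64 + code q ∈ [fdart P bs[i] j, rdart P bs[i] j] := by
      rw [← hd2]
      cases d <;> simp
    have q2 : code p * 64 + code q ∈ [fdart P bs[i] j', rdart P bs[i] j'] := by
      rw [← hy]
      cases d' <;> simp
    have hjj : j = j' := by
      rcases lt_trichotomy j j' with h | h | h
      · exact absurd q2 (nd5 j j' hj hj' h q1)
      · exact h
      · exact absurd q1 (nd5 j' j hj' hj h q2)
    subst hjj
    have nd6 := nd4 j (List.mem_range.2 hj)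
    simp only [List.nodup_cons, List.mem_cons, List.not_mem_nil, or_false] at nd6
    have hdd : d' = d := by
      have h7 := nd6.1
      have h8 := hd2.trans hy.symm
      clear * - h7 h8
      cases d <;> cases d'
      · rfl
      · exact absurd (by simpa using h8) h7
      · exact absurd (by simpa using h8.symm) h7
      · rfl
    subst hdd
    rfl

/-! ### Expanding base blocks and checking the resulting relation -/

/-- Read a packed list of two-digit codes. -/
def unpack : ℕ → ℕ → List ℕ
  | 0, _ => []
  | k + 1, x => x % 100 :: unpack k (x / 100)

/-- Rotate a code by `k` steps: couples below `L` are arranged in cycles of length `w`, and the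
two members of a couple are swapped on each turn if `tw` is odd. -/
def rotc (w L tw k c : ℕ) : ℕ :=
  bif Nat.blt (c / 2) L then
    2 * (c / 2 / w * w + (c / 2 % w + k) % w) + (c + tw * ((c / 2 % w + k) / w)) % 2
  else c

/-- All translates of the packed base blocks. -/
def expand (M w L tw s r : ℕ) (base : List ℕ) : List (List ℕ) :=
  base.flatMap fun x => (List.range r).map fun i => (unpack M x).map (rotc w L tw (s * i))

/-- Check a list of blocks, together with a test on the mask of covered darts. -/
def chk (P : List ℕ) (N : ℕ) (bs : List (List ℕ)) (test : ℕ → Bool) : Bool :=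
  decide (0 < N) && (decide (N ≤ 32) && (bs.all (okBlock P N) &&
    match cover (bs.flatMap (bdarts P)) 0 with
    | none => false
    | some k => test k))

theorem chk_spec {P : List ℕ} {N : ℕ} {bs : List (List ℕ)} {test : ℕ → Bool}
    (h : chk P N bs test = true) : ∃ k, test k = true ∧ Dec (nxF P) (Mask N k) := by
  simp only [chk, Bool.and_eq_true, decide_eq_true_eq] at h
  obtain ⟨h1, h2, h3, h4⟩ := h
  cases hc : cover (bs.flatMap (bdarts P)) 0 with
  | none => rw [hc] at h4; simp at h4
  | some k =>
    rw [hc] at h4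
    exact ⟨k, h4, dec_of_cover h1 h2 h3 hc⟩

/-- Test that a predicate holds for all pairs of codes. -/
def all2 (n : ℕ) (T : ℕ → ℕ → Bool) : Bool :=
  (List.range n).all fun p => (List.range n).all fun q => T p q

theorem all2_spec {n : ℕ} {T : ℕ → ℕ → Bool} (h : all2 n T = true) {p q : ℕ} (hp : p < n)
    (hq : q < n) : T p q = true :=
  List.all_eq_true.1 (List.all_eq_true.1 h p (List.mem_range.2 hp)) q (List.mem_range.2 hq)

/-- Test for the complete relation with a hole on the couples from `g` onwards. -/
def holeTest (g N k : ℕ) : Bool :=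
  all2 (2 * N) fun p q =>
    bif tb k (p * 64 + q) then
      !(Nat.beq (p / 2) (q / 2)) && !(Nat.ble g (p / 2) && Nat.ble g (q / 2))
    else Nat.beq (p / 2) (q / 2) || (Nat.ble g (p / 2) && Nat.ble g (q / 2))

theorem code_half {N : ℕ} (p : Fin N × Fin 2) : code p / 2 = p.1.val := by
  have := p.2.2
  unfold code
  omega

theorem holeTest_spec {g N k : ℕ} (h : holeTest g N k = true) (p q : Fin N × Fin 2) :
    Mask N k p q ↔ p.1 ≠ q.1 ∧ ¬ (g ≤ p.1.val ∧ g ≤ q.1.val) := by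
  have := all2_spec h (code_lt p) (code_lt q)
  rw [tb_eq, code_half, code_half] at this
  rw [Mask, ne_eq, Fin.ext_iff, ← Nat.beq_eq, ← Nat.ble_eq, ← Nat.ble_eq]
  revert this
  generalize Nat.beq _ _ = x
  generalize Nat.ble g p.1.val = y
  generalize Nat.ble g q.1.val = z
  generalize Nat.testBit _ _ = w
  revert x y z w
  decide

/-- Check for an ingredient with a hole. -/
def chkHole (P : List ℕ) (g N w L tw s r : ℕ) (base : List ℕ) : Bool :=
  chk P N (expand P.sum w L tw s r base) (holeTest g N)

theorem full_of_chk {P : List ℕ} {N w L tw s r : ℕ} {base : List ℕ}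
    (h : chkHole P N N w L tw s r base = true) : Dec (nxF P) (Full (Fin N)) := by
  obtain ⟨k, h1, h2⟩ := chk_spec h
  refine h2.congr fun p q => (holeTest_spec h1 p q).trans ?_
  have := p.1.2
  simp only [Full]
  constructor
  · exact fun h => h.1
  · exact fun h => ⟨h, by omega⟩

theorem hole_of_chk {P : List ℕ} {g f w L tw s r : ℕ} {base : List ℕ}
    (h : chkHole P g (g + f) w L tw s r base = true) : Dec (nxF P) (Hole g f) := by
  obtain ⟨k, h1, h2⟩ := chk_spec h
  refine (h2.mapEquiv finSumFinEquiv).congr fun p q => (holeTest_spec h1 _ _).trans ?_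
  obtain ⟨p, a⟩ := p
  obtain ⟨q, b⟩ := q
  have hne : ∀ p q : Fin g ⊕ Fin f, finSumFinEquiv p ≠ finSumFinEquiv q ↔ p ≠ q := by
    intro p q
    simp
  simp only [lift2, Hole, hne]
  refine and_congr_right fun _ => not_congr ?_
  rcases p with p | p <;> rcases q with q | q <;> simp

/-- The nine pairs of roles. -/
def rolePairs : List (ℕ × ℕ) :=
  [(0, 0), (0, 1), (0, 2), (1, 0), (1, 1), (1, 2), (2, 0), (2, 1), (2, 2)]

/-- The relation used for a pair of roles. -/
def roleTest (g kA kB u v : ℕ) (ij : ℕ × ℕ) : Bool :=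
  bif Nat.beq ij.1 1 && Nat.beq ij.2 0 then tb kB ((2 * g * ij.1 + u) * 64 + (2 * g * ij.2 + v))
  else tb kA ((2 * g * ij.1 + u) * 64 + (2 * g * ij.2 + v))

/-- The list has exactly one element. -/
def single : List (ℕ × ℕ) → Bool
  | [_] => true
  | _ => false

/-- Test for the compatibility of two tripartite ingredients. -/
def abTest (g kA kB : ℕ) : Bool :=
  (all2 (6 * g) fun p q =>
    bif Nat.beq (p / 2 / g) (q / 2 / g) then
      !(tb kA (p * 64 + q)) && !(tb kB (p * 64 + q))
    else bif Nat.beq (p / 2 / g) 2 || Nat.beq (q / 2 / g) 2 then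
      bif tb kA (p * 64 + q) then tb kB (p * 64 + q) else !(tb kB (p * 64 + q))
    else true) &&
  all2 (2 * g) fun u v => single (rolePairs.filter (roleTest g kA kB u v))

/-- Check for the two tripartite ingredients. -/
def chkAB (P : List ℕ) (g : ℕ) (baseA baseB : List ℕ) : Bool :=
  chk P (3 * g) (expand P.sum g (3 * g) 0 1 g baseA) fun kA =>
    chk P (3 * g) (expand P.sum g (3 * g) 0 1 g baseB) fun kB => abTest g kA kB

/-- The relation on three fibres described by a mask. -/
def TriMask (g k : ℕ) : (Fin 3 × Fin g) × Fin 2 → (Fin 3 × Fin g) × Fin 2 → Prop :=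
  fun p q => Mask (3 * g) k (lift2 finProdFinEquiv p) (lift2 finProdFinEquiv q)

theorem code_tri {g : ℕ} (i : Fin 3) (P : Fin g) (a : Fin 2) :
    code (lift2 finProdFinEquiv ((i, P), a)) = 2 * g * i.val + (2 * P.val + a.val) := by
  simp only [code, lift2, finProdFinEquiv_apply_val]
  ring

theorem role_tri {g : ℕ} (i : Fin 3) (P : Fin g) (a : Fin 2) :
    (2 * g * i.val + (2 * P.val + a.val)) / 2 / g = i.val := by
  have h1 : (2 * g * i.val + (2 * P.val + a.val)) / 2 = P.val + g * i.val := by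
    have := a.2
    have h2 : 2 * g * i.val = 2 * (g * i.val) := by ring
    omega
  have hg : 0 < g := by
    have := P.2
    omega
  rw [h1, Nat.add_mul_div_left _ _ hg, Nat.div_eq_of_lt P.2, zero_add]

theorem single_spec {l : List (ℕ × ℕ)} (h : single l = true) : ∃ x, l = [x] := by
  match l, h with
  | [x], _ => exact ⟨x, rfl⟩

theorem rolePairs_mem : ∀ i j : Fin 3, (i.val, j.val) ∈ rolePairs := by decide

theorem rolePairs_lt : ∀ x ∈ rolePairs, x.1 < 3 ∧ x.2 < 3 := by decide

theorem pair_eq_iff : ∀ i j : Fin 3,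
    (i, j) = ((1 : Fin 3), (0 : Fin 3)) ↔ (i.val = 1 ∧ j.val = 0) := by decide

theorem compat_of_test {g kA kB : ℕ} (h : abTest g kA kB = true) :
    Compat g (TriMask g kA) (TriMask g kB) := by
  simp only [abTest, Bool.and_eq_true] at h
  obtain ⟨h1, h2⟩ := h
  have key : ∀ k i P a j Q b, TriMask g k ((i, P), a) ((j, Q), b) ↔
      k.testBit ((2 * g * i.val + (2 * P.val + a.val)) * 64 +
        (2 * g * j.val + (2 * Q.val + b.val))) = true := by
    intro k i P a j Q b
    simp only [TriMask, Mask, code_tri]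
  have lt6 : ∀ (i : Fin 3) (P : Fin g) (a : Fin 2),
      2 * g * i.val + (2 * P.val + a.val) < 6 * g := by
    intro i P a
    rw [← code_tri]
    have := code_lt (lift2 finProdFinEquiv ((i, P), a))
    omega
  have t1 : ∀ i P a j Q b, _ := fun (i : Fin 3) (P : Fin g) (a : Fin 2) (j : Fin 3) (Q : Fin g)
    (b : Fin 2) => all2_spec h1 (lt6 i P a) (lt6 j Q b)
  simp only [role_tri, tb_eq] at t1
  refine ⟨?_, ?_, ?_, ?_⟩
  · intro i P a Q b
    rw [key]
    have := t1 i P a i Q b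
    simp only [Nat.beq_refl, cond_true, Bool.and_eq_true, Bool.not_eq_true'] at this
    simp [this.1]
  · intro i P a Q b
    rw [key]
    have := t1 i P a i Q b
    simp only [Nat.beq_refl, cond_true, Bool.and_eq_true, Bool.not_eq_true'] at this
    simp [this.2]
  · intro i j hij P a Q b
    rw [key, key]
    have := t1 i P a j Q b
    have h3 : (Nat.beq i.val 2 || Nat.beq j.val 2) = true := by
      rcases hij with rfl | rfl <;> simp
    rw [h3, cond_true] at this
    revert this
    generalize Nat.beq _ _ = x
    generalize Nat.testBit kA _ = y
    generalize Nat.testBit kB _ = z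
    revert x y z
    decide
  · intro P a Q b
    have hP : 2 * P.val + a.val < 2 * g := by
      have := P.2
      have := a.2
      omega
    have hQ : 2 * Q.val + b.val < 2 * g := by
      have := Q.2
      have := b.2
      omega
    obtain ⟨x, hx⟩ := single_spec (all2_spec h2 hP hQ)
    have hR : ∀ ij : Fin 3 × Fin 3,
        (if ij = (1, 0) then TriMask g kB ((ij.1, P), a) ((ij.2, Q), b)
          else TriMask g kA ((ij.1, P), a) ((ij.2, Q), b)) ↔ (ij.1.val, ij.2.val) = x := by
      rintro ⟨i, j⟩
      have e1 : (i.val, j.val) = x ↔ (i.val, j.val) ∈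
          rolePairs.filter (roleTest g kA kB (2 * P.val + a.val) (2 * Q.val + b.val)) := by
        rw [hx, List.mem_singleton]
      rw [e1, List.mem_filter]
      rw [key, key, and_iff_right (rolePairs_mem i j), roleTest, tb_eq, tb_eq]
      have e2 : (i, j) = ((1 : Fin 3), (0 : Fin 3)) ↔ (i.val = 1 ∧ j.val = 0) :=
        pair_eq_iff i j
      by_cases h5 : i.val = 1 ∧ j.val = 0
      · have h6 : (Nat.beq i.val 1 && Nat.beq j.val 0) = true := by simpa using h5
        rw [if_pos (e2.2 h5), h6, cond_true]
      · have h6 : (Nat.beq i.val 1 && Nat.beq j.val 0) = false := by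
          rw [← Bool.not_eq_true]
          simpa using h5
        rw [if_neg (fun h => h5 (e2.1 h)), h6, cond_false]
    have hx2 : x ∈ rolePairs := by
      have : x ∈ rolePairs.filter
          (roleTest g kA kB (2 * P.val + a.val) (2 * Q.val + b.val)) := by
        rw [hx]
        simp
      exact (List.mem_filter.1 this).1
    obtain ⟨l1, l2⟩ := rolePairs_lt x hx2
    refine ⟨(⟨x.1, l1⟩, ⟨x.2, l2⟩), (hR _).2 rfl, ?_⟩
    intro y hy
    have h6 := (hR y).1 hy
    subst h6
    rfl

/-- The pair of tripartite ingredients exists. -/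
def Tri (P : List ℕ) (g : ℕ) : Prop :=
  ∃ RA RB, Dec (nxF P) RA ∧ Dec (nxF P) RB ∧ Compat g RA RB

theorem tri_of_chk {P : List ℕ} {g : ℕ} {baseA baseB : List ℕ}
    (h : chkAB P g baseA baseB = true) : Tri P g := by
  obtain ⟨kA, h1, hA⟩ := chk_spec h
  obtain ⟨kB, h2, hB⟩ := chk_spec h1
  exact ⟨TriMask g kA, TriMask g kB, hA.mapEquiv _, hB.mapEquiv _, compat_of_test h2⟩

/-! ### From decompositions to solutions -/

/-- Successor on the positions of a disjoint union of cycles. -/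
def sigNx {t : ℕ} (m : Fin t → ℕ) (x : (i : Fin t) × Fin (m i)) : (i : Fin t) × Fin (m i) :=
  ⟨x.1, ⟨(x.2.val + 1) % m x.1, Nat.mod_lt _ (Nat.zero_lt_of_lt x.2.2)⟩⟩

theorem fin2_ne : ∀ b d : Fin 2, b ≠ d → d = b + 1 := by decide

theorem isIEdge_iff {n : ℕ} (u v : HOPVertex n) (huv : u ≠ v) : IsIEdge s(u, v) ↔ u.1 = v.1 := by
  constructor
  · rintro ⟨w, hw⟩
    rw [Sym2.eq_iff] at hw
    rcases hw with ⟨rfl, rfl⟩ | ⟨rfl, rfl⟩ <;> rfl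
  · intro h
    refine ⟨u, ?_⟩
    obtain ⟨a, b⟩ := u
    obtain ⟨c, d⟩ := v
    simp only at h
    subst h
    have : d = b + 1 := fin2_ne b d fun h => huv (by rw [h])
    simp [HOPspouse, this]

section factor

variable {n s t : ℕ} {m : Fin t → ℕ} (hm : ∀ i, 2 ≤ m i)
  (b : ((i : Fin t) × Fin (m i)) → HOPVertex n)

/-- The position of a vertex of a cycle. -/
def halfPos (i : Fin t) (z : ZMod (2 * m i)) (hz : z.val < 2 * m i) :
    (i : Fin t) × Fin (m i) := ⟨i, ⟨z.val / 2, by omega⟩⟩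

/-- The cycles described by a block. -/
def mkCyc (hv : ∀ i (z : ZMod (2 * m i)), z.val < 2 * m i) (i : Fin t) (z : ZMod (2 * m i)) :
    HOPVertex n :=
  if z.val % 2 = 0 then b (halfPos i z (hv i z)) else HOPspouse (b (halfPos i z (hv i z)))

end factor

theorem val_lt' {t : ℕ} {m : Fin t → ℕ} (hm : ∀ i, 2 ≤ m i) (i : Fin t) (z : ZMod (2 * m i)) :
    z.val < 2 * m i := by
  have := hm i
  have : NeZero (2 * m i) := ⟨by omega⟩
  exact ZMod.val_lt z

theorem val_succ' {N : ℕ} (hN : 2 ≤ N) (z : ZMod N) :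
    (z + 1).val = if z.val + 1 < N then z.val + 1 else 0 := by
  have : NeZero N := ⟨by omega⟩
  have : Fact (1 < N) := ⟨by omega⟩
  have hz := ZMod.val_lt z
  rw [ZMod.val_add, ZMod.val_one]
  split_ifs with h
  · exact Nat.mod_eq_of_lt h
  · have : z.val + 1 = N := by omega
    rw [this, Nat.mod_self]

theorem exists_factor {n s t : ℕ} {m : Fin t → ℕ} (hm : ∀ i, 2 ≤ m i) (hn : n = s + ∑ i, m i)
    (b : ((i : Fin t) × Fin (m i)) → HOPVertex n) (hb : Function.Injective fun j => (b j).1) :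
    ∃ F : HOPFactor n s t m, ∀ e : Sym2 (HOPVertex n), ¬ IsIEdge e →
      (e ∈ F.edges ↔ ∃ j d, e = s((dart (sigNx m) b j d).1, (dart (sigNx m) b j d).2)) := by
  classical
  have hv := val_lt' hm
  let J := (i : Fin t) × Fin (m i)
  have hcJ : Fintype.card J = ∑ i, m i := by simp [J]
  -- the couples that sit alone
  let C := {v : Fin n // v ∉ Set.range fun j => (b j).1}
  have hcC : Fintype.card C = s := by
    have h1 : Fintype.card C = Fintype.card (Fin n) -
        Fintype.card {v : Fin n // v ∈ Set.range fun j => (b j).1} :=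
      Fintype.card_subtype_compl _
    have h2 : Fintype.card {v : Fin n // v ∈ Set.range fun j => (b j).1} = Fintype.card J :=
      Set.card_range_of_injective hb
    rw [h1, h2, hcJ, Fintype.card_fin]
    omega
  let eC : Fin s ≃ C := (Fintype.equivFinOfCardEq hcC).symm
  let cyc : (i : Fin t) → ZMod (2 * m i) → HOPVertex n := mkCyc b hv
  have even : ∀ i (z : ZMod (2 * m i)), z.val % 2 = 0 → cyc i z = b (halfPos i z (hv i z)) := by
    intro i z hz
    simp only [cyc, mkCyc, hz, if_true]
  have odd : ∀ i (z : ZMod (2 * m i)), z.val % 2 = 1 →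
      cyc i z = HOPspouse (b (halfPos i z (hv i z))) := by
    intro i z hz
    have : ¬ z.val % 2 = 0 := by omega
    simp only [cyc, mkCyc, this, if_false]
  have vs : ∀ i (z : ZMod (2 * m i)), (z + 1).val =
      if z.val + 1 < 2 * m i then z.val + 1 else 0 := fun i z =>
    val_succ' (by have := hm i; omega) z
  have pe : ∀ i (z : ZMod (2 * m i)), z.val % 2 = 0 → (z + 1).val % 2 = 1 ∧
      halfPos i (z + 1) (hv i _) = halfPos i z (hv i z) := by
    intro i z hz
    have h1 := vs i z
    have h2 := hv i z
    rw [if_pos (by omega)] at h1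
    refine ⟨by omega, ?_⟩
    simp only [halfPos, Sigma.mk.injEq, heq_eq_eq, true_and, Fin.mk.injEq]
    omega
  have po : ∀ i (z : ZMod (2 * m i)), z.val % 2 = 1 → (z + 1).val % 2 = 0 ∧
      halfPos i (z + 1) (hv i _) = sigNx m (halfPos i z (hv i z)) := by
    intro i z hz
    have h1 := vs i z
    have h2 := hv i z
    have h3 := hm i
    by_cases h4 : z.val + 1 < 2 * m i
    · rw [if_pos h4] at h1
      refine ⟨by omega, ?_⟩
      simp only [halfPos, sigNx, Sigma.mk.injEq, heq_eq_eq, true_and, Fin.mk.injEq]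
      rw [Nat.mod_eq_of_lt (by omega)]
      omega
    · rw [if_neg h4] at h1
      refine ⟨by omega, ?_⟩
      simp only [halfPos, sigNx, Sigma.mk.injEq, heq_eq_eq, true_and, Fin.mk.injEq]
      have h5 : z.val / 2 + 1 = m i := by omega
      rw [h5, h1, Nat.mod_self]
  have stepO : ∀ i (z : ZMod (2 * m i)), z.val % 2 = 1 →
      (cyc i z, cyc i (z + 1)) = dart (sigNx m) b (halfPos i z (hv i z)) false := by
    intro i z hz
    rw [odd i z hz, even i _ (po i z hz).1, (po i z hz).2]
    rfl
  have nxne : ∀ j : J, sigNx m j ≠ j := by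
    rintro ⟨i, j⟩ h
    simp only [sigNx, Sigma.mk.injEq, heq_eq_eq, true_and, Fin.ext_iff] at h
    have h3 := hm i
    have h4 := j.2
    rcases Nat.lt_or_ge (j.val + 1) (m i) with h5 | h5
    · rw [Nat.mod_eq_of_lt h5] at h
      omega
    · have h6 : j.val + 1 = m i := by omega
      rw [h6, Nat.mod_self] at h
      omega
  have dne : ∀ j, (b j).1 ≠ (b (sigNx m j)).1 := fun j h => nxne j (hb h).symm
  have notI : ∀ j, ¬ IsIEdge s((dart (sigNx m) b j false).1, (dart (sigNx m) b j false).2) := by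
    intro j h
    have h1 : (dart (sigNx m) b j false).1 ≠ (dart (sigNx m) b j false).2 := by
      intro h
      have h0 := congrArg Prod.fst h
      exact dne j h0
    rw [isIEdge_iff _ _ h1] at h
    exact dne j h
  -- every position is reached
  have reach : ∀ j : J, ∀ e : ℕ, e < 2 → ∃ z : ZMod (2 * m j.1),
      z.val % 2 = e ∧ halfPos j.1 z (hv j.1 z) = j := by
    rintro ⟨i, j⟩ e he
    have h3 := hm i
    have h4 := j.2
    have : NeZero (2 * m i) := ⟨by omega⟩
    have h5 : ((2 * j.val + e : ℕ) : ZMod (2 * m i)).val = 2 * j.val + e :=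
      ZMod.val_natCast_of_lt (by omega)
    refine ⟨((2 * j.val + e : ℕ) : ZMod (2 * m i)), ?_, ?_⟩
    · simp only
      rw [h5]
      omega
    · simp only [halfPos, Sigma.mk.injEq, heq_eq_eq, true_and, Fin.ext_iff]
      rw [h5]
      omega
  have two : ∀ (x y : Fin 2), x = y ∨ x = y + 1 := by decide
  have spanning : Function.Bijective (Sum.elim
      (fun a : Fin s × Fin 2 => if a.2 = 0 then ((eC a.1).1, (0 : Fin 2))
        else HOPspouse ((eC a.1).1, (0 : Fin 2)))
      (fun x : (i : Fin t) × ZMod (2 * m i) => cyc x.1 x.2)) := by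
    have : ∀ i, NeZero (2 * m i) := fun i => ⟨by have := hm i; omega⟩
    rw [Fintype.bijective_iff_surjective_and_card]
    constructor
    · rintro ⟨v, c⟩
      by_cases hvC : v ∈ Set.range fun j => (b j).1
      · obtain ⟨j, hj⟩ := hvC
        simp only at hj
        rcases two c (b j).2 with h | h
        · obtain ⟨z, z1, z2⟩ := reach j 0 (by norm_num)
          refine ⟨Sum.inr ⟨j.1, z⟩, ?_⟩
          simp only [Sum.elim_inr]
          rw [even _ _ z1, z2, ← hj, h]
        · obtain ⟨z, z1, z2⟩ := reach j 1 (by norm_num)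
          refine ⟨Sum.inr ⟨j.1, z⟩, ?_⟩
          simp only [Sum.elim_inr]
          rw [odd _ _ z1, z2, ← hj, h]
          rfl
      · refine ⟨Sum.inl (eC.symm ⟨v, hvC⟩, c), ?_⟩
        simp only [Sum.elim_inl, Equiv.apply_symm_apply]
        fin_cases c <;> rfl
    · simp only [Fintype.card_sum, Fintype.card_prod, Fintype.card_fin, Fintype.card_sigma,
        ZMod.card]
      rw [← Finset.mul_sum, hn]
      ring
  let F : HOPFactor n s t m :=
    { pair := fun a => ((eC a).1, 0)
      cyc := cyc
      alt_even := by
        intro i z hz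
        rw [even i z hz, odd i _ (pe i z hz).1, (pe i z hz).2]
      alt_odd := by
        intro i z hz
        have h1 := stepO i z hz
        have h2 := notI (halfPos i z (hv i z))
        rw [← h1] at h2
        exact h2
      spanning := spanning }
  refine ⟨F, fun e he => ?_⟩
  constructor
  · rintro (⟨a, rfl⟩ | ⟨i, z, rfl⟩)
    · exact absurd ⟨_, rfl⟩ he
    · rcases Nat.mod_two_eq_zero_or_one z.val with hz | hz
      · exfalso
        refine he ⟨cyc i z, ?_⟩
        rw [F.alt_even i z hz]
      · refine ⟨halfPos i z (hv i z), false, ?_⟩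
        rw [← stepO i z hz]
  · rintro ⟨j, d, rfl⟩
    obtain ⟨z, z1, z2⟩ := reach j 1 (by norm_num)
    have h1 := stepO j.1 z z1
    rw [z2] at h1
    refine Or.inr ⟨j.1, z, ?_⟩
    cases d
    · rw [← h1]
    · have h2 : dart (sigNx m) b j true = (dart (sigNx m) b j false).swap := rfl
      rw [h2, ← h1]
      exact Sym2.eq_swap

theorem solution_of_dec {n s t : ℕ} {m : Fin t → ℕ} (hm : ∀ i, 2 ≤ m i)
    (hn : n = s + ∑ i, m i) (h : Dec (sigNx m) (Full (Fin n))) : HOPSolution n s t m := by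
  classical
  obtain ⟨ι, _, B, h1, h2, h3⟩ := h
  let e : ι ≃ Fin (Fintype.card ι) := Fintype.equivFin ι
  choose F hF using fun k => exists_factor (s := s) hm hn (B k) (h1 k)
  refine ⟨Fintype.card ι, ?_, fun k => F (e.symm k), ?_⟩
  · -- counting darts
    let f : ι × ((i : Fin t) × Fin (m i)) × Bool →
        {x : (Fin n × Fin 2) × (Fin n × Fin 2) // x.1.1 ≠ x.2.1} :=
      fun x => ⟨dart (sigNx m) (B x.1) x.2.1 x.2.2, h2 _ _ _⟩
    have hf : Function.Bijective f := by
      constructor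
      · intro x y hxy
        have h4 := congrArg Subtype.val hxy
        simp only [f] at h4
        have h5 : Full (Fin n) (dart (sigNx m) (B y.1) y.2.1 y.2.2).1
          (dart (sigNx m) (B y.1) y.2.1 y.2.2).2 := h2 _ _ _
        exact (h3 _ _ h5).unique h4 rfl
      · rintro ⟨⟨p, q⟩, hpq⟩
        obtain ⟨x, hx, -⟩ := h3 p q hpq
        exact ⟨x, Subtype.ext hx⟩
    have hc := Fintype.card_of_bijective hf
    let g : {x : (Fin n × Fin 2) × (Fin n × Fin 2) // x.1.1 ≠ x.2.1} ≃
        {y : Fin n × Fin n // y.1 ≠ y.2} × (Fin 2 × Fin 2) :=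
      { toFun := fun x => (⟨(x.1.1.1, x.1.2.1), x.2⟩, (x.1.1.2, x.1.2.2))
        invFun := fun y => ⟨((y.1.1.1, y.2.1), (y.1.1.2, y.2.2)), y.1.2⟩
        left_inv := fun _ => rfl
        right_inv := fun _ => rfl }
    have hoff : Fintype.card {y : Fin n × Fin n // y.1 ≠ y.2} = n * n - n := by
      rw [Fintype.card_subtype]
      have := Finset.offDiag_card (Finset.univ : Finset (Fin n))
      rw [Finset.card_univ, Fintype.card_fin] at this
      rw [← this]
      congr 1
      ext y
      simp
    rw [Fintype.card_congr g] at hc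
    simp only [Fintype.card_prod, Fintype.card_sigma, Fintype.card_fin, Fintype.card_bool,
      hoff] at hc
    have h6 : n * n - n = n * (n - 1) := by
      rw [Nat.mul_sub, mul_one]
    rw [h6] at hc
    have h7 : 2 * n * (n - 1) = 2 * (n * (n - 1)) := by ring
    rw [h7]
    generalize n * (n - 1) = N at hc
    rw [← mul_assoc] at hc
    omega
  · intro ed hd hI
    induction ed using Sym2.ind with
    | _ u v =>
      have huv : u ≠ v := by simpa using hd
      have hfull : Full (Fin n) u v := fun h => hI ((isIEdge_iff u v huv).2 h)
      obtain ⟨⟨k, j, d⟩, hx, hu⟩ := h3 u v hfull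
      simp only at hx
      refine ⟨e k, ?_, ?_⟩
      · refine (hF _ _ hI).2 ⟨j, d, ?_⟩
        rw [e.symm_apply_apply, hx]
      · intro k' hk'
        obtain ⟨j', d', h8⟩ := (hF _ _ hI).1 hk'
        rw [Sym2.eq_iff] at h8
        have h9 : ∃ d'', dart (sigNx m) (B (e.symm k')) j' d'' = (u, v) := by
          rcases h8 with ⟨a1, a2⟩ | ⟨a1, a2⟩
          · exact ⟨d', by rw [a1, a2]⟩
          · exact ⟨!d', by rw [dart_not, a1, a2]; rfl⟩
        obtain ⟨d'', h9⟩ := h9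
        have := hu (e.symm k', j', d'') h9
        simp only [Prod.mk.injEq] at this
        rw [← this.1, e.apply_symm_apply]

/-! ### Assembling the solutions -/

/-- The position in the concatenation. -/
def posn (P : List ℕ) (x : (i : Fin P.length) × Fin (P.get i)) : ℕ :=
  (P.take x.1.val).sum + x.2.val

/-- All admissible decompositions exist for the cycle type `P`. -/
def Good (P : List ℕ) : Prop :=
  ∀ n, P.sum ≤ n → Odd n → n * (n - 1) ≡ 0 [MOD 2 * P.sum] → Dec (nxF P) (Full (Fin n))

theorem sol_of_good {P : List ℕ} (hg : Good P) (h2 : ∀ i, 2 ≤ P.get i)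
    (p1 : ∀ x, posn P x < P.sum) (p2 : ∀ x y, posn P x = posn P y → x = y)
    (p3 : ∀ x, posn P (sigNx P.get x) = nxt P (posn P x)) {n s : ℕ} (hn : n = s + P.sum)
    (hodd : Odd n) (hc : n * (n - 1) ≡ 0 [MOD 2 * P.sum]) :
    HOPSolution n s P.length P.get := by
  have hsum : ∑ i, P.get i = P.sum := by
    simp
  refine solution_of_dec h2 (by rw [hsum]; exact hn) ?_
  let f : ((i : Fin P.length) × Fin (P.get i)) → Fin P.sum := fun x => ⟨posn P x, p1 x⟩
  have hf : Function.Bijective f := by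
    rw [Fintype.bijective_iff_injective_and_card]
    refine ⟨fun x y h => p2 x y (congrArg Fin.val h), ?_⟩
    rw [Fintype.card_sigma, Fintype.card_fin, ← hsum]
    simp only [Fintype.card_fin]
  refine (hg n (by omega) hodd hc).reindex (Equiv.ofBijective f hf) ?_
  intro x
  exact Fin.ext (p3 x)

theorem glue_full {P : List ℕ} {g f h n : ℕ} (T : Tri P g) (hh : 3 ≤ h)
    (hE : Dec (nxF P) (Full (Fin (g + f)))) (hH : Dec (nxF P) (Hole g f))
    (hn : n = g * h + f) : Dec (nxF P) (Full (Fin n)) := by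
  obtain ⟨RA, RB, hA, hB, hc⟩ := T
  have h0 := Dec.glue hh hA hB hc (hE.full_equiv finSumFinEquiv) hH
  refine h0.full_equiv (Fintype.equivOfCardEq ?_)
  simp only [Fintype.card_sum, Fintype.card_prod, Fintype.card_fin]
  rw [hn]
  ring

theorem hole_of_full {P : List ℕ} {g f : ℕ} (hf : f ≤ 1)
    (hE : Dec (nxF P) (Full (Fin (g + f)))) : Dec (nxF P) (Hole g f) := by
  refine (hE.full_equiv finSumFinEquiv).congr ?_
  rintro ⟨p, a⟩ ⟨q, b⟩
  simp only [Full, Hole]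
  constructor
  · intro h
    refine ⟨h, ?_⟩
    rintro ⟨h1, h2⟩
    rcases p with p | p
    · simp at h1
    rcases q with q | q
    · simp at h2
    apply h
    congr 1
    ext
    omega
  · exact fun h => h.1

theorem case_one {P : List ℕ} {M : ℕ} (T : Tri P M) (hF : Dec (nxF P) (Full (Fin (M + 1))))
    (hG : Dec (nxF P) (Full (Fin (2 * M + 1)))) {k n : ℕ} (hk : 1 ≤ k)
    (hn : n = 2 * M * k + 1) : Dec (nxF P) (Full (Fin n)) := by
  rcases Nat.lt_or_ge k 2 with h | h
  · obtain rfl : k = 1 := by omega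
    rw [mul_one] at hn
    exact hn ▸ hG
  · refine glue_full (h := 2 * k) T (by omega) hF (hole_of_full le_rfl hF) ?_
    rw [hn]
    ring

theorem case_odd {P : List ℕ} {M : ℕ} (T : Tri P M) (hE : Dec (nxF P) (Full (Fin M))) {k n : ℕ}
    (hn : n = M * (2 * k + 1)) : Dec (nxF P) (Full (Fin n)) := by
  rcases Nat.eq_zero_or_pos k with rfl | h
  · rw [mul_zero, zero_add, mul_one] at hn
    exact hn ▸ hE
  · exact glue_full (f := 0) (h := 2 * k + 1) T (by omega) hE
      (hole_of_full (by norm_num) hE) hn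

/-- Reduction of the congruence to residues. -/
theorem residue {M n : ℕ} (hM : 0 < M) (h1 : 1 ≤ n) (hodd : Odd n)
    (hc : n * (n - 1) ≡ 0 [MOD 2 * M]) :
    ∃ r k, r < 2 * M ∧ n = 2 * M * k + r + 1 ∧ r % 2 = 0 ∧ (r + 1) * r % (2 * M) = 0 := by
  refine ⟨(n - 1) % (2 * M), (n - 1) / (2 * M), Nat.mod_lt _ (by omega), ?_, ?_, ?_⟩
  · have := Nat.div_add_mod (n - 1) (2 * M)
    omega
  · rw [Nat.mod_mul_right_mod]
    obtain ⟨k, hk⟩ := hodd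
    omega
  · have h2 : n - 1 + 1 = n := by omega
    have h3 : ((n - 1) % (2 * M) + 1) * ((n - 1) % (2 * M)) ≡ (n - 1 + 1) * (n - 1) [MOD 2 * M] :=
      Nat.ModEq.mul ((Nat.mod_modEq _ _).add_right 1) (Nat.mod_modEq _ _)
    rw [h2] at h3
    exact h3.trans hc

theorem res_two : ∀ M ∈ [2, 4, 8], ∀ r < 2 * M, r % 2 = 0 → (r + 1) * r % (2 * M) = 0 →
    r = 0 := by decide

theorem res_odd : ∀ M ∈ [3, 5, 7, 9], ∀ r < 2 * M, r % 2 = 0 → (r + 1) * r % (2 * M) = 0 →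
    r = 0 ∨ r + 1 = M := by decide

theorem res_six : ∀ r < 2 * 6, r % 2 = 0 → (r + 1) * r % (2 * 6) = 0 →
    r = 0 ∨ r = 8 := by decide

theorem res_ten : ∀ r < 2 * 10, r % 2 = 0 → (r + 1) * r % (2 * 10) = 0 →
    r = 0 ∨ r = 4 := by decide

theorem good_two {P : List ℕ} (M : ℕ) (hM : M ∈ [2, 4, 8]) (hP : P.sum = M) (T : Tri P M)
    (hF : Dec (nxF P) (Full (Fin (M + 1)))) (hG : Dec (nxF P) (Full (Fin (2 * M + 1)))) :
    Good P := by
  intro n hn hodd hc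
  rw [hP] at hn hc
  have hM2 : 2 ≤ M := by
    simp only [List.mem_cons, List.not_mem_nil, or_false] at hM
    omega
  obtain ⟨r, k, h1, h2, h3, h4⟩ := residue (by omega) (by omega) hodd hc
  obtain rfl := res_two M hM r h1 h3 h4
  refine case_one T hF hG (k := k) ?_ (by omega)
  rcases Nat.eq_zero_or_pos k with rfl | h
  · simp only [mul_zero] at h2
    omega
  · exact h

theorem good_odd {P : List ℕ} (M : ℕ) (hM : M ∈ [3, 5, 7, 9]) (hP : P.sum = M) (T : Tri P M)
    (hE : Dec (nxF P) (Full (Fin M)))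
    (hF : Dec (nxF P) (Full (Fin (M + 1)))) (hG : Dec (nxF P) (Full (Fin (2 * M + 1)))) :
    Good P := by
  intro n hn hodd hc
  rw [hP] at hn hc
  have hM2 : 2 ≤ M := by
    simp only [List.mem_cons, List.not_mem_nil, or_false] at hM
    omega
  obtain ⟨r, k, h1, h2, h3, h4⟩ := residue (by omega) (by omega) hodd hc
  rcases res_odd M hM r h1 h3 h4 with rfl | hr
  · refine case_one T hF hG (k := k) ?_ (by omega)
    rcases Nat.eq_zero_or_pos k with rfl | h
    · simp only [mul_zero] at h2
      omega
    · exact h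
  · refine case_odd T hE (k := k) ?_
    rw [h2, add_assoc, hr]
    ring

theorem good_six {P : List ℕ} (hP : P.sum = 6) (T : Tri P 6)
    (hF : Dec (nxF P) (Full (Fin 7))) (hG : Dec (nxF P) (Full (Fin 13)))
    (hE : Dec (nxF P) (Full (Fin 9))) (hH : Dec (nxF P) (Hole 6 3)) : Good P := by
  intro n hn hodd hc
  rw [hP] at hn hc
  obtain ⟨r, k, h1, h2, h3, h4⟩ := residue (by omega) (by omega) hodd hc
  rcases res_six r h1 h3 h4 with rfl | rfl
  · exact case_one T hF hG (k := k) (by omega) (by omega)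
  · rcases Nat.eq_zero_or_pos k with rfl | h
    · obtain rfl : n = 9 := by omega
      exact hE
    · exact glue_full (h := 2 * k + 1) T (by omega) hE hH (by omega)

theorem good_ten {P : List ℕ} (hP : P.sum = 10) (T : Tri P 10)
    (hF : Dec (nxF P) (Full (Fin 11))) (hG : Dec (nxF P) (Full (Fin 21)))
    (hE : Dec (nxF P) (Full (Fin 15))) (hH : Dec (nxF P) (Hole 10 5))
    (hJ : Dec (nxF P) (Full (Fin 25))) : Good P := by
  intro n hn hodd hc
  rw [hP] at hn hc
  obtain ⟨r, k, h1, h2, h3, h4⟩ := residue (by omega) (by omega) hodd hc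
  rcases res_ten r h1 h3 h4 with rfl | rfl
  · exact case_one T hF hG (k := k) (by omega) (by omega)
  · rcases Nat.lt_or_ge k 2 with h | h
    · obtain rfl : n = 25 := by omega
      exact hJ
    · exact glue_full (h := 2 * k) T (by omega) hE hH (by omega)

/-! ### Explicit ingredients, cycle type by cycle type -/

theorem tAB2 : Tri [2] 2 :=
  tri_of_chk (baseA := [703, 401])
    (baseB := [402, 304])
    (by decide +kernel)

theorem tF2 : Dec (nxF [2]) (Full (Fin 3)) :=
  full_of_chk (w := 3) (L := 3) (tw := 0) (s := 1) (r := 3) (base :=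
    [305, 500])
    (by decide +kernel)

theorem tG2 : Dec (nxF [2]) (Full (Fin 5)) :=
  full_of_chk (w := 5) (L := 5) (tw := 0) (s := 1) (r := 5) (base :=
    [507, 508, 602, 708])
    (by decide +kernel)

theorem g2 : Good [2] :=
  good_two 2 (by decide) rfl tAB2 tF2 tG2

theorem tAB3 : Tri [3] 3 :=
  tri_of_chk (baseA := [10616, 71600])
    (baseB := [61600, 100415])
    (by decide +kernel)

theorem tE3 : Dec (nxF [3]) (Full (Fin 3)) :=
  full_of_chk (w := 2) (L := 2) (tw := 1) (s := 1) (r := 4) (base :=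
    [50003])
    (by decide +kernel)

theorem tF3 : Dec (nxF [3]) (Full (Fin 4)) :=
  full_of_chk (w := 4) (L := 4) (tw := 1) (s := 1) (r := 8) (base :=
    [50207])
    (by decide +kernel)

theorem tG3 : Dec (nxF [3]) (Full (Fin 7)) :=
  full_of_chk (w := 7) (L := 7) (tw := 0) (s := 1) (r := 7) (base :=
    [91307, 70810, 100403, 30610])
    (by decide +kernel)

theorem g3 : Good [3] :=
  good_odd 3 (by decide) rfl tAB3 tE3 tF3 tG3

theorem tAB2_2 : Tri [2, 2] 4 :=
  tri_of_chk (baseA := [15051103, 6120118])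
    (baseB := [6170905, 13000714])
    (by decide +kernel)

theorem tF2_2 : Dec (nxF [2, 2]) (Full (Fin 5)) :=
  full_of_chk (w := 5) (L := 5) (tw := 0) (s := 1) (r := 5) (base :=
    [2090507, 2080506])
    (by decide +kernel)

theorem tG2_2 : Dec (nxF [2, 2]) (Full (Fin 9)) :=
  full_of_chk (w := 9) (L := 9) (tw := 0) (s := 1) (r := 9) (base :=
    [14020912, 16061012, 170213, 2060815])
    (by decide +kernel)

theorem g2_2 : Good [2, 2] :=
  good_two 4 (by decide) rfl tAB2_2 tF2_2 tG2_2

theorem tAB4 : Tri [4] 4 :=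
  tri_of_chk (baseA := [15161201, 111913])
    (baseB := [91714, 11021317])
    (by decide +kernel)

theorem tF4 : Dec (nxF [4]) (Full (Fin 5)) :=
  full_of_chk (w := 5) (L := 5) (tw := 1) (s := 1) (r := 10) (base :=
    [2000506])
    (by decide +kernel)

theorem tG4 : Dec (nxF [4]) (Full (Fin 9)) :=
  full_of_chk (w := 9) (L := 9) (tw := 1) (s := 1) (r := 18) (base :=
    [3090017, 13141001])
    (by decide +kernel)

theorem g4 : Good [4] :=
  good_two 4 (by decide) rfl tAB4 tF4 tG4

theorem tAB2_3 : Tri [2, 3] 5 :=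
  tri_of_chk (baseA := [1229020724, 1202281426])
    (baseB := [1203282506, 1229031426])
    (by decide +kernel)

theorem tE2_3 : Dec (nxF [2, 3]) (Full (Fin 5)) :=
  full_of_chk (w := 1) (L := 0) (tw := 0) (s := 1) (r := 1) (base :=
    [704020801, 602080004, 805030700, 502090701, 906050200, 306040901, 508070300, 608020104])
    (by decide +kernel)

theorem tF2_3 : Dec (nxF [2, 3]) (Full (Fin 6)) :=
  full_of_chk (w := 3) (L := 6) (tw := 0) (s := 1) (r := 3) (base :=
    [307041109, 208000510, 210040708, 408010306])
    (by decide +kernel)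

theorem tG2_3 : Dec (nxF [2, 3]) (Full (Fin 11)) :=
  full_of_chk (w := 11) (L := 11) (tw := 0) (s := 1) (r := 11) (base :=
    [1405101816, 509181220, 720101218, 2111140506])
    (by decide +kernel)

theorem g2_3 : Good [2, 3] :=
  good_odd 5 (by decide) rfl tAB2_3 tE2_3 tF2_3 tG2_3

theorem tAB5 : Tri [5] 5 :=
  tri_of_chk (baseA := [1403122709, 413031628])
    (baseB := [1506160028, 1203271501])
    (by decide +kernel)

theorem tE5 : Dec (nxF [5]) (Full (Fin 5)) :=
  full_of_chk (w := 4) (L := 4) (tw := 1) (s := 1) (r := 8) (base :=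
    [709020500])
    (by decide +kernel)

theorem tF5 : Dec (nxF [5]) (Full (Fin 6)) :=
  full_of_chk (w := 3) (L := 6) (tw := 0) (s := 1) (r := 3) (base :=
    [801110206, 7081105, 702040901, 1104020109])
    (by decide +kernel)

theorem tG5 : Dec (nxF [5]) (Full (Fin 11)) :=
  full_of_chk (w := 11) (L := 11) (tw := 0) (s := 1) (r := 11) (base :=
    [1805000716, 1102150708, 1505201719, 1812041006])
    (by decide +kernel)

theorem g5 : Good [5] :=
  good_odd 5 (by decide) rfl tAB5 tE5 tF5 tG5

theorem tAB2_2_2 : Tri [2, 2, 2] 6 :=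
  tri_of_chk (baseA := [182806230413, 191122062008])
    (baseB := [291913000523, 220511200114])
    (by decide +kernel)

theorem tF2_2_2 : Dec (nxF [2, 2, 2]) (Full (Fin 7)) :=
  full_of_chk (w := 7) (L := 7) (tw := 0) (s := 1) (r := 7) (base :=
    [91304030600, 20401081106])
    (by decide +kernel)

theorem tG2_2_2 : Dec (nxF [2, 2, 2]) (Full (Fin 13)) :=
  full_of_chk (w := 13) (L := 13) (tw := 0) (s := 1) (r := 13) (base :=
    [141118062320, 152204110718, 110103052213, 111525170612])
    (by decide +kernel)

theorem tE2_2_2 : Dec (nxF [2, 2, 2]) (Full (Fin 9)) :=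
  full_of_chk (w := 3) (L := 9) (tw := 0) (s := 1) (r := 3) (base :=
    [140907001610, 60017090215, 50812110217, 50213140711, 110804151303, 121603110605,
     21401050913, 11117061204])
    (by decide +kernel)

theorem tH2_2_2 : Dec (nxF [2, 2, 2]) (Hole 6 3) :=
  hole_of_chk (w := 1) (L := 0) (tw := 0) (s := 1) (r := 1) (base :=
    [90117030406, 10510090307, 121104020709, 41411060801, 81401171311, 170401061203,
     70215100917, 20800130614, 51709111500, 60013030914, 31404130711, 11109061702,
     41512091117, 130116060805, 160704110209, 120407141003, 60511160115, 120702140011,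
     160113090304, 160900030511, 50911150002, 512061002])
    (by decide +kernel)

theorem g2_2_2 : Good [2, 2, 2] :=
  good_six rfl tAB2_2_2 tF2_2_2 tG2_2_2 tE2_2_2 tH2_2_2

theorem tAB2_4 : Tri [2, 4] 6 :=
  tri_of_chk (baseA := [32704332907, 130417103014])
    (baseB := [130433102907, 51611352521])
    (by decide +kernel)

theorem tF2_4 : Dec (nxF [2, 4]) (Full (Fin 7)) :=
  full_of_chk (w := 7) (L := 7) (tw := 0) (s := 1) (r := 7) (base :=
    [50708131003, 40710020913])
    (by decide +kernel)

theorem tG2_4 : Dec (nxF [2, 4]) (Full (Fin 13)) :=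
  full_of_chk (w := 13) (L := 13) (tw := 0) (s := 1) (r := 13) (base :=
    [305091520, 101916212414, 120006182310, 131107021901])
    (by decide +kernel)

theorem tE2_4 : Dec (nxF [2, 4]) (Full (Fin 9)) :=
  full_of_chk (w := 3) (L := 9) (tw := 0) (s := 1) (r := 3) (base :=
    [110103070514, 101615050802, 140207171112, 130911170506, 140007121002, 140417030906,
     30110150413, 160815070102])
    (by decide +kernel)

theorem tH2_4 : Dec (nxF [2, 4]) (Hole 6 3) :=
  hole_of_chk (w := 1) (L := 0) (tw := 0) (s := 1) (r := 1) (base :=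
    [111705150613, 120014030817, 10206051116, 71503160805, 141112080205, 60903010513,
     90511130317, 40201150813, 41107130902, 170007041008, 160314081000, 131114021701,
     80414070112, 160801051106, 41303110709, 1711150406, 21006120008, 121105000702,
     10309140717, 140900061003, 51706001108, 150602040011])
    (by decide +kernel)

theorem g2_4 : Good [2, 4] :=
  good_six rfl tAB2_4 tF2_4 tG2_4 tE2_4 tH2_4

theorem tAB3_3 : Tri [3, 3] 6 :=
  tri_of_chk (baseA := [192607241122, 321800101725])
    (baseB := [160530003319, 321200312204])
    (by decide +kernel)

theorem tF3_3 : Dec (nxF [3, 3]) (Full (Fin 7)) :=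
  full_of_chk (w := 1) (L := 6) (tw := 1) (s := 1) (r := 2) (base :=
    [80703010511, 100502081300, 50313070110, 100903051307, 50900101206, 207121008,
     130201060805])
    (by decide +kernel)

theorem tG3_3 : Dec (nxF [3, 3]) (Full (Fin 13)) :=
  full_of_chk (w := 13) (L := 13) (tw := 1) (s := 1) (r := 26) (base :=
    [241008121707, 100403151907])
    (by decide +kernel)

theorem tE3_3 : Dec (nxF [3, 3]) (Full (Fin 9)) :=
  full_of_chk (w := 4) (L := 8) (tw := 1) (s := 1) (r := 8) (base :=
    [140705001216, 120107111703, 101512020708])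
    (by decide +kernel)

theorem tH3_3 : Dec (nxF [3, 3]) (Hole 6 3) :=
  hole_of_chk (w := 1) (L := 6) (tw := 1) (s := 1) (r := 2) (base :=
    [100105021407, 131006031708, 11509120506, 20517090600, 41501100309, 1303170408,
     151103120904, 170601051115, 91113020406, 100016150608, 171106010313])
    (by decide +kernel)

theorem g3_3 : Good [3, 3] :=
  good_six rfl tAB3_3 tF3_3 tG3_3 tE3_3 tH3_3

theorem tAB6 : Tri [6] 6 :=
  tri_of_chk (baseA := [220015051309, 32008140718])
    (baseB := [111403220517, 220919111500])
    (by decide +kernel)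

theorem tF6 : Dec (nxF [6]) (Full (Fin 7)) :=
  full_of_chk (w := 7) (L := 7) (tw := 0) (s := 1) (r := 7) (base :=
    [71211080401, 41008031200])
    (by decide +kernel)

theorem tG6 : Dec (nxF [6]) (Full (Fin 13)) :=
  full_of_chk (w := 13) (L := 13) (tw := 1) (s := 1) (r := 26) (base :=
    [20921121406, 251916130215])
    (by decide +kernel)

theorem tE6 : Dec (nxF [6]) (Full (Fin 9)) :=
  full_of_chk (w := 4) (L := 8) (tw := 1) (s := 1) (r := 8) (base :=
    [20913001506, 150407161108, 140601111602])
    (by decide +kernel)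

theorem tH6 : Dec (nxF [6]) (Hole 6 3) :=
  hole_of_chk (w := 1) (L := 6) (tw := 1) (s := 1) (r := 2) (base :=
    [703170413, 71202160501, 140311061308, 60409031015, 50301080615, 91701110412,
     161001140807, 40711130201, 80314011311, 110916070205, 111405090117])
    (by decide +kernel)

theorem g6 : Good [6] :=
  good_six rfl tAB6 tF6 tG6 tE6 tH6

theorem tAB2_2_3 : Tri [2, 2, 3] 7 :=
  tri_of_chk (baseA := [5292233114124, 29240613270117])
    (baseB := [18013909223316, 21380340040016])
    (by decide +kernel)

theorem tE2_2_3 : Dec (nxF [2, 2, 3]) (Full (Fin 7)) :=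
  full_of_chk (w := 3) (L := 6) (tw := 0) (s := 1) (r := 3) (base :=
    [1060304081311, 4110309071301, 7020500091013, 13020006090511])
    (by decide +kernel)

theorem tF2_2_3 : Dec (nxF [2, 2, 3]) (Full (Fin 8)) :=
  full_of_chk (w := 1) (L := 0) (tw := 0) (s := 1) (r := 1) (base :=
    [10020007121404, 11000512020907, 7050114081113, 5030112140911, 7110208150113,
     110509131502, 31510090605, 11150402091307, 3071512050008, 7001502130804, 7140509001310,
     6100009031204, 11040201150708, 3000715100813, 6110308051215, 10140700130502])
    (by decide +kernel)

theorem tG2_2_3 : Dec (nxF [2, 2, 3]) (Full (Fin 15)) :=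
  full_of_chk (w := 15) (L := 15) (tw := 0) (s := 1) (r := 15) (base :=
    [9151920221701, 25071412110827, 22011029140712, 11211522270008])
    (by decide +kernel)

theorem g2_2_3 : Good [2, 2, 3] :=
  good_odd 7 (by decide) rfl tAB2_2_3 tE2_2_3 tF2_2_3 tG2_2_3

theorem tAB2_5 : Tri [2, 5] 7 :=
  tri_of_chk (baseA := [15023511302713, 20400536122509])
    (baseB := [8321704411401, 17092804372206])
    (by decide +kernel)

theorem tE2_5 : Dec (nxF [2, 5]) (Full (Fin 7)) :=
  full_of_chk (w := 3) (L := 6) (tw := 0) (s := 1) (r := 3) (base :=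
    [12000704091002, 2120905000611, 5120306001008, 7010308041012])
    (by decide +kernel)

theorem tF2_5 : Dec (nxF [2, 5]) (Full (Fin 8)) :=
  full_of_chk (w := 1) (L := 0) (tw := 0) (s := 1) (r := 1) (base :=
    [1131008060304, 6111300031409, 9020612041501, 14011106040812, 5010310130906,
     3140705111209, 20811150413, 12020410140701, 2151005060801, 11040013021509,
     11080402130614, 5080012061402, 6130300101405, 9071214110005, 9010610021314,
     6030905151100])
    (by decide +kernel)

theorem tG2_5 : Dec (nxF [2, 5]) (Full (Fin 15)) :=
  full_of_chk (w := 15) (L := 15) (tw := 0) (s := 1) (r := 15) (base :=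
    [4152810250006, 9000207272218, 10001306091529, 70211132618])
    (by decide +kernel)

theorem g2_5 : Good [2, 5] :=
  good_odd 7 (by decide) rfl tAB2_5 tE2_5 tF2_5 tG2_5

theorem tAB3_4 : Tri [3, 4] 7 :=
  tri_of_chk (baseA := [20042406003123, 17021433342411])
    (baseB := [34240318263106, 12190516063715])
    (by decide +kernel)

theorem tE3_4 : Dec (nxF [3, 4]) (Full (Fin 7)) :=
  full_of_chk (w := 6) (L := 6) (tw := 1) (s := 1) (r := 12) (base :=
    [6050903001211])
    (by decide +kernel)

theorem tF3_4 : Dec (nxF [3, 4]) (Full (Fin 8)) :=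
  full_of_chk (w := 8) (L := 8) (tw := 1) (s := 1) (r := 16) (base :=
    [11090014070313])
    (by decide +kernel)

theorem tG3_4 : Dec (nxF [3, 4]) (Full (Fin 15)) :=
  full_of_chk (w := 15) (L := 15) (tw := 0) (s := 1) (r := 15) (base :=
    [2280921180016, 23261029132114, 25040929200722, 6142112261929])
    (by decide +kernel)

theorem g3_4 : Good [3, 4] :=
  good_odd 7 (by decide) rfl tAB3_4 tE3_4 tF3_4 tG3_4

theorem tAB7 : Tri [7] 7 :=
  tri_of_chk (baseA := [8173704250721, 141023073717])
    (baseB := [25041708190131, 16032106220536])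
    (by decide +kernel)

theorem tE7 : Dec (nxF [7]) (Full (Fin 7)) :=
  full_of_chk (w := 6) (L := 6) (tw := 1) (s := 1) (r := 12) (base :=
    [9100701130305])
    (by decide +kernel)

theorem tF7 : Dec (nxF [7]) (Full (Fin 8)) :=
  full_of_chk (w := 8) (L := 8) (tw := 1) (s := 1) (r := 16) (base :=
    [51412110307])
    (by decide +kernel)

theorem tG7 : Dec (nxF [7]) (Full (Fin 15)) :=
  full_of_chk (w := 15) (L := 15) (tw := 0) (s := 1) (r := 15) (base :=
    [12240515291610, 13072618210408, 8172915192207, 21260911032401])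
    (by decide +kernel)

theorem g7 : Good [7] :=
  good_odd 7 (by decide) rfl tAB7 tE7 tF7 tG7

theorem tAB2_2_2_2 : Tri [2, 2, 2, 2] 8 :=
  tri_of_chk (baseA := [3036330528031118, 4027023607220521])
    (baseB := [928304526153810, 3731251426020438])
    (by decide +kernel)

theorem tF2_2_2_2 : Dec (nxF [2, 2, 2, 2]) (Full (Fin 9)) :=
  full_of_chk (w := 9) (L := 9) (tw := 0) (s := 1) (r := 9) (base :=
    [710141602130509, 1206161114040102])
    (by decide +kernel)

theorem tG2_2_2_2 : Dec (nxF [2, 2, 2, 2]) (Full (Fin 17)) :=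
  full_of_chk (w := 17) (L := 17) (tw := 0) (s := 1) (r := 17) (base :=
    [3204152730282111, 2007333015041924, 3325200029020427, 1712190104081530])
    (by decide +kernel)

theorem g2_2_2_2 : Good [2, 2, 2, 2] :=
  good_two 8 (by decide) rfl tAB2_2_2_2 tF2_2_2_2 tG2_2_2_2

theorem tAB2_2_4 : Tri [2, 2, 4] 8 :=
  tri_of_chk (baseA := [1120032706191431, 1140032443090127])
    (baseB := [1426062242082802, 2101460915221605])
    (by decide +kernel)

theorem tF2_2_4 : Dec (nxF [2, 2, 4]) (Full (Fin 9)) :=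
  full_of_chk (w := 9) (L := 9) (tw := 0) (s := 1) (r := 9) (base :=
    [609011517120511, 711081713000204])
    (by decide +kernel)

theorem tG2_2_4 : Dec (nxF [2, 2, 4]) (Full (Fin 17)) :=
  full_of_chk (w := 17) (L := 17) (tw := 0) (s := 1) (r := 17) (base :=
    [1423130524030820, 1128272002160104, 17233303193028, 3122290325211904])
    (by decide +kernel)

theorem g2_2_4 : Good [2, 2, 4] :=
  good_two 8 (by decide) rfl tAB2_2_4 tF2_2_4 tG2_2_4

theorem tAB2_3_3 : Tri [2, 3, 3] 8 :=
  tri_of_chk (baseA := [1020331939071700, 1810443005324225])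
    (baseB := [431334109213718, 2111320640300124])
    (by decide +kernel)

theorem tF2_3_3 : Dec (nxF [2, 3, 3]) (Full (Fin 9)) :=
  full_of_chk (w := 9) (L := 9) (tw := 0) (s := 1) (r := 9) (base :=
    [717080511011214, 1105060817131403])
    (by decide +kernel)

theorem tG2_3_3 : Dec (nxF [2, 3, 3]) (Full (Fin 17)) :=
  full_of_chk (w := 17) (L := 17) (tw := 0) (s := 1) (r := 17) (base :=
    [921301301020604, 313210030231016, 131040702212316, 8242814133017])
    (by decide +kernel)

theorem g2_3_3 : Good [2, 3, 3] :=
  good_two 8 (by decide) rfl tAB2_3_3 tF2_3_3 tG2_3_3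

theorem tAB2_6 : Tri [2, 6] 8 :=
  tri_of_chk (baseA := [924062942262334, 3113191025140026])
    (baseB := [1323112000182804, 4024012909274718])
    (by decide +kernel)

theorem tF2_6 : Dec (nxF [2, 6]) (Full (Fin 9)) :=
  full_of_chk (w := 9) (L := 9) (tw := 0) (s := 1) (r := 9) (base :=
    [1402040016110609, 312161001061505])
    (by decide +kernel)

theorem tG2_6 : Dec (nxF [2, 6]) (Full (Fin 17)) :=
  full_of_chk (w := 17) (L := 17) (tw := 0) (s := 1) (r := 17) (base :=
    [1120193330140916, 1315330903071623, 12042102241807, 2802162022333110])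
    (by decide +kernel)

theorem g2_6 : Good [2, 6] :=
  good_two 8 (by decide) rfl tAB2_6 tF2_6 tG2_6

theorem tAB3_5 : Tri [3, 5] 8 :=
  tri_of_chk (baseA := [1328013927352005, 4524062705290234])
    (baseB := [2411352301410918, 1932022707161537])
    (by decide +kernel)

theorem tF3_5 : Dec (nxF [3, 5]) (Full (Fin 9)) :=
  full_of_chk (w := 9) (L := 9) (tw := 1) (s := 1) (r := 18) (base :=
    [1407130200040811])
    (by decide +kernel)

theorem tG3_5 : Dec (nxF [3, 5]) (Full (Fin 17)) :=
  full_of_chk (w := 17) (L := 17) (tw := 1) (s := 1) (r := 34) (base :=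
    [1424280327050021, 1916103326232106])
    (by decide +kernel)

theorem g3_5 : Good [3, 5] :=
  good_two 8 (by decide) rfl tAB3_5 tF3_5 tG3_5

theorem tAB4_4 : Tri [4, 4] 8 :=
  tri_of_chk (baseA := [2232190220101706, 3420131701332544])
    (baseB := [2700301014181323, 1844313237164008])
    (by decide +kernel)

theorem tF4_4 : Dec (nxF [4, 4]) (Full (Fin 9)) :=
  full_of_chk (w := 9) (L := 9) (tw := 1) (s := 1) (r := 18) (base :=
    [500031417130608])
    (by decide +kernel)

theorem tG4_4 : Dec (nxF [4, 4]) (Full (Fin 17)) :=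
  full_of_chk (w := 17) (L := 17) (tw := 1) (s := 1) (r := 34) (base :=
    [2629042106251418, 1008003032051906])
    (by decide +kernel)

theorem g4_4 : Good [4, 4] :=
  good_two 8 (by decide) rfl tAB4_4 tF4_4 tG4_4

theorem tAB8 : Tri [8] 8 :=
  tri_of_chk (baseA := [1418062237293230, 3631084519071702])
    (baseB := [1320442633230028, 2603291435011647])
    (by decide +kernel)

theorem tF8 : Dec (nxF [8]) (Full (Fin 9)) :=
  full_of_chk (w := 9) (L := 9) (tw := 1) (s := 1) (r := 18) (base :=
    [413011517110307])
    (by decide +kernel)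

theorem tG8 : Dec (nxF [8]) (Full (Fin 17)) :=
  full_of_chk (w := 17) (L := 17) (tw := 1) (s := 1) (r := 34) (base :=
    [1302091507212831, 2300153209202527])
    (by decide +kernel)

theorem g8 : Good [8] :=
  good_two 8 (by decide) rfl tAB8 tF8 tG8

theorem tAB2_2_2_3 : Tri [2, 2, 2, 3] 9 :=
  tri_of_chk (baseA := [194911522325460221, 122050142811303306])
    (baseB := [13926053151283415, 211250350319014028])
    (by decide +kernel)

theorem tE2_2_2_3 : Dec (nxF [2, 2, 2, 3]) (Full (Fin 9)) :=
  full_of_chk (w := 1) (L := 0) (tw := 0) (s := 1) (r := 1) (base :=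
    [150905160201100613, 41406021301110817, 21506050012110816, 130315051007170900,
     31407160105120811, 612111608150205, 50601171402110812, 1316111404020708,
     1613110603091405, 50813161002071501, 131503110705170901, 61408010316121004,
     130805001507161103, 60501160312151109, 60804020116141012, 60012111509021704])
    (by decide +kernel)

theorem tF2_2_2_3 : Dec (nxF [2, 2, 2, 3]) (Full (Fin 10)) :=
  full_of_chk (w := 5) (L := 10) (tw := 0) (s := 1) (r := 5) (base :=
    [131615070208041000, 110519140317130806, 150610050209180017, 180211140617050912])
    (by decide +kernel)

theorem tG2_2_2_3 : Dec (nxF [2, 2, 2, 3]) (Full (Fin 19)) :=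
  full_of_chk (w := 19) (L := 19) (tw := 0) (s := 1) (r := 19) (base :=
    [133236351703291823, 53037242708161320, 251831122803011027, 12420160603302208])
    (by decide +kernel)

theorem g2_2_2_3 : Good [2, 2, 2, 3] :=
  good_odd 9 (by decide) rfl tAB2_2_2_3 tE2_2_2_3 tF2_2_2_3 tG2_2_2_3

theorem tAB2_2_5 : Tri [2, 2, 5] 9 :=
  tri_of_chk (baseA := [153545073619510827, 234400275236354806])
    (baseB := [320751243744304200, 521333430521400927])
    (by decide +kernel)

theorem tE2_2_5 : Dec (nxF [2, 2, 5]) (Full (Fin 9)) :=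
  full_of_chk (w := 1) (L := 0) (tw := 0) (s := 1) (r := 1) (base :=
    [91604070112110215, 51510080213170601, 120710140109040216, 170408031211071400,
     51109120115031707, 150008161104021307, 130308041117001507, 131105010309061615,
     21117060013041509, 50208061713151101, 141116091306040201, 51016141303070900,
     130608110200161405, 131603110801040615, 141608120406031100, 61103160500121409])
    (by decide +kernel)

theorem tF2_2_5 : Dec (nxF [2, 2, 5]) (Full (Fin 10)) :=
  full_of_chk (w := 5) (L := 10) (tw := 0) (s := 1) (r := 5) (base :=
    [181510031208061601, 41214170118080307, 100409171306190214, 41816021309061500])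
    (by decide +kernel)

theorem tG2_2_5 : Dec (nxF [2, 2, 5]) (Full (Fin 19)) :=
  full_of_chk (w := 19) (L := 19) (tw := 0) (s := 1) (r := 19) (base :=
    [310306183222110916, 350915200717361802, 80520270719113600, 361509321229000602])
    (by decide +kernel)

theorem g2_2_5 : Good [2, 2, 5] :=
  good_odd 9 (by decide) rfl tAB2_2_5 tE2_2_5 tF2_2_5 tG2_2_5

theorem tAB2_3_4 : Tri [2, 3, 4] 9 :=
  tri_of_chk (baseA := [43317292606440118, 122717254622150418])
    (baseB := [330620082745120219, 112009190038320322])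
    (by decide +kernel)

theorem tE2_3_4 : Dec (nxF [2, 3, 4]) (Full (Fin 9)) :=
  full_of_chk (w := 1) (L := 0) (tw := 0) (s := 1) (r := 1) (base :=
    [50006100913140217, 40312151610000709, 50800141112020617, 130914160304010710,
     40916061100120215, 110400091402161306, 20816001307041510, 140713170108100204,
     21006010804161513, 130516010910020715, 30814001707051210, 51203090015061017,
     130317000511150906, 81713000410140206, 171102140106051308, 81101140513160702])
    (by decide +kernel)

theorem tF2_3_4 : Dec (nxF [2, 3, 4]) (Full (Fin 10)) :=
  full_of_chk (w := 5) (L := 10) (tw := 0) (s := 1) (r := 5) (base :=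
    [121407051901170811, 150508100601130217, 51512030009181610, 140016191005060802])
    (by decide +kernel)

theorem tG2_3_4 : Dec (nxF [2, 3, 4]) (Full (Fin 19)) :=
  full_of_chk (w := 19) (L := 19) (tw := 0) (s := 1) (r := 19) (base :=
    [322725211405361601, 52102371801300933, 103707022422342101, 181101331631202324])
    (by decide +kernel)

theorem g2_3_4 : Good [2, 3, 4] :=
  good_odd 9 (by decide) rfl tAB2_3_4 tE2_3_4 tF2_3_4 tG2_3_4

theorem tAB2_7 : Tri [2, 7] 9 :=
  tri_of_chk (baseA := [461535071941080425, 33208263710501220])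
    (baseB := [441527084624040150, 122003270952251916])
    (by decide +kernel)

theorem tE2_7 : Dec (nxF [2, 7]) (Full (Fin 9)) :=
  full_of_chk (w := 1) (L := 0) (tw := 0) (s := 1) (r := 1) (base :=
    [130805011115160703, 31209150011170705, 130408101401020716, 61301161409031105,
     31501041107081216, 50308011711121506, 510081615020612, 160201100913140506,
     60304141300101609, 40313150910170701, 120016030508071510, 51316010806141102,
     812100215040717, 150804170212010611, 151311030109071604, 130515030917100700])
    (by decide +kernel)

theorem tF2_7 : Dec (nxF [2, 7]) (Full (Fin 10)) :=
  full_of_chk (w := 5) (L := 10) (tw := 0) (s := 1) (r := 5) (base :=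
    [121117181505010308, 190103130815061105, 11018090712140205, 111518001205090216])
    (by decide +kernel)

theorem tG2_7 : Dec (nxF [2, 7]) (Full (Fin 19)) :=
  full_of_chk (w := 19) (L := 19) (tw := 0) (s := 1) (r := 19) (base :=
    [232404071233312601, 282533083420131923, 212406133209362935, 53424362729150123])
    (by decide +kernel)

theorem g2_7 : Good [2, 7] :=
  good_odd 9 (by decide) rfl tAB2_7 tE2_7 tF2_7 tG2_7

theorem tAB3_3_3 : Tri [3, 3, 3] 9 :=
  tri_of_chk (baseA := [381635452113004918, 362011173451153918])
    (baseB := [273816124320483305, 94135521800260547])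
    (by decide +kernel)

theorem tE3_3_3 : Dec (nxF [3, 3, 3]) (Full (Fin 9)) :=
  full_of_chk (w := 2) (L := 8) (tw := 1) (s := 1) (r := 4) (base :=
    [40913140103071611, 70502140916100113, 130715031008041700, 120907011516100204])
    (by decide +kernel)

theorem tF3_3_3 : Dec (nxF [3, 3, 3]) (Full (Fin 10)) :=
  full_of_chk (w := 5) (L := 10) (tw := 0) (s := 1) (r := 5) (base :=
    [41612180802151101, 120611160903011815, 50003180716151008, 50207161508011210])
    (by decide +kernel)

theorem tG3_3_3 : Dec (nxF [3, 3, 3]) (Full (Fin 19)) :=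
  full_of_chk (w := 19) (L := 19) (tw := 0) (s := 1) (r := 19) (base :=
    [330201292237270831, 243430041609063221, 23010361412082707, 223320363114121703])
    (by decide +kernel)

theorem g3_3_3 : Good [3, 3, 3] :=
  good_odd 9 (by decide) rfl tAB3_3_3 tE3_3_3 tF3_3_3 tG3_3_3

theorem tAB3_6 : Tri [3, 6] 9 :=
  tri_of_chk (baseA := [234613411452013150, 311626093553113241])
    (baseB := [163039350144362506, 354022005315254413])
    (by decide +kernel)

theorem tE3_6 : Dec (nxF [3, 6]) (Full (Fin 9)) :=
  full_of_chk (w := 8) (L := 8) (tw := 1) (s := 1) (r := 16) (base :=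
    [30912141710040007])
    (by decide +kernel)

theorem tF3_6 : Dec (nxF [3, 6]) (Full (Fin 10)) :=
  full_of_chk (w := 5) (L := 10) (tw := 0) (s := 1) (r := 5) (base :=
    [111202010806141905, 1719130615041008, 130516001002061915, 40803010618171214])
    (by decide +kernel)

theorem tG3_6 : Dec (nxF [3, 6]) (Full (Fin 19)) :=
  full_of_chk (w := 19) (L := 19) (tw := 0) (s := 1) (r := 19) (base :=
    [201403052509351232, 362034170208100524, 291809172133150310, 41922313202162611])
    (by decide +kernel)

theorem g3_6 : Good [3, 6] :=
  good_odd 9 (by decide) rfl tAB3_6 tE3_6 tF3_6 tG3_6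

theorem tAB4_5 : Tri [4, 5] 9 :=
  tri_of_chk (baseA := [280538300652251320, 401043251403341719])
    (baseB := [162303324610430825, 204905284601180223])
    (by decide +kernel)

theorem tE4_5 : Dec (nxF [4, 5]) (Full (Fin 9)) :=
  full_of_chk (w := 8) (L := 8) (tw := 1) (s := 1) (r := 16) (base :=
    [71300021416091005])
    (by decide +kernel)

theorem tF4_5 : Dec (nxF [4, 5]) (Full (Fin 10)) :=
  full_of_chk (w := 5) (L := 10) (tw := 0) (s := 1) (r := 5) (base :=
    [40816111501180306, 110509131802160615, 190205110112160709, 41916140211090013])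
    (by decide +kernel)

theorem tG4_5 : Dec (nxF [4, 5]) (Full (Fin 19)) :=
  full_of_chk (w := 19) (L := 19) (tw := 0) (s := 1) (r := 19) (base :=
    [1128250934222113, 271628230915250300, 290434273301031420, 322103313601042725])
    (by decide +kernel)

theorem g4_5 : Good [4, 5] :=
  good_odd 9 (by decide) rfl tAB4_5 tE4_5 tF4_5 tG4_5

theorem tAB9 : Tri [9] 9 :=
  tri_of_chk (baseA := [133501370843304119, 131916280225063442])
    (baseB := [273809311132431449, 341329082407204610])
    (by decide +kernel)

theorem tE9 : Dec (nxF [9]) (Full (Fin 9)) :=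
  full_of_chk (w := 8) (L := 8) (tw := 1) (s := 1) (r := 16) (base :=
    [515071109161203])
    (by decide +kernel)

theorem tF9 : Dec (nxF [9]) (Full (Fin 10)) :=
  full_of_chk (w := 5) (L := 10) (tw := 0) (s := 1) (r := 5) (base :=
    [191102081204170114, 180115100802170406, 151319020017060904, 171410041202070818])
    (by decide +kernel)

theorem tG9 : Dec (nxF [9]) (Full (Fin 19)) :=
  full_of_chk (w := 19) (L := 19) (tw := 0) (s := 1) (r := 19) (base :=
    [280716203324183436, 183604240115173021, 131837273023331409, 21613290609352714])
    (by decide +kernel)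

theorem g9 : Good [9] :=
  good_odd 9 (by decide) rfl tAB9 tE9 tF9 tG9

theorem tAB2_2_2_2_2 : Tri [2, 2, 2, 2, 2] 10 :=
  tri_of_chk (baseA := [19214115234612335128, 26594739133334182510])
    (baseB := [7293116510520433903, 7373240452027580031])
    (by decide +kernel)

theorem tF2_2_2_2_2 : Dec (nxF [2, 2, 2, 2, 2]) (Full (Fin 11)) :=
  full_of_chk (w := 11) (L := 11) (tw := 0) (s := 1) (r := 11) (base :=
    [3001620061813041509, 15082107001116130204])
    (by decide +kernel)

theorem tG2_2_2_2_2 : Dec (nxF [2, 2, 2, 2, 2]) (Full (Fin 21)) :=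
  full_of_chk (w := 21) (L := 21) (tw := 0) (s := 1) (r := 21) (base :=
    [28351321143303221638, 5172329060234313340, 36223102112118070940, 21221416073109243913])
    (by decide +kernel)

theorem tE2_2_2_2_2 : Dec (nxF [2, 2, 2, 2, 2]) (Full (Fin 15)) :=
  full_of_chk (w := 7) (L := 14) (tw := 0) (s := 1) (r := 7) (base :=
    [23290015202510130816, 24272304021018071421, 6082721221317032804, 13031409220411271700,
     27282420120306162311, 9160424031027152906])
    (by decide +kernel)

theorem tH2_2_2_2_2 : Dec (nxF [2, 2, 2, 2, 2]) (Hole 10 5) :=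
  hole_of_chk (w := 1) (L := 0) (tw := 0) (s := 1) (r := 1) (base :=
    [17001908250415230603, 10251319002615050921, 7250810142813182204, 24102016010804071413,
     18051417120609032101, 1030423122028170906, 21100928180105272516, 1241727221804091511,
     15030722192113000905, 24020614211817011210, 20171023281526091200, 23091915120206271604,
     17082610280507121903, 20091211290316051926, 18152106012817122209, 6250213011016190514,
     29050602091318231711, 8282103111422060500, 11231328090204000626, 19012102162708060511,
     15250503132918100122, 9172313032825190115, 23162400270209141006, 29061509171903001121,
     15131003241607211804, 25051308071801292215, 14011902042109270716, 13052200281118082403,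
     8002710132023021907, 4061426121624091129, 70215270425121019, 28182412170709102115,
     29172419260104030615, 29070222171511042713, 10170512002129182703, 15242317000626131002,
     2161101052123121526, 25092015110616032618])
    (by decide +kernel)

theorem tJ2_2_2_2_2 : Dec (nxF [2, 2, 2, 2, 2]) (Full (Fin 25)) :=
  full_of_chk (w := 5) (L := 25) (tw := 0) (s := 1) (r := 5) (base :=
    [28210445003337311943, 19073529151130452640, 20491930230604393701, 17254220223403103314,
     33113001463445032314, 15342723482016413301, 33151300052521350311, 30462332040949034315,
     6431113352241202704, 7111824142938014730, 29083437012448391820, 18284240173227470901,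
     37204208240640462211, 47073501183213102705, 12421707340438034825, 44171333362927482011,
     26112105154001073943, 37350407311532222642, 25274333473422053745, 22301004191402452528,
     43043520123748452703, 16420918224912261445, 16494235440102300611, 30371143034147441306])
    (by decide +kernel)

theorem g2_2_2_2_2 : Good [2, 2, 2, 2, 2] :=
  good_ten rfl tAB2_2_2_2_2 tF2_2_2_2_2 tG2_2_2_2_2 tE2_2_2_2_2 tH2_2_2_2_2 tJ2_2_2_2_2

theorem tAB2_2_2_4 : Tri [2, 2, 2, 4] 10 :=
  tri_of_chk (baseA := [5311727225914435600, 22172609370501293818])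
    (baseB := [18360633002242150945, 17310526291038194833])
    (by decide +kernel)

theorem tF2_2_2_4 : Dec (nxF [2, 2, 2, 4]) (Full (Fin 11)) :=
  full_of_chk (w := 11) (L := 11) (tw := 0) (s := 1) (r := 11) (base :=
    [9121120070002181517, 10001909130516200615])
    (by decide +kernel)

theorem tG2_2_2_4 : Dec (nxF [2, 2, 2, 4]) (Full (Fin 21)) :=
  full_of_chk (w := 21) (L := 21) (tw := 0) (s := 1) (r := 21) (base :=
    [9231428051737394133, 27360502002030341913, 7301732293908260401, 11303318032915260106])
    (by decide +kernel)

theorem tE2_2_2_4 : Dec (nxF [2, 2, 2, 4]) (Full (Fin 15)) :=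
  full_of_chk (w := 7) (L := 14) (tw := 0) (s := 1) (r := 7) (base :=
    [19241611271329042103, 3040806292713222018, 12181521251006012827, 10182716041406002509,
     2120023102718061417, 28121100062522180417])
    (by decide +kernel)

theorem tH2_2_2_4 : Dec (nxF [2, 2, 2, 4]) (Hole 10 5) :=
  hole_of_chk (w := 1) (L := 0) (tw := 0) (s := 1) (r := 1) (base :=
    [4101817260712020825, 10040614121916292101, 6281022142721042417, 6110900281527130221,
     31729112118120822, 22130418030901172707, 11271725221408180106, 25000907111304291823,
     17001314112228190704, 25032911230420071809, 10022616121404240829, 27050803241417132118,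
     27110412290216062114, 13260425151909290207, 4002912152111080722, 23001511091218031607,
     3190612140520011709, 7122201140427182110, 25040218172313011114, 3042217190710291509,
     1110624290509161815, 24070911171200262002, 25060902131026050118, 13231628001108150703,
     220315261812210416, 3140604112609131824, 12072903111821170008, 14130017260804190711,
     16140010122002271929, 12051923142616212906, 9062204281200022415, 25010210140719170905,
     6192412012903232109, 4111901200915220316, 19160501250902112814, 4012302261707211225,
     3240014161126092018, 15032517270022092105])
    (by decide +kernel)

theorem tJ2_2_2_4 : Dec (nxF [2, 2, 2, 4]) (Full (Fin 25)) :=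
  full_of_chk (w := 5) (L := 25) (tw := 0) (s := 1) (r := 5) (base :=
    [8373015433905212926, 40351805110323322406, 35154236321949132246, 3041119144824222744,
     32210711480026134015, 31250418163506392646, 22343918361040431512, 34322824043940062609,
     40213624014339081034, 1350641202526041323, 6274933101417283034, 40010721443731134749,
     47063343053515214426, 2083247271901224917, 37344428060831494613, 41471904003631424839,
     19230603291041264408, 2342409481807144312, 14433616091827481328, 12332840210111143527,
     24392630160640031200, 41394201062134122311, 26203735390143461009, 35470403441325402716])
    (by decide +kernel)

theorem g2_2_2_4 : Good [2, 2, 2, 4] :=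
  good_ten rfl tAB2_2_2_4 tF2_2_2_4 tG2_2_2_4 tE2_2_2_4 tH2_2_2_4 tJ2_2_2_4

theorem tAB2_2_3_3 : Tri [2, 2, 3, 3] 10 :=
  tri_of_chk (baseA := [20024917423519222908, 32400335520425514630])
    (baseB := [13413357381804344620, 58311304512214394125])
    (by decide +kernel)

theorem tF2_2_3_3 : Dec (nxF [2, 2, 3, 3]) (Full (Fin 11)) :=
  full_of_chk (w := 11) (L := 11) (tw := 0) (s := 1) (r := 11) (base :=
    [5210118100714090313, 21805081612112106])
    (by decide +kernel)

theorem tG2_2_3_3 : Dec (nxF [2, 2, 3, 3]) (Full (Fin 21)) :=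
  full_of_chk (w := 21) (L := 21) (tw := 0) (s := 1) (r := 21) (base :=
    [19070805001614224030, 2271337083815224021, 17192315310009332806, 26310316181238231421])
    (by decide +kernel)

theorem tE2_2_3_3 : Dec (nxF [2, 2, 3, 3]) (Full (Fin 15)) :=
  full_of_chk (w := 7) (L := 14) (tw := 0) (s := 1) (r := 7) (base :=
    [25120917150521021829, 6021416202528100519, 4251428031827090713, 29102703130014081805,
     2180720262412001504, 22171420191203082704])
    (by decide +kernel)

theorem tH2_2_3_3 : Dec (nxF [2, 2, 3, 3]) (Hole 10 5) :=
  hole_of_chk (w := 1) (L := 0) (tw := 0) (s := 1) (r := 1) (base :=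
    [5071309010211141621, 16150006192405261112, 20001406251022162612, 8001715130725191126,
     2082612052921171800, 1040618031027141322, 12190506102502270822, 2172209100521062715,
     10291907220413212509, 10170209240422192015, 2200528140124101908, 19000517030715110922,
     25020018061729092311, 5281709020725132719, 28051707022218152700, 22060003151229181008,
     12092701100215231625, 3210429081416180010, 121626100719212203, 19070413111602291508,
     13152806240002041117, 9211018221207272816, 5131629150702240009, 12080700201419032416,
     4151722181229030721, 25051812070817270028, 19021112210923000527, 24030126071013292108,
     29101917062205150127, 25011219092628070314, 19120003171522052111, 3122705240915062911,
     290708171404101303, 7181720111304001522, 24051406080217262001, 1231029050821021915,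
     131718082714250521, 11042215251221181709])
    (by decide +kernel)

theorem tJ2_2_3_3 : Dec (nxF [2, 2, 3, 3]) (Full (Fin 25)) :=
  full_of_chk (w := 5) (L := 25) (tw := 0) (s := 1) (r := 5) (base :=
    [1363213113023400604, 39244620120843262835, 32360244301448430912, 49031441211032244506,
     46421730231505372809, 24391002492107333708, 6232932451116153120, 7171321490900253143,
     47341545214318380129, 10342014251622084704, 21412608423934333007, 6163923332919370900,
     46220126251530293445, 27112547430132391306, 48330518142325372844, 41193303310748110925,
     6154843380841353018, 37421247094901402339, 2394645222408054014, 37284132172211090119,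
     4351027154031390819, 15012622192531414211, 15272001180710174241, 40022142183444162909])
    (by decide +kernel)

theorem g2_2_3_3 : Good [2, 2, 3, 3] :=
  good_ten rfl tAB2_2_3_3 tF2_2_3_3 tG2_2_3_3 tE2_2_3_3 tH2_2_3_3 tJ2_2_3_3

theorem tAB2_2_6 : Tri [2, 2, 6] 10 :=
  tri_of_chk (baseA := [5230830103413322851, 10391327025952202419])
    (baseB := [10280824192122543814, 51023610391400304221])
    (by decide +kernel)

theorem tF2_2_6 : Dec (nxF [2, 2, 6]) (Full (Fin 11)) :=
  full_of_chk (w := 11) (L := 11) (tw := 0) (s := 1) (r := 11) (base :=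
    [11020616090115201913, 4150112080718162102])
    (by decide +kernel)

theorem tG2_2_6 : Dec (nxF [2, 2, 6]) (Full (Fin 21)) :=
  full_of_chk (w := 21) (L := 21) (tw := 0) (s := 1) (r := 21) (base :=
    [23081315342911211724, 22402514131829090333, 36091533063416240031, 31353201381024402102])
    (by decide +kernel)

theorem tE2_2_6 : Dec (nxF [2, 2, 6]) (Full (Fin 15)) :=
  full_of_chk (w := 7) (L := 14) (tw := 0) (s := 1) (r := 7) (base :=
    [14032326110107092417, 23212812031126080700, 14270716031801222010, 23252911071809170115,
     18091229250617102004, 22290210152526180708])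
    (by decide +kernel)

theorem tH2_2_6 : Dec (nxF [2, 2, 6]) (Hole 10 5) :=
  hole_of_chk (w := 1) (L := 0) (tw := 0) (s := 1) (r := 1) (base :=
    [3011408132007292710, 16071100231913290424, 2220615051611190008, 7151318200008040324,
     6192117270829150524, 10032816152526120508, 3082407051517281310, 11010327161804130928,
     5132310200628000825, 5022911071325160021, 6162705102313012115, 29102116061215080519,
     22041706020124151109, 20080112150619022605, 6241901040321082213, 26100224131501182304,
     7030020162612080528, 12211808221014050026, 19240208201723140501, 3200726181201282410,
     10042208140216120618, 2090704191516102513, 7251523180209172700, 7011903101523082905,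
     15271105182301160906, 17030900221820120710, 2281914001310090517, 2261909251201171115,
     13032604012308281624, 12192506260905031116, 12100507201502170918, 28111826151612070124,
     2201926062200241715, 10001426032117122919, 15191328070016230521, 2151022072826082104,
     15281001071826131723, 19281520102509160223])
    (by decide +kernel)

theorem tJ2_2_6 : Dec (nxF [2, 2, 6]) (Full (Fin 25)) :=
  full_of_chk (w := 5) (L := 25) (tw := 0) (s := 1) (r := 5) (base :=
    [18021216243446324930, 45490632314234382018, 25461645433231202901, 49032735042813151039,
     28474809173533380003, 1331925143113454035, 3471226190141330724, 11463705422733001240,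
     25160615421147134103, 3120944492907223924, 34234714171800202541, 15083925203727040123,
     21431337251048062302, 39202825400544324909, 41200438440830113533, 31134221492505083815,
     10050333200725291309, 22302644110912012414, 49080213040016391421, 16362618141103300439,
     44421701134903314737, 7332739454143082916, 49204213353628273306, 20173212482840274338])
    (by decide +kernel)

theorem g2_2_6 : Good [2, 2, 6] :=
  good_ten rfl tAB2_2_6 tF2_2_6 tG2_2_6 tE2_2_6 tH2_2_6 tJ2_2_6

theorem tAB2_3_5 : Tri [2, 3, 5] 10 :=
  tri_of_chk (baseA := [18543412410350223214, 42260535141820450839])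
    (baseB := [37033804405022094718, 1240333491623433711])
    (by decide +kernel)

theorem tF2_3_5 : Dec (nxF [2, 3, 5]) (Full (Fin 11)) :=
  full_of_chk (w := 11) (L := 11) (tw := 0) (s := 1) (r := 11) (base :=
    [10181208001516060520, 12170609051021150002])
    (by decide +kernel)

theorem tG2_3_5 : Dec (nxF [2, 3, 5]) (Full (Fin 21)) :=
  full_of_chk (w := 21) (L := 21) (tw := 0) (s := 1) (r := 21) (base :=
    [32100030351937060841, 16231837312904203508, 33410125131103081534, 26102521193541312814])
    (by decide +kernel)

theorem tE2_3_5 : Dec (nxF [2, 3, 5]) (Full (Fin 15)) :=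
  full_of_chk (w := 7) (L := 14) (tw := 0) (s := 1) (r := 7) (base :=
    [21051628071823150308, 10160323280605091215, 25211217032600081423, 6170503212823121808,
     2241307231817210508, 27290610192203051416])
    (by decide +kernel)

theorem tH2_3_5 : Dec (nxF [2, 3, 5]) (Hole 10 5) :=
  hole_of_chk (w := 1) (L := 0) (tw := 0) (s := 1) (r := 1) (base :=
    [20151618120811280723, 21020618162511090013, 1080316151027051822, 27091023150119022507,
     5172000181006261308, 8162304031821111425, 17070528030021142609, 26022509141021042300,
     19240717211113230508, 8281914201610010704, 3062704211314010822, 29172618011402220412,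
     10162502282205150812, 12071003232605002914, 20060928160322130027, 19132702150420102801,
     2191510120708200529, 1101409032806190516, 26041123161921081406, 7002512281710260305,
     7132805010217151124, 26160804151229060325, 14270620120328110817, 6082915250127131018,
     10190507271612250022, 16072009220414192501, 10070118241504222916, 19201302271705230615,
     1021424160623132718, 8230602261216241929, 6280213181521100117, 200218041008061326,
     16190802070413201000, 25002812192310021509, 18022100070524091013, 52513151017031909,
     2000924051614131922, 16130424191115290800])
    (by decide +kernel)

theorem tJ2_3_5 : Dec (nxF [2, 3, 5]) (Full (Fin 25)) :=
  full_of_chk (w := 5) (L := 25) (tw := 0) (s := 1) (r := 5) (base :=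
    [37090643290005173138, 39200819152227361242, 35093116374214392918, 43492301041329243715,
     43481544234117324739, 37190524301434274339, 32203441384317021204, 29470918032644221437,
     10393242282003232400, 10480844293326160604, 12142148194132301137, 29484741144226451721,
     25350332471221113601, 14382510162702290433, 12011109413245203625, 1284905110314193440,
     33481345080205351628, 7430140270337294634, 5311244341548460006, 9461241302114002305,
     26242031011413320447, 19401422252030360247, 6213429404323481609, 404204383308130324])
    (by decide +kernel)

theorem g2_3_5 : Good [2, 3, 5] :=
  good_ten rfl tAB2_3_5 tF2_3_5 tG2_3_5 tE2_3_5 tH2_3_5 tJ2_3_5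

theorem tAB2_4_4 : Tri [2, 4, 4] 10 :=
  tri_of_chk (baseA := [18331229220548103046, 39193211052200280337])
    (baseB := [27142505391128185337, 33043400102417553702])
    (by decide +kernel)

theorem tF2_4_4 : Dec (nxF [2, 4, 4]) (Full (Fin 11)) :=
  full_of_chk (w := 11) (L := 11) (tw := 0) (s := 1) (r := 11) (base :=
    [4112018090003151612, 15010717041920110912])
    (by decide +kernel)

theorem tG2_4_4 : Dec (nxF [2, 4, 4]) (Full (Fin 21)) :=
  full_of_chk (w := 21) (L := 21) (tw := 0) (s := 1) (r := 21) (base :=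
    [8170106411822132810, 39042510090320193501, 7292601132334410232, 9342332381816120702])
    (by decide +kernel)

theorem tE2_4_4 : Dec (nxF [2, 4, 4]) (Full (Fin 15)) :=
  full_of_chk (w := 7) (L := 14) (tw := 0) (s := 1) (r := 7) (base :=
    [28271708191124052003, 3050026281225202214, 24191701060204221013, 18031520051116082400,
     21182306260516122809, 29241417020905102707])
    (by decide +kernel)

theorem tH2_4_4 : Dec (nxF [2, 4, 4]) (Hole 10 5) :=
  hole_of_chk (w := 1) (L := 0) (tw := 0) (s := 1) (r := 1) (base :=
    [7120227182505112015, 6192205110315081227, 25152900130922170705, 4261808221502172000,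
     9260428010310140623, 14280500112617060802, 15060827041012200028, 10082601071322021817,
     22030108281924052706, 22112502280416090118, 11130526151703180120, 18051316220008031510,
     4152400181203270929, 9170221271324042911, 5191303142201242711, 13021429170825011104,
     20081407160102261310, 8061724011528121822, 11172619230105152806, 28032511120818060516,
     2011920141624130906, 17110821061826142313, 22090206121504011824, 2240721092310011828,
     1142513181109041606, 24162606081904142813, 6141219032608051720, 2152216111921071209,
     24170007221320101418, 16152111030700291205, 16132508201903110523, 28112403220600160421,
     5241106211901132816, 20112304132700061728, 17191410240621080205, 8151604122103191000,
     9182300021107281427, 12142016280702192600])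
    (by decide +kernel)

theorem tJ2_4_4 : Dec (nxF [2, 4, 4]) (Full (Fin 25)) :=
  full_of_chk (w := 5) (L := 25) (tw := 0) (s := 1) (r := 5) (base :=
    [33474025491729383410, 16422814353807250901, 41281748000942123703, 46041102443722061634,
     16211907042422324710, 28422503044930234021, 16370413444643214038, 36272307284102171121,
     24403203233421121129, 47073321353609493124, 41050108241813363217, 493344022107171830,
     110718093221244541, 42240401034931331218, 4121026380333174131, 36434416390125140218,
     4392511222734364902, 31104515082628054633, 40012442362045284918, 1334222194504462114,
     13332744471807340021, 32394406123147272320, 15051936234510293430, 2083039431512114117])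
    (by decide +kernel)

theorem g2_4_4 : Good [2, 4, 4] :=
  good_ten rfl tAB2_4_4 tF2_4_4 tG2_4_4 tE2_4_4 tH2_4_4 tJ2_4_4

theorem tAB2_8 : Tri [2, 8] 10 :=
  tri_of_chk (baseA := [12330626082018483103, 14210628022509434805])
    (baseB := [39115804351537061740, 22173609451521051235])
    (by decide +kernel)

theorem tF2_8 : Dec (nxF [2, 8]) (Full (Fin 11)) :=
  full_of_chk (w := 11) (L := 11) (tw := 0) (s := 1) (r := 11) (base :=
    [4030614121721190111, 21080004130617141903])
    (by decide +kernel)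

theorem tG2_8 : Dec (nxF [2, 8]) (Full (Fin 21)) :=
  full_of_chk (w := 21) (L := 21) (tw := 0) (s := 1) (r := 21) (base :=
    [34312912063620273816, 37260532013125022915, 24413328150205310812, 21234100180730131727])
    (by decide +kernel)

theorem tE2_8 : Dec (nxF [2, 8]) (Full (Fin 15)) :=
  full_of_chk (w := 7) (L := 14) (tw := 0) (s := 1) (r := 7) (base :=
    [16272500091510231307, 23130025271603291018, 13060420030126181424, 16252907192005091115,
     4240318171001142813, 8120110222916240620])
    (by decide +kernel)

theorem tH2_8 : Dec (nxF [2, 8]) (Hole 10 5) :=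
  hole_of_chk (w := 1) (L := 0) (tw := 0) (s := 1) (r := 1) (base :=
    [12161419270605080011, 6091221192411230127, 281714061012242708, 24140312192616012907,
     11190429142712090616, 4020615220818112117, 4160313200701261908, 18290426020010141220,
     14231016052903182713, 7231911050117032015, 3101722071324092105, 28182703111724072009,
     24031429191709051207, 1120328140817232610, 12280708260500140319, 11200503290925140018,
     8041417002418120727, 21001323080519100207, 8000502122219200710, 2111322170814200029,
     16022315072412181009, 16210612140118050325, 19140023112413160320, 11092715001604220718,
     4251706271928100801, 3011116221825150907, 27161329080205150106, 6041318210924151128,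
     20010514161223022406, 26130418061725110003, 5261115230919071628, 19211627021005251409,
     8241718012204280721, 7111428031626011204, 3240123070415262813, 3152101291608231211,
     23042410200008031314, 2192205201028091301])
    (by decide +kernel)

theorem tJ2_8 : Dec (nxF [2, 8]) (Full (Fin 25)) :=
  full_of_chk (w := 5) (L := 25) (tw := 0) (s := 1) (r := 5) (base :=
    [37022839102418214348, 3242247294339480627, 28021615224904063545, 12311722342632472406,
     22074916144240284432, 4134502152936012542, 49461518130300092737, 4321424264639182801,
     14354919223028103239, 44241122461334082631, 7341214264739281700, 25053738130008304842,
     3490843061404163047, 42242334452813394905, 19494707374322353212, 28401643052526234635,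
     2441622150408334620, 41172748074519333411, 37104102273235091744, 15274043110518363539,
     17111802320839050620, 41351304092125002832, 27194536053003342011, 25080443120311463032])
    (by decide +kernel)

theorem g2_8 : Good [2, 8] :=
  good_ten rfl tAB2_8 tF2_8 tG2_8 tE2_8 tH2_8 tJ2_8

theorem tAB3_3_4 : Tri [3, 3, 4] 10 :=
  tri_of_chk (baseA := [234129260752135438, 19384828105922511327])
    (baseB := [7364822442603043151, 37532314380442452816])
    (by decide +kernel)

theorem tF3_3_4 : Dec (nxF [3, 3, 4]) (Full (Fin 11)) :=
  full_of_chk (w := 11) (L := 11) (tw := 0) (s := 1) (r := 11) (base :=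
    [10001505072102191608, 3140807101219172101])
    (by decide +kernel)

theorem tG3_3_4 : Dec (nxF [3, 3, 4]) (Full (Fin 21)) :=
  full_of_chk (w := 21) (L := 21) (tw := 1) (s := 1) (r := 42) (base :=
    [1080227120704412025, 10412125020415071731])
    (by decide +kernel)

theorem tE3_3_4 : Dec (nxF [3, 3, 4]) (Full (Fin 15)) :=
  full_of_chk (w := 7) (L := 14) (tw := 1) (s := 1) (r := 14) (base :=
    [8272515071619021101, 26172329052107091502, 13150616010528192411])
    (by decide +kernel)

theorem tH3_3_4 : Dec (nxF [3, 3, 4]) (Hole 10 5) :=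
  hole_of_chk (w := 1) (L := 10) (tw := 1) (s := 1) (r := 2) (base :=
    [6280210231701141226, 80726051224201803, 9031627130029072210, 9250104162806132718,
     18221309261102000704, 14241911010307042808, 3211029160519000914, 17200627151109240319,
     14200924130619051126, 24001216092819040623, 5101217210715192700, 16152608012119291013,
     3052100152217072413, 5141322281719250306, 19152804230902162511, 16021220290114221910,
     9230010120304140719, 5150227081321161001, 11210524031523070916])
    (by decide +kernel)

theorem tJ3_3_4 : Dec (nxF [3, 3, 4]) (Full (Fin 25)) :=
  full_of_chk (w := 12) (L := 24) (tw := 1) (s := 1) (r := 24) (base :=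
    [25051408271738180329, 17042547123726022048, 39453542362308290200, 44251720424048120830,
     12243215370130350319])
    (by decide +kernel)

theorem g3_3_4 : Good [3, 3, 4] :=
  good_ten rfl tAB3_3_4 tF3_3_4 tG3_3_4 tE3_3_4 tH3_3_4 tJ3_3_4

theorem tAB3_7 : Tri [3, 7] 10 :=
  tri_of_chk (baseA := [2572314320120433118, 21042719241757285202])
    (baseB := [13281036400732044935, 37142506341353270959])
    (by decide +kernel)

theorem tF3_7 : Dec (nxF [3, 7]) (Full (Fin 11)) :=
  full_of_chk (w := 11) (L := 11) (tw := 0) (s := 1) (r := 11) (base :=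
    [21050619170014121009, 6160214190400210812])
    (by decide +kernel)

theorem tG3_7 : Dec (nxF [3, 7]) (Full (Fin 21)) :=
  full_of_chk (w := 21) (L := 21) (tw := 1) (s := 1) (r := 42) (base :=
    [35221727093713073203, 26341925232031083717])
    (by decide +kernel)

theorem tE3_7 : Dec (nxF [3, 7]) (Full (Fin 15)) :=
  full_of_chk (w := 7) (L := 14) (tw := 1) (s := 1) (r := 14) (base :=
    [26232813250614180304, 8241522111812290020, 2272517061204140111])
    (by decide +kernel)

theorem tH3_7 : Dec (nxF [3, 7]) (Hole 10 5) :=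
  hole_of_chk (w := 1) (L := 10) (tw := 1) (s := 1) (r := 2) (base :=
    [8072517131005001423, 13280315002404161108, 9201015122418280006, 19041202161429112709,
     3001719211012091425, 2100426070020231812, 182916040327142007, 7241615261222090519,
     3140828100719211301, 12060328042409161000, 28130901270715221811, 6100128160308220415,
     1052015180712160927, 14042203240118160720, 25112809230602142712, 16230903052719251511,
     26182009000211040717, 23022617200401191225, 16221018032013280604])
    (by decide +kernel)

theorem tJ3_7 : Dec (nxF [3, 7]) (Full (Fin 25)) :=
  full_of_chk (w := 12) (L := 24) (tw := 1) (s := 1) (r := 24) (base :=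
    [21121916493039430732, 42232148261305003137, 18250306103605383343, 21084241223107350019,
     36443234134121022731])
    (by decide +kernel)

theorem g3_7 : Good [3, 7] :=
  good_ten rfl tAB3_7 tF3_7 tG3_7 tE3_7 tH3_7 tJ3_7

theorem tAB4_6 : Tri [4, 6] 10 :=
  tri_of_chk (baseA := [6270350182028123815, 9311037015623032840])
    (baseB := [22543714430619210224, 27172312320205570839])
    (by decide +kernel)

theorem tF4_6 : Dec (nxF [4, 6]) (Full (Fin 11)) :=
  full_of_chk (w := 11) (L := 11) (tw := 0) (s := 1) (r := 11) (base :=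
    [17090621011015131802, 210714021804161308])
    (by decide +kernel)

theorem tG4_6 : Dec (nxF [4, 6]) (Full (Fin 21)) :=
  full_of_chk (w := 21) (L := 21) (tw := 1) (s := 1) (r := 42) (base :=
    [34121723210304302940, 21412618042807033216])
    (by decide +kernel)

theorem tE4_6 : Dec (nxF [4, 6]) (Full (Fin 15)) :=
  full_of_chk (w := 7) (L := 14) (tw := 1) (s := 1) (r := 14) (base :=
    [222127162915250604, 7270115092517050219, 90212270421112914])
    (by decide +kernel)

theorem tH4_6 : Dec (nxF [4, 6]) (Hole 10 5) :=
  hole_of_chk (w := 1) (L := 10) (tw := 1) (s := 1) (r := 2) (base :=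
    [16031204230121071908, 9191622112515021226, 11191529030526130009, 25002707101303190408,
     29100807250301260515, 20102603071622181304, 9231124171429120718, 19270306002311162904,
     17010325120804152207, 3042414122300200608, 25151103211801131705, 11201605190013290714,
     29011421021116181206, 1111419260629162408, 28042113110814021627, 20012914080506101623,
     23092705071524010219, 14201811271613220208, 4011928072416082013])
    (by decide +kernel)

theorem tJ4_6 : Dec (nxF [4, 6]) (Full (Fin 25)) :=
  full_of_chk (w := 12) (L := 24) (tw := 1) (s := 1) (r := 24) (base :=
    [28042609012136102349, 27063323482936393546, 44354205013630241817, 12101747013206310342,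
     40132216274542021101])
    (by decide +kernel)

theorem g4_6 : Good [4, 6] :=
  good_ten rfl tAB4_6 tF4_6 tG4_6 tE4_6 tH4_6 tJ4_6

theorem tAB5_5 : Tri [5, 5] 10 :=
  tri_of_chk (baseA := [6385602273146201959, 35450224073219261156])
    (baseB := [21122347003609493107, 354537431329074124])
    (by decide +kernel)

theorem tF5_5 : Dec (nxF [5, 5]) (Full (Fin 11)) :=
  full_of_chk (w := 11) (L := 11) (tw := 0) (s := 1) (r := 11) (base :=
    [6091104152000190312, 17030610001420080413])
    (by decide +kernel)

theorem tG5_5 : Dec (nxF [5, 5]) (Full (Fin 21)) :=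
  full_of_chk (w := 21) (L := 21) (tw := 1) (s := 1) (r := 42) (base :=
    [8200325182213403639, 36081329161506043921])
    (by decide +kernel)

theorem tE5_5 : Dec (nxF [5, 5]) (Full (Fin 15)) :=
  full_of_chk (w := 7) (L := 14) (tw := 1) (s := 1) (r := 14) (base :=
    [15280126080510182024, 1241720151903042308, 15021311280108252604])
    (by decide +kernel)

theorem tH5_5 : Dec (nxF [5, 5]) (Hole 10 5) :=
  hole_of_chk (w := 1) (L := 10) (tw := 1) (s := 1) (r := 2) (base :=
    [11181729011426042006, 10062012240426151603, 12061116052809220214, 13230724140105190920,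
     19171513060826110524, 5150126090603191129, 11032004290107251809, 8060510011812251722,
     16271022000528182503, 1240212260508112114, 17071421001012290222, 11140113022717092119,
     14240412280723010216, 12081418260025111728, 16211008240406021922, 3291806012315111209,
     20030817121419000522, 7081502261901121604, 27062909031318211723])
    (by decide +kernel)

theorem tJ5_5 : Dec (nxF [5, 5]) (Full (Fin 25)) :=
  full_of_chk (w := 12) (L := 24) (tw := 1) (s := 1) (r := 24) (base :=
    [11390830132106434426, 37391221083546263019, 23010728480235091247, 40260206484623374438,
     24170347091422403021])
    (by decide +kernel)

theorem g5_5 : Good [5, 5] :=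
  good_ten rfl tAB5_5 tF5_5 tG5_5 tE5_5 tH5_5 tJ5_5

theorem tAB10 : Tri [10] 10 :=
  tri_of_chk (baseA := [15341039063301231826, 26003604391933152409])
    (baseB := [33083116281434182212, 30133809270522163300])
    (by decide +kernel)

theorem tF10 : Dec (nxF [10]) (Full (Fin 11)) :=
  full_of_chk (w := 11) (L := 11) (tw := 0) (s := 1) (r := 11) (base :=
    [6011316092014051002, 15070416180220010813])
    (by decide +kernel)

theorem tG10 : Dec (nxF [10]) (Full (Fin 21)) :=
  full_of_chk (w := 21) (L := 21) (tw := 1) (s := 1) (r := 42) (base :=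
    [8023139323712001107, 36121434003307264111])
    (by decide +kernel)

theorem tE10 : Dec (nxF [10]) (Full (Fin 15)) :=
  full_of_chk (w := 7) (L := 14) (tw := 1) (s := 1) (r := 14) (base :=
    [3011510262516200728, 12192722110003240514, 6011820080512222915])
    (by decide +kernel)

theorem tH10 : Dec (nxF [10]) (Hole 10 5) :=
  hole_of_chk (w := 1) (L := 10) (tw := 1) (s := 1) (r := 2) (base :=
    [13230105060814280326, 14230301241929120804, 1192817050310092607, 15251107050020160818,
     261023062416190313, 29001005161826142006, 13201827111501021607, 11061627052209280113,
     18092905140602231125, 28112012090227152206, 5121429172609211922, 16100403150807181325,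
     72503111612042108, 4250903211615121118, 4090017231302201119, 23082514112805200019,
     14210702251217081001, 13191502170125052706, 12260123171506180328])
    (by decide +kernel)

theorem tJ10 : Dec (nxF [10]) (Full (Fin 25)) :=
  full_of_chk (w := 12) (L := 24) (tw := 1) (s := 1) (r := 24) (base :=
    [33032220143529261644, 14373942014941160323, 19484706390545241301, 35441931470926433604,
     6143410093626041832])
    (by decide +kernel)

theorem g10 : Good [10] :=
  good_ten rfl tAB10 tF10 tG10 tE10 tH10 tJ10

/-- All cycle types. -/
def parts : List (List ℕ) :=
  [[2], [3], [2, 2], [4], [2, 3], [5], [2, 2, 2], [2, 4], [3, 3], [6], [2, 2, 3], [2, 5],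
   [3, 4], [7], [2, 2, 2, 2], [2, 2, 4], [2, 3, 3], [2, 6], [3, 5], [4, 4], [8], [2, 2, 2, 3],
   [2, 2, 5], [2, 3, 4], [2, 7], [3, 3, 3], [3, 6], [4, 5], [9], [2, 2, 2, 2, 2], [2, 2, 2, 4],
   [2, 2, 3, 3], [2, 2, 6], [2, 3, 5], [2, 4, 4], [2, 8], [3, 3, 4], [3, 7], [4, 6], [5, 5],
   [10]]

theorem parts_good : ∀ P ∈ parts, Good P := by
  simp only [parts, List.forall_mem_cons]
  exact ⟨g2, g3, g2_2, g4, g2_3, g5, g2_2_2, g2_4, g3_3, g6, g2_2_3, g2_5, g3_4, g7, g2_2_2_2,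
    g2_2_4, g2_3_3, g2_6, g3_5, g4_4, g8, g2_2_2_3, g2_2_5, g2_3_4, g2_7, g3_3_3, g3_6, g4_5,
    g9, g2_2_2_2_2, g2_2_2_4, g2_2_3_3, g2_2_6, g2_3_5, g2_4_4, g2_8, g3_3_4, g3_7, g4_6, g5_5,
    g10, by simp⟩

theorem parts_two : ∀ P ∈ parts, ∀ i, 2 ≤ P.get i := by decide +kernel

theorem parts_lt : ∀ P ∈ parts, ∀ x, posn P x < P.sum := by decide +kernel

theorem parts_inj : ∀ P ∈ parts, ∀ x y, posn P x = posn P y → x = y := by decide +kernel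

theorem parts_nxt : ∀ P ∈ parts, ∀ x, posn P (sigNx P.get x) = nxt P (posn P x) := by
  decide +kernel

theorem mem_parts (P : List ℕ) (h0 : P ≠ []) (h2 : ∀ x ∈ P, 2 ≤ x) (hs : P.Pairwise (· ≤ ·))
    (hS : P.sum ≤ 10) : P ∈ parts := by
  rcases P with _ | ⟨a, _ | ⟨b, _ | ⟨c, _ | ⟨d, _ | ⟨e, _ | ⟨f, P⟩⟩⟩⟩⟩⟩
  · exact absurd rfl h0
  all_goals
    simp only [List.mem_cons, List.not_mem_nil, or_false, forall_eq_or_imp, forall_eq,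
      List.pairwise_cons, List.sum_cons, List.sum_nil] at h2 hs hS
  · have ha : a ≤ 10 := by omega
    have ha' : 2 ≤ a := by omega
    clear h2 hs hS h0
    interval_cases a <;> decide
  · have ha : a ≤ 5 := by omega
    have hb : b ≤ 10 := by omega
    obtain ⟨ha', hb'⟩ := h2
    interval_cases a <;> interval_cases b <;> first | omega | decide
  · have ha : a ≤ 3 := by omega
    have hb : b ≤ 4 := by omega
    have hc : c ≤ 6 := by omega
    obtain ⟨ha', hb', hc'⟩ := h2
    interval_cases a <;> interval_cases b <;> interval_cases c <;> first | omega | decide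
  · have ha : a ≤ 2 := by omega
    have hb : b ≤ 3 := by omega
    have hc : c ≤ 3 := by omega
    have hd : d ≤ 4 := by omega
    obtain ⟨ha', hb', hc', hd'⟩ := h2
    interval_cases a <;> interval_cases b <;> interval_cases c <;> interval_cases d <;>
      first | omega | decide
  · obtain ⟨ha', hb', hc', hd', he'⟩ := h2
    obtain rfl : a = 2 := by omega
    obtain rfl : b = 2 := by omega
    obtain rfl : c = 2 := by omega
    obtain rfl : d = 2 := by omega
    obtain rfl : e = 2 := by omega
    decide
  · exfalso
    omega

end HOPAux

/-- Theorem 1.2: if `s ≥ 0`, `2 ≤ m₁ ≤ … ≤ m_t`, `m = m₁ + ⋯ + m_t ≤ 10`, `n = s + m`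
is odd, and `n(n-1) ≡ 0 (mod 2m)`, then `HOP(2^⟨s⟩, 2m₁, …, 2m_t)` has a solution. -/
theorem hop_small_round_tables (s t : ℕ) (ht : 1 ≤ t) (m : Fin t → ℕ)
    (hm₂ : ∀ i, 2 ≤ m i) (hmono : Monotone m)
    (M n : ℕ) (hM : M = ∑ i, m i) (hM10 : M ≤ 10) (hn : n = s + M)
    (hodd : Odd n) (hcong : n * (n - 1) ≡ 0 [MOD 2 * M]) :
    HOPSolution n s t m := by
  obtain ⟨P, hPt, hPm⟩ : ∃ P : List ℕ, ∃ h : t = P.length, ∀ i, m i = P.get (Fin.cast h i) :=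
    ⟨List.ofFn m, by simp, by intro i; simp⟩
  subst hPt
  obtain rfl : m = P.get := funext hPm
  have hsum : ∑ i, P.get i = P.sum := by simp
  rw [hsum] at hM
  subst hM
  have hmem : P ∈ HOPAux.parts := by
    refine HOPAux.mem_parts P ?_ ?_ ?_ hM10
    · rintro rfl
      simp at ht
    · intro x hx
      obtain ⟨i, rfl⟩ := List.get_of_mem hx
      exact hm₂ i
    · rw [List.pairwise_iff_get]
      intro i j hij
      exact hmono hij.le
  exact HOPAux.sol_of_good (HOPAux.parts_good P hmem) (HOPAux.parts_two P hmem)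
    (HOPAux.parts_lt P hmem) (HOPAux.parts_inj P hmem) (HOPAux.parts_nxt P hmem) hn hodd hcong
end

section
/- Let s ≥ 0, r ≥ 1 and m ≥ 3 be integers, and let n = s + 2r + m. If n ≡ 1 (mod 2(2r + m)), then HOP(2^⟨s⟩, 4^⟨r⟩, 2m) has a solution. -/
/-- Alternating partial sums of `f`. -/
def zigW (f : ℕ → ℕ) (l : ℕ) : ℤ := ∑ i ∈ Finset.range l, (-1 : ℤ) ^ i * (f i : ℤ)

lemma zigW_succ (f : ℕ → ℕ) (l : ℕ) : zigW f (l + 1) = zigW f l + (-1) ^ l * (f l : ℤ) := by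
  simp [zigW, Finset.sum_range_succ]

lemma zigW_bound (f : ℕ → ℕ) (L : ℕ) (hpos : ∀ i < L, 1 ≤ f i)
    (hf : ∀ i, i + 1 < L → f i < f (i + 1)) (a l : ℕ) (h : a + l < L) :
    0 < (-1 : ℤ) ^ (a + l) * (zigW f (a + l + 1) - zigW f a) ∧
      (-1 : ℤ) ^ (a + l) * (zigW f (a + l + 1) - zigW f a) ≤ f (a + l) := by
  have sq : ∀ b : ℕ, (-1 : ℤ) ^ b * (-1) ^ b = 1 := fun b => by
    rw [← mul_pow]; simp
  induction l with
  | zero =>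
    have := hpos a (by omega)
    have e : (-1 : ℤ) ^ (a + 0) * (zigW f (a + 0 + 1) - zigW f a) = f a := by
      rw [add_zero, zigW_succ]
      linear_combination (f a : ℤ) * sq a
    rw [e]
    simp only [add_zero]
    omega
  | succ l ih =>
    have ih' := ih (by omega)
    have h1 := hf (a + l) (by omega)
    have e : (-1 : ℤ) ^ (a + (l + 1)) * (zigW f (a + (l + 1) + 1) - zigW f a)
        = f (a + l + 1) - (-1 : ℤ) ^ (a + l) * (zigW f (a + l + 1) - zigW f a) := by
      rw [zigW_succ, ← add_assoc]
      have := sq (a + l + 1)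
      have h2 : (-1 : ℤ) ^ (a + l + 1) = - (-1) ^ (a + l) := by rw [pow_succ]; ring
      rw [h2] at this ⊢
      linear_combination (f (a + l + 1) : ℤ) * this
    rw [e, ← add_assoc]
    constructor <;> linarith [ih'.1, ih'.2, (by exact_mod_cast h1 : (f (a + l) : ℤ) < f (a + l + 1))]

/-- A zigzag path closes up to a cycle with prescribed differences. -/
lemma zig_cycle (m N : ℕ) (hm : 3 ≤ m) (f : ℕ → ℕ) (hpos : ∀ i < m, 1 ≤ f i ∧ f i ≤ N)
    (hf : ∀ i, i + 1 < m - 1 → f i < f (i + 1))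
    (hc : zigW f (m - 1) = f (m - 1) ∨ zigW f (m - 1) = - (f (m - 1) : ℤ)) :
    ∃ x : ℕ → ZMod (2 * N + 1),
      (∀ i i', i < m → i' < m → x i = x i' → i = i') ∧
      ∀ i < m, x ((i + 1) % m) = x i + (f i : ZMod (2 * N + 1)) ∨
        x i = x ((i + 1) % m) + (f i : ZMod (2 * N + 1)) := by
  refine ⟨fun i => ((zigW f i : ℤ) : ZMod (2 * N + 1)), ?_, ?_⟩
  · have key : ∀ i i', i < i' → i' < m →
        ((zigW f i : ℤ) : ZMod (2 * N + 1)) ≠ ((zigW f i' : ℤ) : ZMod (2 * N + 1)) := by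
      intro i i' h1 h2 he
      obtain ⟨l, rfl⟩ : ∃ l, i' = i + l + 1 := ⟨i' - i - 1, by omega⟩
      have hb := zigW_bound f (m - 1) (fun i hi => (hpos i (by omega)).1) hf i l (by omega)
      have hN := (hpos (i + l) (by omega)).2
      rw [ZMod.intCast_eq_intCast_iff_dvd_sub] at he
      have hd := he.mul_left ((-1 : ℤ) ^ (i + l))
      have := Int.le_of_dvd hb.1 hd
      push_cast at this
      omega
    intro i i' hi hi' he
    rcases lt_trichotomy i i' with h | h | h
    · exact absurd he (key i i' h hi')
    · exact h
    · exact absurd he.symm (key i' i h hi)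
  · intro i hi
    by_cases h : i = m - 1
    · subst h
      have e : (m - 1 + 1) % m = 0 := by
        rw [show m - 1 + 1 = m by omega]; simp
      rw [e]
      have z : zigW f 0 = 0 := by simp [zigW]
      simp only [z]
      rcases hc with hc | hc <;> rw [hc]
      · right; simp
      · left; simp
    · have e : (i + 1) % m = i + 1 := Nat.mod_eq_of_lt (by omega)
      rw [e]
      simp only [zigW_succ]
      rcases neg_one_pow_eq_or ℤ i with h | h <;> rw [h]
      · left; push_cast; ring
      · right; push_cast; ring

lemma interval_inj (k m : ℕ) (f : ℕ → ℕ → ℕ) (Lo Hi : ℕ → ℕ)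
    (hb : ∀ j < k, ∀ i < m, k * Lo i < f j i ∧ f j i ≤ k * Hi i)
    {j j' i i' : ℕ} (hj : j < k) (hj' : j' < k) (hi : i < m) (hi' : i' < m)
    (h : Hi i ≤ Lo i' ∨ Hi i' ≤ Lo i) : f j i ≠ f j' i' := by
  have h1 := hb j hj i hi
  have h2 := hb j' hj' i' hi'
  rcases h with h | h
  · have := Nat.mul_le_mul_left k h; omega
  · have := Nat.mul_le_mul_left k h; omega

lemma diffs_even (k p M : ℕ) (hp : 2 ≤ p) (hM : 2 * p + 2 ≤ M) :
    ∃ f : ℕ → ℕ → ℕ, (∀ j < k, ∀ i < 2 * p, 1 ≤ f j i ∧ f j i ≤ M * k) ∧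
      (∀ j j' i i', j < k → j' < k → i < 2 * p → i' < 2 * p → f j i = f j' i' → j = j' ∧ i = i') ∧
      (∀ j < k, ∀ i, i + 1 < 2 * p - 1 → f j i < f j (i + 1)) ∧
      (∀ j < k, zigW (f j) (2 * p - 1) = f j (2 * p - 1) ∨
        zigW (f j) (2 * p - 1) = - (f j (2 * p - 1) : ℤ)) := by
  obtain ⟨e, q, he, hq, hqe⟩ : ∃ e q, e ≤ 2 ∧ 1 ≤ e ∧ 2 * q + e = p - 1 := by
    rcases Nat.even_or_odd' p with ⟨t, rfl | rfl⟩
    · exact ⟨1, t - 1, by omega, by omega, by omega⟩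
    · exact ⟨2, t - 1, by omega, by omega, by omega⟩
  let u : ℕ → ℕ := fun i => if i = 2 * p - 1 then p - 1 else if i ≤ 2 * q then i else i + e
  let f : ℕ → ℕ → ℕ := fun j i => k * u i + j + 1
  have hu : ∀ i < 2 * p, u i + 1 ≤ M := by
    intro i hi; simp only [u]; split_ifs <;> omega
  have huinj : ∀ i i', i < 2 * p → i' < 2 * p → i ≠ i' → u i + 1 ≤ u i' ∨ u i' + 1 ≤ u i := by
    intro i i' hi hi' hne; simp only [u]; split_ifs <;> omega
  have hb : ∀ j < k, ∀ i < 2 * p, k * u i < f j i ∧ f j i ≤ k * (u i + 1) := by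
    intro j hj i hi; simp only [f, mul_add]; omega
  refine ⟨f, ?_, ?_, ?_, ?_⟩
  · intro j hj i hi
    have := hb j hj i hi
    have h2 := Nat.mul_le_mul_left k (hu i hi)
    rw [mul_comm M k]
    omega
  · intro j j' i i' hj hj' hi hi' h
    by_cases hii : i = i'
    · subst hii; simp only [f] at h; omega
    · exact absurd h (interval_inj k (2 * p) f u (fun i => u i + 1) hb hj hj' hi hi'
        (huinj i i' hi hi' hii))
  · intro j hj i hi
    have : u i + 1 ≤ u (i + 1) := by simp only [u]; split_ifs <;> omega
    have h2 := Nat.mul_le_mul_left k this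
    simp only [f]
    rw [mul_add] at h2
    omega
  · intro j hj
    left
    have key : ∀ t, t + 1 ≤ p → zigW (f j) (2 * t + 1) = k * t + j + 1 := by
      intro t
      induction t with
      | zero =>
        intro _
        have : u 0 = 0 := by simp only [u]; split_ifs <;> omega
        simp [zigW, f, this]
      | succ t ih =>
        intro ht
        rw [show 2 * (t + 1) + 1 = 2 * t + 1 + 1 + 1 by ring, zigW_succ, zigW_succ, ih (by omega)]
        have hh : u (2 * t + 1 + 1) = u (2 * t + 1) + 1 := by
          simp only [u]; split_ifs <;> omega
        have s1 : (-1 : ℤ) ^ (2 * t + 1) = -1 := by rw [pow_succ, pow_mul]; simp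
        have s2 : (-1 : ℤ) ^ (2 * t + 1 + 1) = 1 := by rw [pow_succ, s1]; simp
        rw [s1, s2]
        simp only [f, hh]
        push_cast; ring
    have h1 := key (p - 1) (by omega)
    rw [show 2 * (p - 1) + 1 = 2 * p - 1 by omega] at h1
    rw [h1]
    simp [f, u]

lemma diffs_odd (k p M : ℕ) (hp : 1 ≤ p) (hM : 2 * p + 3 ≤ M) :
    ∃ f : ℕ → ℕ → ℕ, (∀ j < k, ∀ i < 2 * p + 1, 1 ≤ f j i ∧ f j i ≤ M * k) ∧
      (∀ j j' i i', j < k → j' < k → i < 2 * p + 1 → i' < 2 * p + 1 →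
        f j i = f j' i' → j = j' ∧ i = i') ∧
      (∀ j < k, ∀ i, i + 1 < 2 * p → f j i < f j (i + 1)) ∧
      (∀ j < k, zigW (f j) (2 * p) = f j (2 * p) ∨
        zigW (f j) (2 * p) = - (f j (2 * p) : ℤ)) := by
  obtain ⟨e, q, he, hq, hqe⟩ : ∃ e q, e ≤ 3 ∧ 2 ≤ e ∧ 2 * q + e = p + 1 := by
    rcases Nat.even_or_odd' p with ⟨t, rfl | rfl⟩
    · exact ⟨3, t - 1, by omega, by omega, by omega⟩
    · exact ⟨2, t, by omega, by omega, by omega⟩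
  let u : ℕ → ℕ := fun i => if i < 2 * q then i else i + e
  let f : ℕ → ℕ → ℕ := fun j i =>
    if i = 2 * p then k * (p - 1) + 2 * j + 1
    else if i = 2 * p - 1 then k * (2 * p - 2 + e) + k + j + 1
    else if i = 2 * p - 2 then k * (2 * p - 2 + e) + k - j
    else k * u i + j + 1
  let Lo : ℕ → ℕ := fun i =>
    if i = 2 * p then p - 1
    else if i = 2 * p - 1 then 2 * p - 2 + e + 1
    else if i = 2 * p - 2 then 2 * p - 2 + e
    else u i
  let Hi : ℕ → ℕ := fun i =>
    if i = 2 * p then p + 1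
    else if i = 2 * p - 1 then 2 * p - 2 + e + 2
    else if i = 2 * p - 2 then 2 * p - 2 + e + 1
    else u i + 1
  have hu : ∀ i < 2 * p + 1, Hi i ≤ M := by
    intro i hi; simp only [Hi, u]; split_ifs <;> omega
  have huinj : ∀ i i', i < 2 * p + 1 → i' < 2 * p + 1 → i ≠ i' → Hi i ≤ Lo i' ∨ Hi i' ≤ Lo i := by
    intro i i' hi hi' hne; simp only [Hi, Lo, u]; split_ifs <;> omega
  have hb : ∀ j < k, ∀ i < 2 * p + 1, k * Lo i < f j i ∧ f j i ≤ k * Hi i := by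
    intro j hj i hi
    simp only [f, Lo, Hi]
    have : k * (p + 1) = k * (p - 1) + 2 * k := by
      obtain ⟨t, rfl⟩ : ∃ t, p = t + 1 := ⟨p - 1, by omega⟩
      simp only [Nat.add_sub_cancel]; ring
    split_ifs
    · rw [this]; omega
    all_goals (simp only [mul_add, mul_one]; omega)
  refine ⟨f, ?_, ?_, ?_, ?_⟩
  · intro j hj i hi
    have := hb j hj i hi
    have h2 := Nat.mul_le_mul_left k (hu i hi)
    rw [mul_comm M k]
    omega
  · intro j j' i i' hj hj' hi hi' h
    by_cases hii : i = i'
    · subst hii; simp only [f] at h; refine ⟨?_, rfl⟩; split_ifs at h <;> omega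
    · exact absurd h (interval_inj k (2 * p + 1) f Lo Hi hb hj hj' hi hi'
        (huinj i i' hi hi' hii))
  · intro j hj i hi
    have : Hi i ≤ Lo (i + 1) := by simp only [Hi, Lo, u]; split_ifs <;> omega
    have h2 := Nat.mul_le_mul_left k this
    have h3 := hb j hj i (by omega)
    have h4 := hb j hj (i + 1) (by omega)
    omega
  · intro j hj
    right
    have key : ∀ t, t + 1 ≤ p → zigW (f j) (2 * t) = - (k * t : ℤ) := by
      intro t
      induction t with
      | zero => intro _; simp [zigW]
      | succ t ih =>
        intro ht
        rw [show 2 * (t + 1) = 2 * t + 1 + 1 by ring, zigW_succ, zigW_succ, ih (by omega)]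
        have hh : u (2 * t + 1) = u (2 * t) + 1 := by
          simp only [u]; split_ifs <;> omega
        have s0 : (-1 : ℤ) ^ (2 * t) = 1 := by rw [pow_mul]; simp
        have s1 : (-1 : ℤ) ^ (2 * t + 1) = -1 := by rw [pow_succ, pow_mul]; simp
        have f0 : f j (2 * t) = k * u (2 * t) + j + 1 := by
          simp only [f]; rw [if_neg (by omega), if_neg (by omega), if_neg (by omega)]
        have f1 : f j (2 * t + 1) = k * u (2 * t + 1) + j + 1 := by
          simp only [f]; rw [if_neg (by omega), if_neg (by omega), if_neg (by omega)]
        rw [s1, s0, f0, f1, hh]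
        push_cast; ring
    obtain ⟨t, rfl⟩ : ∃ t, p = t + 1 := ⟨p - 1, by omega⟩
    have h1 := key t le_rfl
    rw [show 2 * (t + 1) = 2 * t + 1 + 1 by ring, zigW_succ, zigW_succ, h1]
    have s0 : (-1 : ℤ) ^ (2 * t) = 1 := by rw [pow_mul]; simp
    have s1 : (-1 : ℤ) ^ (2 * t + 1) = -1 := by rw [pow_succ, pow_mul]; simp
    have f0 : (f j (2 * t) : ℤ) = k * (2 * t + e) + k - j := by
      simp only [f]
      rw [if_neg (by omega), if_neg (by omega), if_pos (by omega),
        show 2 * (t + 1) - 2 = 2 * t by omega]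
      rw [Nat.cast_sub (by omega)]
      push_cast; ring
    have f1 : (f j (2 * t + 1) : ℤ) = k * (2 * t + e) + k + j + 1 := by
      simp only [f]
      rw [if_neg (by omega), if_pos (by omega), show 2 * (t + 1) - 2 = 2 * t by omega]
      push_cast; ring
    have f2 : (f j (2 * t + 1 + 1) : ℤ) = k * t + 2 * j + 1 := by
      simp only [f]
      rw [if_pos (by omega), Nat.add_sub_cancel]
      push_cast; ring
    rw [s0, s1, f0, f1, f2]
    ring

lemma diffs (k m M : ℕ) (hm : 3 ≤ m) (hM : m + 2 ≤ M) :
    ∃ f : ℕ → ℕ → ℕ, (∀ j < k, ∀ i < m, 1 ≤ f j i ∧ f j i ≤ M * k) ∧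
      (∀ j j' i i', j < k → j' < k → i < m → i' < m → f j i = f j' i' → j = j' ∧ i = i') ∧
      (∀ j < k, ∀ i, i + 1 < m - 1 → f j i < f j (i + 1)) ∧
      (∀ j < k, zigW (f j) (m - 1) = f j (m - 1) ∨
        zigW (f j) (m - 1) = - (f j (m - 1) : ℤ)) := by
  rcases Nat.even_or_odd' m with ⟨p, rfl | rfl⟩
  · exact diffs_even k p M (by omega) hM
  · exact diffs_odd k p M (by omega) hM

/-- Greedy placement of disjoint pairs with prescribed differences. -/
lemma greedy (n : ℕ) [NeZero n] (r : ℕ) (e : ℕ → ZMod n) (he : ∀ l < r, e l ≠ 0)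
    (U : Finset (ZMod n)) (hU : 2 * (U.card + 2 * r) ≤ n) :
    ∃ y : ℕ → ZMod n, (∀ l < r, y l ∉ U ∧ y l + e l ∉ U) ∧
      ∀ l < r, ∀ l' < r, l ≠ l' → y l ≠ y l' ∧ y l ≠ y l' + e l' ∧ y l + e l ≠ y l' + e l' := by
  induction r generalizing U with
  | zero => exact ⟨fun _ => 0, by simp, by simp⟩
  | succ r ih =>
    obtain ⟨z, hz⟩ : ∃ z, z ∉ U ∪ U.image (fun a => a - e r) := by
      by_contra! hall
      have h1 : (Finset.univ : Finset (ZMod n)) ⊆ U ∪ U.image (fun a => a - e r) :=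
        fun z _ => hall z
      have h2 := Finset.card_le_card h1
      have h3 := Finset.card_union_le U (U.image (fun a => a - e r))
      have h4 := Finset.card_image_le (s := U) (f := fun a => a - e r)
      rw [Finset.card_univ, ZMod.card] at h2
      omega
    have hz1 : z ∉ U := fun h => hz (Finset.mem_union_left _ h)
    have hz2 : z + e r ∉ U := fun h => hz (Finset.mem_union_right _
      (Finset.mem_image.2 ⟨_, h, by simp⟩))
    obtain ⟨y, hy1, hy2⟩ := ih (fun l hl => he l (by omega)) (insert z (insert (z + e r) U)) (by
      have h1 := Finset.card_insert_le z (insert (z + e r) U)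
      have h2 := Finset.card_insert_le (z + e r) U
      omega)
    have hy1' : ∀ l < r, (y l ≠ z ∧ y l ≠ z + e r ∧ y l ∉ U) ∧
        (y l + e l ≠ z ∧ y l + e l ≠ z + e r ∧ y l + e l ∉ U) := by
      intro l hl
      have := hy1 l hl
      simpa [not_or] using this
    refine ⟨fun l => if l = r then z else y l, ?_, ?_⟩
    · intro l hl
      by_cases h : l = r
      · subst h; simp [hz1, hz2]
      · have := hy1' l (by omega)
        simp only [if_neg h]; tauto
    · intro l hl l' hl' hne
      by_cases h : l = r
      · subst h
        have h' : l' ≠ l := fun h => hne h.symm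
        have := hy1' l' (by omega)
        simp only [if_neg h', if_true]
        exact ⟨this.1.1.symm, this.2.1.symm, this.2.2.1.symm⟩
      · by_cases h' : l' = r
        · subst h'
          have := hy1' l (by omega)
          simp only [if_neg h, if_true]
          exact ⟨this.1.1, this.1.2.1, this.2.2.1⟩
        · simp only [if_neg h, if_neg h']
          exact hy2 l (by omega) l' (by omega) hne

lemma fin2_cases (a : Fin 2) : a = 0 ∨ a = 1 := by omega

/-- Parity of a natural number, as an element of `Fin 2`. -/
def par2 (z : ℕ) : Fin 2 := ⟨z % 2, Nat.mod_lt _ (by norm_num)⟩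

lemma par2_zero {z : ℕ} (h : z % 2 = 0) : par2 z = 0 := Fin.ext h

lemma par2_one {z : ℕ} (h : z % 2 = 1) : par2 z = 1 := Fin.ext h

set_option maxHeartbeats 1000000 in
/-- Build a factor from the cyclic sequences of couples and entrance sides. -/
lemma exists_factor (n s t : ℕ) (m : Fin t → ℕ) (hm : ∀ i, 2 ≤ m i) (hn : n = s + ∑ i, m i)
    (X : Fin t → ℕ → Fin n) (A : Fin t → ℕ → Fin 2)
    (hX : ∀ i i' p p', p < m i → p' < m i' → X i p = X i' p' → i = i' ∧ p = p') :
    ∃ F : HOPFactor n s t m, ∀ e, ¬ IsIEdge e → (e ∈ F.edges ↔ ∃ i, ∃ p < m i,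
      e = s((X i p, A i p + 1), (X i ((p + 1) % m i), A i ((p + 1) % m i)))) := by
  classical
  let S : Finset (Fin n) := Finset.univ.image (fun x : (i : Fin t) × Fin (m i) => X x.1 x.2)
  have hS : S.card = ∑ i, m i := by
    rw [Finset.card_image_of_injective]
    · simp
    · rintro ⟨i, p⟩ ⟨i', p'⟩ h
      obtain ⟨rfl, h2⟩ := hX i i' p p' p.2 p'.2 h
      have := Fin.ext h2
      subst this; rfl
  have hSc : Sᶜ.card = s := by
    rw [Finset.card_compl, hS, Fintype.card_fin]; omega
  let σ : Fin s ≃ {x // x ∈ Sᶜ} := (Finset.equivFinOfCardEq hSc).symm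
  have hmem : ∀ i p, p < m i → X i p ∈ S := fun i p hp =>
    Finset.mem_image.2 ⟨⟨i, ⟨p, hp⟩⟩, Finset.mem_univ _, rfl⟩
  have hσ : ∀ a, (σ a).1 ∉ S := fun a => Finset.mem_compl.1 (σ a).2
  have hne : ∀ i, NeZero (2 * m i) := fun i => ⟨by have := hm i; omega⟩
  let C : (i : Fin t) → ZMod (2 * m i) → HOPVertex n := fun i z =>
    (X i (z.val / 2), A i (z.val / 2) + par2 z.val)
  have hval : ∀ i (z : ZMod (2 * m i)), z.val < 2 * m i := fun i z => ZMod.val_lt z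
  have hval1 : ∀ i (z : ZMod (2 * m i)), (z + 1).val = (z.val + 1) % (2 * m i) := by
    intro i z
    have : Fact (1 < 2 * m i) := ⟨by have := hm i; omega⟩
    rw [ZMod.val_add, ZMod.val_one]
  have heven : ∀ i (z : ZMod (2 * m i)), z.val % 2 = 0 → C i (z + 1) = HOPspouse (C i z) := by
    intro i z hz
    have h1 := hval i z
    have h2 : (z + 1).val = z.val + 1 := by
      rw [hval1]; exact Nat.mod_eq_of_lt (by omega)
    have h3 : (z.val + 1) / 2 = z.val / 2 := by omega
    have h4 : (z.val + 1) % 2 = 1 := by omega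
    simp only [C, HOPspouse, h2, h3, par2_one h4, par2_zero hz, add_zero]
  have hodd : ∀ i (z : ZMod (2 * m i)), z.val % 2 = 1 →
      C i z = (X i (z.val / 2), A i (z.val / 2) + 1) ∧
      C i (z + 1) = (X i ((z.val / 2 + 1) % m i), A i ((z.val / 2 + 1) % m i)) := by
    intro i z hz
    refine ⟨by simp only [C, par2_one hz], ?_⟩
    have h1 := hval i z
    have h2 : (z + 1).val = 2 * ((z.val / 2 + 1) % m i) := by
      rw [hval1, show z.val + 1 = 2 * (z.val / 2 + 1) by omega, Nat.mul_mod_mul_left]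
    have h5 : 2 * ((z.val / 2 + 1) % m i) / 2 = (z.val / 2 + 1) % m i := by omega
    simp only [C, h2, par2_zero (Nat.mul_mod_right 2 _), add_zero, h5]
  have hIfst : ∀ u v : HOPVertex n, IsIEdge s(u, v) → u.1 = v.1 := by
    rintro u v ⟨w, hw⟩
    rw [Sym2.eq_iff] at hw
    rcases hw with ⟨rfl, rfl⟩ | ⟨rfl, rfl⟩ <;> rfl
  have hpm : ∀ i p, p < m i → (p + 1) % m i < m i := fun i p hp => Nat.mod_lt _ (by omega)
  have hpne : ∀ i p, p < m i → (p + 1) % m i ≠ p := by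
    intro i p hp
    have := hm i
    by_cases h : p + 1 = m i
    · rw [h, Nat.mod_self]; omega
    · rw [Nat.mod_eq_of_lt (by omega)]; omega
  let F : HOPFactor n s t m :=
    { pair := fun a => ((σ a).1, 0)
      cyc := C
      alt_even := heven
      alt_odd := by
        intro i z hz hI
        have h := hIfst _ _ hI
        have h1 := hval i z
        rw [(hodd i z hz).1, (hodd i z hz).2] at h
        have hlt : z.val / 2 < m i := by omega
        exact hpne i _ hlt (hX i i _ _ hlt (hpm i _ hlt) h).2.symm
      spanning := by
        constructor
        · rintro (⟨a, b⟩ | ⟨i, z⟩) (⟨a', b'⟩ | ⟨i', z'⟩) h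
          · simp only [Sum.elim_inl] at h
            have h1 : σ a = σ a' := by
              apply Subtype.ext
              have := congrArg Prod.fst h
              simpa [HOPspouse, apply_ite Prod.fst] using this
            have h2 : a = a' := σ.injective h1
            subst h2
            have h3 := congrArg Prod.snd h
            rcases fin2_cases b with rfl | rfl <;> rcases fin2_cases b' with rfl | rfl <;>
              simp_all [HOPspouse]
          · exfalso
            simp only [Sum.elim_inl, Sum.elim_inr] at h
            have h1 : (σ a).1 = X i' (z'.val / 2) := by
              have := congrArg Prod.fst h
              simpa [HOPspouse, apply_ite Prod.fst, C] using this
            have := hval i' z'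
            exact hσ a (h1 ▸ hmem i' _ (by omega))
          · exfalso
            simp only [Sum.elim_inl, Sum.elim_inr] at h
            have h1 : (σ a').1 = X i (z.val / 2) := by
              have := congrArg Prod.fst h.symm
              simpa [HOPspouse, apply_ite Prod.fst, C] using this
            have := hval i z
            exact hσ a' (h1 ▸ hmem i _ (by omega))
          · simp only [Sum.elim_inr] at h
            have h1 : X i (z.val / 2) = X i' (z'.val / 2) := congrArg Prod.fst h
            have v1 := hval i z
            have v2 := hval i' z'
            obtain ⟨rfl, h2⟩ := hX _ _ _ _ (by omega) (by omega) h1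
            have h3 : A i (z.val / 2) + par2 z.val
              = A i (z'.val / 2) + par2 z'.val := congrArg Prod.snd h
            rw [h2] at h3
            have h4 := add_left_cancel h3
            have h5 : z.val % 2 = z'.val % 2 := congrArg Fin.val h4
            have h6 : z.val = z'.val := by omega
            have := ZMod.val_injective _ h6
            subst this; rfl
        · rintro ⟨c, b⟩
          by_cases hc : c ∈ S
          · obtain ⟨⟨i, p⟩, -, hp⟩ := Finset.mem_image.1 hc
            simp only at hp
            have hq : (b - A i p).val < 2 := (b - A i p).2
            refine ⟨Sum.inr ⟨i, ((2 * p.1 + (b - A i p).val : ℕ) : ZMod (2 * m i))⟩, ?_⟩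
            have hv : ((2 * p.1 + (b - A i p).val : ℕ) : ZMod (2 * m i)).val
                = 2 * p.1 + (b - A i p).val := ZMod.val_cast_of_lt (by have := p.2; omega)
            simp only [Sum.elim_inr, C, hv]
            have e1 : (2 * p.1 + (b - A i p).val) / 2 = p.1 := by omega
            have e2 : par2 (2 * p.1 + (b - A i p).val) = b - A i p := Fin.ext (by
              simp only [par2]; omega)
            rw [e1, e2, hp]
            simp
          · refine ⟨Sum.inl (σ.symm ⟨c, Finset.mem_compl.2 hc⟩, b), ?_⟩
            rcases fin2_cases b with rfl | rfl <;> simp [HOPspouse] }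
  refine ⟨F, fun e he => ⟨?_, ?_⟩⟩
  · rintro (⟨a, rfl⟩ | ⟨i, z, rfl⟩)
    · exact absurd ⟨_, rfl⟩ he
    · change ¬ IsIEdge s(C i z, C i (z + 1)) at he
      change ∃ i_1, ∃ p < m i_1, s(C i z, C i (z + 1)) = _
      rcases Nat.mod_two_eq_zero_or_one z.val with h | h
      · exact absurd ⟨C i z, by rw [heven i z h]⟩ he
      · have := hval i z
        exact ⟨i, z.val / 2, by omega, by rw [(hodd i z h).1, (hodd i z h).2]⟩
  · rintro ⟨i, p, hp, rfl⟩
    right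
    refine ⟨i, ((2 * p + 1 : ℕ) : ZMod (2 * m i)), ?_⟩
    change _ = s(C i _, C i _)
    have hv : ((2 * p + 1 : ℕ) : ZMod (2 * m i)).val = 2 * p + 1 :=
      ZMod.val_cast_of_lt (by omega)
    have h := hodd i ((2 * p + 1 : ℕ) : ZMod (2 * m i)) (by rw [hv]; omega)
    rw [h.1, h.2, hv, show (2 * p + 1) / 2 = p by omega]

/-- The difference `t + 1` as an element of `ZMod (2 * N + 1)`. -/
def dv {N : ℕ} (t : Fin N) : ZMod (2 * N + 1) := ((t.val + 1 : ℕ) : ZMod (2 * N + 1))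

lemma dv_val {N : ℕ} (t : Fin N) : (dv t).val = t.val + 1 :=
  ZMod.val_cast_of_lt (by have := t.2; omega)

lemma dv_ne_zero {N : ℕ} (t : Fin N) : dv t ≠ 0 := by
  intro h
  have := dv_val t
  rw [h, ZMod.val_zero] at this
  omega

lemma dv_inj {N : ℕ} {t t' : Fin N} (h : dv t = dv t') : t = t' := by
  have h1 := dv_val t
  rw [h, dv_val t'] at h1
  exact Fin.ext (by omega)

lemma dv_add_ne {N : ℕ} (t t' : Fin N) : dv t + dv t' ≠ 0 := by
  intro h
  have h1 : (dv t + dv t').val = (t.val + 1) + (t'.val + 1) := by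
    rw [ZMod.val_add, dv_val, dv_val]
    exact Nat.mod_eq_of_lt (by have := t.2; have := t'.2; omega)
  rw [h, ZMod.val_zero] at h1
  omega

lemma dv_or {N : ℕ} (a : ZMod (2 * N + 1)) (ha : a ≠ 0) : ∃ t : Fin N, a = dv t ∨ -a = dv t := by
  have h0 : a.val ≠ 0 := by rwa [Ne, ZMod.val_eq_zero]
  have h1 := ZMod.val_lt a
  by_cases h : a.val ≤ N
  · refine ⟨⟨a.val - 1, by omega⟩, Or.inl ?_⟩
    apply ZMod.val_injective
    rw [dv_val]; simp only; omega
  · have : NeZero a := ⟨ha⟩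
    have h2 := ZMod.val_neg_of_ne_zero a
    refine ⟨⟨(-a).val - 1, by omega⟩, Or.inr ?_⟩
    apply ZMod.val_injective
    rw [dv_val]; simp only; omega

lemma design (k r m N : ℕ) (hr : 1 ≤ r) (hm : 3 ≤ m) (hk : 1 ≤ k) (hN : N = (2 * r + m) * k) :
    ∃ (D : Fin k × (Fin m ⊕ Fin r × Fin 2) → Fin N) (x : Fin k → ℕ → ZMod (2 * N + 1))
      (y : Fin k → Fin 2 → Fin r → ZMod (2 * N + 1)),
      Function.Injective D ∧
      (∀ j, ∀ i i', i < m → i' < m → x j i = x j i' → i = i') ∧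
      (∀ j, ∀ i : Fin m, x j ((i.val + 1) % m) = x j i.val + dv (D (j, Sum.inl i)) ∨
        x j i.val = x j ((i.val + 1) % m) + dv (D (j, Sum.inl i))) ∧
      (∀ j w l, ∀ p < m, y j w l ≠ x j p ∧ y j w l + dv (D (j, Sum.inr (l, w))) ≠ x j p) ∧
      (∀ j w l l', l ≠ l' → y j w l ≠ y j w l' ∧
        y j w l ≠ y j w l' + dv (D (j, Sum.inr (l', w))) ∧
        y j w l + dv (D (j, Sum.inr (l, w))) ≠ y j w l' + dv (D (j, Sum.inr (l', w)))) := by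
  classical
  obtain ⟨f, hf1, hf2, hf3, hf4⟩ := diffs k m (2 * r + m) hm (by omega)
  rw [← hN] at hf1
  let d : Fin k × Fin m → Fin N := fun a =>
    ⟨f a.1 a.2 - 1, by have := hf1 a.1 a.1.2 a.2 a.2.2; omega⟩
  have hd : Function.Injective d := by
    rintro ⟨j, i⟩ ⟨j', i'⟩ h
    have h1 := congrArg Fin.val h
    simp only [d] at h1
    have a1 := hf1 j j.2 i i.2
    have a2 := hf1 j' j'.2 i' i'.2
    have := hf2 j j' i i' j.2 j'.2 i.2 i'.2 (by omega)
    exact Prod.ext (Fin.ext this.1) (Fin.ext this.2)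
  let S : Finset (Fin N) := Finset.univ.image d
  have hS : S.card = k * m := by
    rw [Finset.card_image_of_injective _ hd]; simp
  have hSc : Fintype.card {t // t ∈ Sᶜ} = Fintype.card (Fin k × Fin r × Fin 2) := by
    rw [Fintype.card_coe, Finset.card_compl, hS]
    simp only [Fintype.card_fin, Fintype.card_prod]
    rw [hN, Nat.sub_eq_iff_eq_add (by nlinarith)]
    ring
  let σ : (Fin k × Fin r × Fin 2) ≃ {t // t ∈ Sᶜ} := (Fintype.equivOfCardEq hSc).symm
  have hσ : ∀ a, (σ a).1 ∉ S := fun a => Finset.mem_compl.1 (σ a).2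
  have hdS : ∀ a, d a ∈ S := fun a => Finset.mem_image_of_mem d (Finset.mem_univ a)
  let D : Fin k × (Fin m ⊕ Fin r × Fin 2) → Fin N := fun a =>
    Sum.elim (fun i => d (a.1, i)) (fun b => (σ (a.1, b)).1) a.2
  have hD : Function.Injective D := by
    rintro ⟨j, i | b⟩ ⟨j', i' | b'⟩ h
    · have := hd h
      simp only [Prod.mk.injEq] at this
      obtain ⟨rfl, rfl⟩ := this; rfl
    · have h' : d (j, i) = (σ (j', b')).1 := h
      exact absurd (show (σ (j', b')).1 ∈ S from h' ▸ hdS (j, i)) (hσ _)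
    · have h' : (σ (j, b)).1 = d (j', i') := h
      exact absurd (show (σ (j, b)).1 ∈ S from h' ▸ hdS (j', i')) (hσ _)
    · have := σ.injective (Subtype.ext h)
      simp only [Prod.mk.injEq] at this
      obtain ⟨rfl, rfl⟩ := this; rfl
  have hx : ∀ j : Fin k, _ := fun j => zig_cycle m N hm (f j) (hf1 j j.2) (hf3 j j.2) (hf4 j j.2)
  choose x hx1 hx2 using hx
  have hy : ∀ (j : Fin k) (w : Fin 2), ∃ y : Fin r → ZMod (2 * N + 1),
      (∀ l, ∀ p < m, y l ≠ x j p ∧ y l + dv (D (j, Sum.inr (l, w))) ≠ x j p) ∧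
      (∀ l l', l ≠ l' → y l ≠ y l' ∧
        y l ≠ y l' + dv (D (j, Sum.inr (l', w))) ∧
        y l + dv (D (j, Sum.inr (l, w))) ≠ y l' + dv (D (j, Sum.inr (l', w)))) := by
    intro j w
    let U : Finset (ZMod (2 * N + 1)) := (Finset.range m).image (x j)
    have hU : U.card ≤ m := by
      simpa using Finset.card_image_le (s := Finset.range m) (f := x j)
    have hxU : ∀ p < m, x j p ∈ U := fun p hp =>
      Finset.mem_image_of_mem _ (Finset.mem_range.2 hp)
    obtain ⟨y, hy1, hy2⟩ := greedy (2 * N + 1) r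
      (fun l => if h : l < r then dv (D (j, Sum.inr (⟨l, h⟩, w))) else 0)
      (fun l hl => by simp only [dif_pos hl]; exact dv_ne_zero _) U (by
        have : 2 * r + m ≤ N := by rw [hN]; exact Nat.le_mul_of_pos_right _ hk
        omega)
    refine ⟨fun l => y l, ?_, ?_⟩
    · intro l p hp
      have h := hy1 l l.2
      simp only [dif_pos l.2, Fin.eta] at h
      refine ⟨fun h' => h.1 ?_, fun h' => h.2 ?_⟩
      · have h'' : y l = x j p := h'
        rw [h'']; exact hxU p hp
      · have h'' : y l + dv (D (j, Sum.inr (l, w))) = x j p := h'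
        rw [h'']; exact hxU p hp
    · intro l l' hne
      have h := hy2 l l.2 l' l'.2 (fun h => hne (Fin.ext h))
      simpa only [dif_pos l.2, dif_pos l'.2, Fin.eta] using h
  choose y hy1 hy2 using hy
  refine ⟨D, x, y, hD, hx1, ?_, hy1, hy2⟩
  intro j i
  have e : dv (D (j, Sum.inl i)) = ((f j i : ℕ) : ZMod (2 * N + 1)) := by
    simp only [D, d, dv, Sum.elim_inl]
    congr 1
    have := hf1 j j.2 i i.2
    omega
  rw [e]
  exact hx2 j i i.2

/-- Edge with given base point, difference and sides. -/
def pedge {N n : ℕ} (σ : ZMod (2 * N + 1) ≃ Fin n)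
    (q : ZMod (2 * N + 1) × Fin N × Fin 2 × Fin 2) : Sym2 (HOPVertex n) :=
  s((σ q.1, q.2.2.1), (σ (q.1 + dv q.2.1), q.2.2.2))

lemma pedge_inj {N n : ℕ} (σ : ZMod (2 * N + 1) ≃ Fin n) : Function.Injective (pedge σ) := by
  rintro ⟨g, d, a, b⟩ ⟨g', d', a', b'⟩ h
  simp only [pedge, Sym2.eq_iff, Prod.mk.injEq, EmbeddingLike.apply_eq_iff_eq] at h
  rcases h with ⟨⟨rfl, rfl⟩, h, rfl⟩ | ⟨⟨h1, -⟩, h2, -⟩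
  · rw [dv_inj (add_left_cancel h)]
  · exfalso
    rw [h1, add_assoc] at h2
    exact dv_add_ne _ _ (by simpa using h2)

lemma pedge_surj {N n : ℕ} (σ : ZMod (2 * N + 1) ≃ Fin n) (e : Sym2 (HOPVertex n))
    (h1 : ¬ e.IsDiag) (h2 : ¬ IsIEdge e) : ∃ q, e = pedge σ q := by
  induction e using Sym2.ind with
  | _ u v =>
  obtain ⟨a, α⟩ := u
  obtain ⟨b, β⟩ := v
  have hab : a ≠ b := by
    rintro rfl
    have hne : α ≠ β := fun h => h1 (by simp [h])
    refine h2 ⟨(a, α), ?_⟩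
    have : β = α + 1 := by omega
    simp [HOPspouse, this]
  have h0 : σ.symm b - σ.symm a ≠ 0 := by
    rw [sub_ne_zero]; exact fun h => hab (σ.symm.injective h).symm
  obtain ⟨t, ht | ht⟩ := dv_or _ h0
  · refine ⟨(σ.symm a, t, α, β), ?_⟩
    simp [pedge, ← ht]
  · refine ⟨(σ.symm b, t, β, α), ?_⟩
    simp [pedge, ← ht, Sym2.eq_swap]

/-- A proper 3-colouring of the cycle of length `m`, composed with the three nonzero linear
functionals on `F_2 ^ 2`. -/
def side (m p : ℕ) (w1 w2 : Fin 2) : Fin 2 :=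
  if p = m - 1 then w1 + w2 else if p % 2 = 0 then w1 else w2

lemma side_inj (m p : ℕ) (hm : 3 ≤ m) (hp : p < m) {w1 w2 w1' w2' : Fin 2}
    (h1 : side m p w1 w2 = side m p w1' w2')
    (h2 : side m ((p + 1) % m) w1 w2 = side m ((p + 1) % m) w1' w2') : w1 = w1' ∧ w2 = w2' := by
  by_cases h : p = m - 1
  · have e : (p + 1) % m = 0 := by rw [show p + 1 = m by omega, Nat.mod_self]
    rw [e] at h2
    simp only [side, if_pos h] at h1
    rw [side, side, if_neg (by omega), if_pos rfl, if_neg (by omega), if_pos rfl] at h2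
    subst h2
    exact ⟨rfl, add_left_cancel h1⟩
  · have e : (p + 1) % m = p + 1 := Nat.mod_eq_of_lt (by omega)
    rw [e] at h2
    simp only [side, if_neg h] at h1 h2
    by_cases h3 : p + 1 = m - 1
    · simp only [if_pos h3] at h2
      split_ifs at h1
      · subst h1; exact ⟨rfl, add_left_cancel h2⟩
      · subst h1; exact ⟨add_right_cancel h2, rfl⟩
    · simp only [if_neg h3] at h2
      split_ifs at h1 h2 <;> omega

set_option maxHeartbeats 1000000 in
theorem hop_main (s r m n k N : ℕ) (hr : 1 ≤ r) (hm : 3 ≤ m) (hk : 1 ≤ k)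
    (hn : n = s + 2 * r + m) (hN : N = (2 * r + m) * k) (hnN : n = 2 * N + 1) :
    HOPSolution n s (r + 1) (fun i => if (i : ℕ) < r then 2 else m) := by
  classical
  obtain ⟨D, x, y, hD, hx, hxd, hyx, hyy⟩ := design k r m N hr hm hk hN
  let σ : ZMod (2 * N + 1) ≃ Fin n :=
    Fintype.equivOfCardEq (by rw [ZMod.card, Fintype.card_fin, hnN])
  let mm : Fin (r + 1) → ℕ := fun i => if (i : ℕ) < r then 2 else m
  change HOPSolution n s (r + 1) mm
  have hsum : ∑ i, mm i = 2 * r + m := by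
    rw [Fin.sum_univ_castSucc]
    simp [mm, mul_comm]
  have hmm1 : ∀ i : Fin (r + 1), (i : ℕ) < r → mm i = 2 := fun i h => by simp only [mm, if_pos h]
  have hmm2 : ∀ i : Fin (r + 1), ¬ (i : ℕ) < r → mm i = m := fun i h => by
    simp only [mm, if_neg h]
  let Idx := Fin k × Fin 2 × Fin 2 × ZMod (2 * N + 1)
  let T := Fin m ⊕ Fin r × Fin 2
  let X : Idx → Fin (r + 1) → ℕ → ZMod (2 * N + 1) := fun q i p =>
    if h : (i : ℕ) < r then
      (if p = 0 then y q.1 q.2.1 ⟨i, h⟩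
        else y q.1 q.2.1 ⟨i, h⟩ + dv (D (q.1, Sum.inr (⟨i, h⟩, q.2.1)))) + q.2.2.2
    else x q.1 p + q.2.2.2
  let A : Idx → Fin (r + 1) → ℕ → Fin 2 := fun q i p =>
    if (i : ℕ) < r then (if p = 0 then 0 else q.2.2.1) else side m p q.2.1 q.2.2.1
  have hX : ∀ q i i' p p', p < mm i → p' < mm i' → X q i p = X q i' p' → i = i' ∧ p = p' := by
    rintro ⟨j, w1, w2, g⟩ i i' p p' hp hp' h
    by_cases hi : (i : ℕ) < r <;> by_cases hi' : (i' : ℕ) < r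
    · rw [hmm1 i hi] at hp
      rw [hmm1 i' hi'] at hp'
      simp only [X, dif_pos hi, dif_pos hi', add_left_inj] at h
      by_cases hii : i = i'
      · subst hii
        refine ⟨rfl, ?_⟩
        have := dv_ne_zero (D (j, Sum.inr (⟨i, hi⟩, w1)))
        split_ifs at h
        · omega
        · exact absurd h.symm (by simpa using this)
        · exact absurd h (by simpa using this)
        · omega
      · exfalso
        have hne : (⟨i, hi⟩ : Fin r) ≠ ⟨i', hi'⟩ := by
          intro h; exact hii (Fin.ext (by simpa using h))
        have a1 := hyy j w1 _ _ hne
        have a2 := hyy j w1 _ _ hne.symm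
        split_ifs at h
        · exact a1.1 h
        · exact a1.2.1 h
        · exact a2.2.1 h.symm
        · exact a1.2.2 h
    · exfalso
      rw [hmm2 i' hi'] at hp'
      simp only [X, dif_pos hi, dif_neg hi', add_left_inj] at h
      have := hyx j w1 ⟨i, hi⟩ p' hp'
      split_ifs at h
      · exact this.1 h
      · exact this.2 h
    · exfalso
      rw [hmm2 i hi] at hp
      simp only [X, dif_neg hi, dif_pos hi', add_left_inj] at h
      have := hyx j w1 ⟨i', hi'⟩ p hp
      split_ifs at h
      · exact this.1 h.symm
      · exact this.2 h.symm
    · rw [hmm2 i hi] at hp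
      rw [hmm2 i' hi'] at hp'
      simp only [X, dif_neg hi, dif_neg hi', add_left_inj] at h
      have h1 := i.2
      have h2 := i'.2
      exact ⟨Fin.ext (by omega), hx j p p' hp hp' h⟩
  have hF : ∀ q : Idx, _ := fun q => exists_factor n s (r + 1) mm
    (fun i => by simp only [mm]; split_ifs <;> omega) (by rw [hsum, hn]; ring)
    (fun i p => σ (X q i p)) (A q)
    (fun i i' p p' hp hp' h => hX q i i' p p' hp hp' (σ.injective h))
  choose F hF using hF
  -- the parameters of the edge in a given slot
  let φ : Idx × T → ZMod (2 * N + 1) × Fin N × Fin 2 × Fin 2 := fun a =>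
    Sum.elim
      (fun i : Fin m =>
        if x a.1.1 ((i.val + 1) % m) = x a.1.1 i.val + dv (D (a.1.1, Sum.inl i)) then
          (x a.1.1 i + a.1.2.2.2, D (a.1.1, Sum.inl i), side m i a.1.2.1 a.1.2.2.1 + 1,
            side m ((i.val + 1) % m) a.1.2.1 a.1.2.2.1)
        else
          (x a.1.1 ((i.val + 1) % m) + a.1.2.2.2, D (a.1.1, Sum.inl i),
            side m ((i.val + 1) % m) a.1.2.1 a.1.2.2.1, side m i a.1.2.1 a.1.2.2.1 + 1))
      (fun b : Fin r × Fin 2 =>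
        (y a.1.1 a.1.2.1 b.1 + a.1.2.2.2, D (a.1.1, Sum.inr (b.1, a.1.2.1)), b.2 + 1,
          a.1.2.2.1 + b.2)) a.2
  have hφ2 : ∀ a, (φ a).2.1 = D (a.1.1, Sum.map id (fun b => (b.1, a.1.2.1)) a.2) := by
    rintro ⟨⟨j, w1, w2, g⟩, i | b⟩
    · simp only [φ, Sum.elim_inl]
      split_ifs <;> rfl
    · rfl
  have hφ : Function.Injective φ := by
    rintro ⟨⟨j, w1, w2, g⟩, t⟩ ⟨⟨j', w1', w2', g'⟩, t'⟩ h
    have h1 := hφ2 ⟨⟨j, w1, w2, g⟩, t⟩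
    rw [h, hφ2] at h1
    have h2 := hD h1
    simp only [Prod.mk.injEq] at h2
    obtain ⟨rfl, h3⟩ := h2
    rcases t with i | ⟨l, b⟩ <;> rcases t' with i' | ⟨l', b'⟩
    · simp only [Sum.map_inl, id, Sum.inl.injEq] at h3
      subst h3
      simp only [φ, Sum.elim_inl] at h
      split_ifs at h
      · simp only [Prod.mk.injEq, add_right_inj, add_left_inj, true_and] at h
        obtain ⟨rfl, h4, h5⟩ := h
        obtain ⟨rfl, rfl⟩ := side_inj m i' hm i'.2 h4 h5
        rfl
      · simp only [Prod.mk.injEq, add_right_inj, add_left_inj, true_and] at h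
        obtain ⟨rfl, h5, h4⟩ := h
        obtain ⟨rfl, rfl⟩ := side_inj m i' hm i'.2 h4 h5
        rfl
    · simp at h3
    · simp at h3
    · simp only [Sum.map_inr, Sum.inr.injEq, Prod.mk.injEq] at h3
      obtain ⟨rfl, rfl⟩ := h3
      simp only [φ, Sum.elim_inr, Prod.mk.injEq, add_right_inj, add_left_inj, true_and] at h
      obtain ⟨rfl, rfl, h5⟩ := h
      simp only [add_left_inj] at h5
      subst h5
      rfl
  have hφb : Function.Bijective φ := by
    rw [Fintype.bijective_iff_injective_and_card]
    refine ⟨hφ, ?_⟩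
    simp only [Idx, T, Fintype.card_prod, Fintype.card_sum, Fintype.card_fin, ZMod.card]
    rw [hN]; ring
  have hedge : ∀ q e, ¬ IsIEdge e → (e ∈ (F q).edges ↔ ∃ t, e = pedge σ (φ (q, t))) := by
    intro q e he
    rw [hF q e he]
    have hcyc : ∀ i : Fin m, s((σ (X q (Fin.last r) i), A q (Fin.last r) i + 1),
        (σ (X q (Fin.last r) ((i.val + 1) % m)), A q (Fin.last r) ((i.val + 1) % m)))
          = pedge σ (φ (q, Sum.inl i)) := by
      intro i
      simp only [X, A, φ, Fin.val_last, lt_irrefl, dif_neg, if_false, not_false_eq_true,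
        Sum.elim_inl]
      split_ifs with h
      · simp only [pedge]
        rw [h, add_right_comm]
      · simp only [pedge]
        have h' := (hxd q.1 i).resolve_left h
        rw [add_right_comm, ← h', Sym2.eq_swap]
    have hpair : ∀ (i : Fin (r + 1)) (hi : (i : ℕ) < r) (b : Fin 2),
        s((σ (X q i b), A q i b + 1), (σ (X q i ((b.val + 1) % 2)), A q i ((b.val + 1) % 2)))
          = pedge σ (φ (q, Sum.inr (⟨i, hi⟩, b))) := by
      intro i hi b
      rcases fin2_cases b with rfl | rfl
      · simp only [X, A, φ, dif_pos hi, if_pos hi, pedge, Sum.elim_inr]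
        rw [add_right_comm, add_zero q.2.2.1]
        rfl
      · simp only [X, A, φ, dif_pos hi, if_pos hi, pedge, Sum.elim_inr]
        rw [Sym2.eq_swap, add_right_comm]
        rfl
    constructor
    · rintro ⟨i, p, hp, rfl⟩
      by_cases hi : (i : ℕ) < r
      · rw [hmm1 i hi] at hp ⊢
        exact ⟨Sum.inr (⟨i, hi⟩, ⟨p, hp⟩), hpair i hi ⟨p, hp⟩⟩
      · rw [hmm2 i hi] at hp ⊢
        have : i = Fin.last r := Fin.ext (by have := i.2; simp only [Fin.val_last]; omega)
        subst this
        exact ⟨Sum.inl ⟨p, hp⟩, hcyc ⟨p, hp⟩⟩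
    · rintro ⟨i | ⟨l, b⟩, rfl⟩
      · refine ⟨Fin.last r, i, ?_, ?_⟩
        · rw [hmm2 _ (by simp)]; exact i.2
        · rw [hmm2 _ (by simp)]; exact (hcyc i).symm
      · refine ⟨l.castSucc, b, ?_, ?_⟩
        · rw [hmm1 _ (by simp)]; exact b.2
        · rw [hmm1 _ (by simp)]; exact (hpair l.castSucc (by simp) b).symm
  let τ : Fin (Fintype.card Idx) ≃ Idx := (Fintype.equivFin Idx).symm
  refine ⟨Fintype.card Idx, ?_, fun a => F (τ a), ?_⟩
  · rw [hsum]
    simp only [Idx, Fintype.card_prod, Fintype.card_fin, ZMod.card]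
    rw [hnN, Nat.add_sub_cancel, hN]; ring
  · intro e h1 h2
    obtain ⟨q, rfl⟩ := pedge_surj σ e h1 h2
    obtain ⟨⟨a, t⟩, rfl⟩ := hφb.2 q
    refine ⟨τ.symm a, ?_, ?_⟩
    · simp only [Equiv.apply_symm_apply]
      exact (hedge a _ h2).2 ⟨t, rfl⟩
    · intro b hb
      obtain ⟨t', ht'⟩ := (hedge (τ b) _ h2).1 hb
      have := hφ (pedge_inj σ ht')
      rw [Equiv.eq_symm_apply]
      exact (congrArg Prod.fst this).symm

/-- Corollary 5.5(i): if `s ≥ 0`, `r ≥ 1`, `m ≥ 3`, `n = s + 2r + m` and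
`n ≡ 1 (mod 2(2r + m))`, then `HOP(2^⟨s⟩, 4^⟨r⟩, 2m)` has a solution. -/
theorem hop_four_tables_mod_one (s r m n : ℕ) (hr : 1 ≤ r) (hm : 3 ≤ m)
    (hn : n = s + 2 * r + m) (hcong : n ≡ 1 [MOD 2 * (2 * r + m)]) :
    HOPSolution n s (r + 1) (fun i => if (i : ℕ) < r then 2 else m) := by
  have hmod := (Nat.modEq_iff_dvd' (by omega : 1 ≤ n)).1 hcong.symm
  obtain ⟨k, hk⟩ := hmod
  have hk1 : 1 ≤ k := by
    rcases Nat.eq_zero_or_pos k with rfl | h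
    · simp only [mul_zero] at hk; omega
    · exact h
  refine hop_main s r m n k ((2 * r + m) * k) hr hm hk1 hn rfl ?_
  rw [← mul_assoc, ← hk]; omega
end
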